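/- Statement (KS) implies statement (Π), where: (KS) is the assertion that for every ε > 0 there exists W such that every finite poset P with w(P) ≥ W satisfies δ(P) > 1/2 − ε; and (Π) is the assertion that for every ε > 0 there exists K such that every finite poset P with π(P) ≥ K satisfies δ(P) > 1/2 − ε. (That is, the Kahn–Saks Conjecture implies the seemingly stronger conjecture with width replaced by the range π.) -/

import Mathlib

open Finset

section Defs
variable (α : Type*) [Fintype α] [PartialOrder α]

/-- Linear extensions of a finite poset `α` with `n` elements: order-preserving
bijections to `Fin n` (representing the target `{1,…,n}`). -/
def LinExt : Type _ :=
  {f : α ≃ Fin (Fintype.card α) // ∀ x y : α, x < y → f x < f y}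

instance : Finite (LinExt α) := by unfold LinExt; infer_instance

noncomputable instance : Fintype (LinExt α) := Fintype.ofFinite _

end Defs

section Defs2
variable {α : Type*} [Fintype α] [PartialOrder α]

/-- the uniform probability `ℙ(E)` of an event `E` on linear extensions -/
noncomputable def Pr (E : LinExt α → Prop) : ℝ :=
  (Nat.card {f : LinExt α // E f} : ℝ) / (Nat.card (LinExt α) : ℝ)

/-- the value `f(x) ∈ {1,…,n}` of a linear extension at `x` -/
def val (f : LinExt α) (x : α) : ℕ := (f.1 x : ℕ) + 1

/-- `ℙ(x ≺ y)`, the probability that `x` precedes `y` in a uniform linear extension -/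
noncomputable def prLT (x y : α) : ℝ := Pr (fun f => val f x < val f y)

/-- the expectation `𝔼 f(x)` for `f` uniform on `E(P)` -/
noncomputable def expec (x : α) : ℝ :=
  (∑ f : LinExt α, (val f x : ℝ)) / (Nat.card (LinExt α) : ℝ)

/-- the variance `Var(f(x))` for `f` uniform on `E(P)` -/
noncomputable def variance (x : α) : ℝ :=
  (∑ f : LinExt α, ((val f x : ℝ) - expec x) ^ 2) / (Nat.card (LinExt α) : ℝ)

/-- the standard deviation `σ(x)` of `f(x)` -/
noncomputable def sigma (x : α) : ℝ := Real.sqrt (variance x)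

/-- `π(x)`: the number of elements of the poset incomparable to `x` -/
noncomputable def piVal (x : α) : ℕ := Nat.card {y : α // ¬ x ≤ y ∧ ¬ y ≤ x}

/-- `q(x) = max_{k ∈ {1,…,n}} ℙ(f(x) = k)` -/
noncomputable def qVal (x : α) : ℝ :=
  ⨆ k : Fin (Fintype.card α), Pr (fun f => val f x = (k : ℕ) + 1)

end Defs2

section LinExts
variable {α : Type*}

open scoped Classical in
/-- The linear arrangements of the finite set `S` in which no `b` with `r b a` comes after `a`. -/
noncomputable def linExts (r : α → α → Prop) (S : Finset α) : Finset (List α) :=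
  (⟨S.val.lists, Multiset.lists_nodup_finset S⟩ : Finset (List α)).filter
    (List.Pairwise fun a b => ¬ r b a)

theorem mem_linExts {r : α → α → Prop} {S : Finset α} {l : List α} :
    l ∈ linExts r S ↔ l.Nodup ∧ (∀ a, a ∈ l ↔ a ∈ S) ∧ l.Pairwise (fun a b => ¬ r b a) := by
  classical
  unfold linExts
  rw [Finset.mem_filter, ← and_assoc]
  refine and_congr_left fun _ => ?_
  rw [Finset.mem_mk, Multiset.mem_lists_iff]
  constructor
  · intro h
    have h' : S.val = (l : Multiset α) := h
    refine ⟨?_, fun a => ?_⟩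
    · rw [← Multiset.coe_nodup, ← h']; exact S.nodup
    · rw [← Finset.mem_val, h']; simp
  · rintro ⟨h1, h2⟩
    change S.val = (l : Multiset α)
    refine (Multiset.Nodup.ext S.nodup (Multiset.coe_nodup.2 h1)).2 fun a => ?_
    simp [h2]

theorem toFinset_of_mem_linExts [DecidableEq α] {r : α → α → Prop} {S : Finset α} {l : List α}
    (h : l ∈ linExts r S) : l.toFinset = S := by
  ext a; simp [(mem_linExts.1 h).2.1]

theorem length_of_mem_linExts {r : α → α → Prop} {S : Finset α} {l : List α}
    (h : l ∈ linExts r S) : l.length = #S := by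
  classical
  rw [← toFinset_of_mem_linExts h, List.toFinset_card_of_nodup (mem_linExts.1 h).1]

/-- The number of linear arrangements of `S` compatible with `r`. -/
noncomputable def numExts (r : α → α → Prop) (S : Finset α) : ℕ := #(linExts r S)

theorem append_mem_linExts [DecidableEq α] {r : α → α → Prop} {S T : Finset α} {l m : List α}
    (hl : l ∈ linExts r S) (hm : m ∈ linExts r T) (hST : Disjoint S T)
    (hr : ∀ a ∈ S, ∀ b ∈ T, ¬ r b a) : l ++ m ∈ linExts r (S ∪ T) := by
  rw [mem_linExts] at *
  obtain ⟨h1, h2, h3⟩ := hl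
  obtain ⟨k1, k2, k3⟩ := hm
  refine ⟨List.nodup_append'.2 ⟨h1, k1, fun a ha hb => ?_⟩, fun a => ?_,
    List.pairwise_append.2 ⟨h3, k3, fun a ha b hb => hr a ((h2 a).1 ha) b ((k2 b).1 hb)⟩⟩
  · exact Finset.disjoint_left.1 hST ((h2 a).1 ha) ((k2 a).1 hb)
  · simp [h2, k2]

theorem numExts_mul_le [DecidableEq α] {r : α → α → Prop} {S T : Finset α} (hST : Disjoint S T)
    (hr : ∀ a ∈ S, ∀ b ∈ T, ¬ r b a) : numExts r S * numExts r T ≤ numExts r (S ∪ T) := by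
  unfold numExts
  rw [← Finset.card_product]
  refine Finset.card_le_card_of_injOn (fun p => p.1 ++ p.2) ?_ ?_
  · rintro ⟨l, m⟩ h
    simp only [coe_product, Set.mem_prod, mem_coe] at h
    exact append_mem_linExts h.1 h.2 hST hr
  · rintro ⟨l, m⟩ h ⟨l', m'⟩ h' heq
    simp only [coe_product, Set.mem_prod, mem_coe] at h h' heq
    have := List.append_inj heq
      ((length_of_mem_linExts h.1).trans (length_of_mem_linExts h'.1).symm)
    simp [this.1, this.2]

theorem map_mem_linExts {β : Type*} [DecidableEq β] {r : α → α → Prop} {r' : β → β → Prop}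
    {S : Finset α} {l : List α} (f : α → β) (hf : Set.InjOn f S)
    (h : ∀ a ∈ S, ∀ b ∈ S, r' (f a) (f b) → r a b) (hl : l ∈ linExts r S) :
    l.map f ∈ linExts r' (S.image f) := by
  rw [mem_linExts] at *
  refine ⟨hl.1.map_on fun a ha b hb => hf ((hl.2.1 a).1 ha) ((hl.2.1 b).1 hb), fun a => ?_, ?_⟩
  · simp [hl.2.1]
  · rw [List.pairwise_map]
    refine List.Pairwise.imp_of_mem (fun {a b} ha hb hr hr' => hr ?_) hl.2.2
    exact h _ ((hl.2.1 b).1 hb) _ ((hl.2.1 a).1 ha) hr'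

theorem List.map_injOn_of_forall_mem {β : Type*} {f : α → β} {s : Set α} (hf : Set.InjOn f s) :
    ∀ {l m : List α}, (∀ a ∈ l, a ∈ s) → (∀ a ∈ m, a ∈ s) → l.map f = m.map f → l = m
  | [], [], _, _, _ => rfl
  | [], _ :: _, _, _, h => by simp at h
  | _ :: _, [], _, _, h => by simp at h
  | a :: l, b :: m, hl, hm, h => by
    simp only [List.map_cons, List.cons.injEq, List.mem_cons, forall_eq_or_imp] at h hl hm
    rw [hf hl.1 hm.1 h.1, map_injOn_of_forall_mem hf hl.2 hm.2 h.2]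

theorem map_injOn_linExts {β : Type*} {r : α → α → Prop} {S : Finset α}
    (f : α → β) (hf : Set.InjOn f S) :
    Set.InjOn (List.map f) (linExts r S : Set (List α)) := by
  intro l hl m hm heq
  have hl' := (mem_linExts.1 hl).2.1
  have hm' := (mem_linExts.1 hm).2.1
  refine List.map_injOn_of_forall_mem hf (fun a ha => (hl' a).1 ha) (fun a ha => (hm' a).1 ha) heq

theorem numExts_le_image {β : Type*} [DecidableEq β] {r : α → α → Prop} {r' : β → β → Prop}
    {S : Finset α} (f : α → β) (hf : Set.InjOn f S)
    (h : ∀ a ∈ S, ∀ b ∈ S, r' (f a) (f b) → r a b) :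
    numExts r S ≤ numExts r' (S.image f) :=
  Finset.card_le_card_of_injOn _ (fun _ hl => map_mem_linExts f hf h hl) (map_injOn_linExts f hf)

theorem numExts_image {β : Type*} [DecidableEq β] {r : α → α → Prop} {r' : β → β → Prop}
    {S : Finset α} (f : α → β) (hf : Set.InjOn f S)
    (h : ∀ a ∈ S, ∀ b ∈ S, r' (f a) (f b) ↔ r a b) :
    numExts r' (S.image f) = numExts r S := by
  classical
  refine le_antisymm ?_ (numExts_le_image f hf fun a ha b hb => (h a ha b hb).1)
  rcases S.eq_empty_or_nonempty with rfl | ⟨a₀, _⟩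
  · refine (Finset.card_le_card_of_injOn (fun _ => []) (fun l hl => ?_) fun l hl m hm _ => ?_)
    · simp [mem_linExts]
    · rw [mem_coe, mem_linExts] at hl hm
      have hl0 : l = [] :=
        List.eq_nil_iff_forall_not_mem.2 fun a ha => by simpa using (hl.2.1 a).1 ha
      have hm0 : m = [] :=
        List.eq_nil_iff_forall_not_mem.2 fun a ha => by simpa using (hm.2.1 a).1 ha
      rw [hl0, hm0]
  · have : Nonempty α := ⟨a₀⟩
    have hinv : ∀ a ∈ S, Function.invFunOn f S (f a) = a := fun a ha =>
      hf.leftInvOn_invFunOn ha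
    have himg : (S.image f).image (Function.invFunOn f S) = S := by
      rw [Finset.image_image]
      exact (Finset.image_congr fun a ha => hinv a ha).trans Finset.image_id
    calc numExts r' (S.image f) ≤ numExts r ((S.image f).image (Function.invFunOn f S)) := by
          refine numExts_le_image _ ?_ ?_
          · intro b hb c hc hbc
            rw [mem_coe, Finset.mem_image] at hb hc
            obtain ⟨b, hb, rfl⟩ := hb
            obtain ⟨c, hc, rfl⟩ := hc
            rw [hinv b hb, hinv c hc] at hbc
            rw [hbc]
          · intro b hb c hc hbc
            rw [Finset.mem_image] at hb hc
            obtain ⟨b, hb, rfl⟩ := hb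
            obtain ⟨c, hc, rfl⟩ := hc
            rw [hinv b hb, hinv c hc] at hbc
            exact (h b hb c hc).2 hbc
      _ = numExts r S := by rw [himg]

end LinExts

section MonoMaps
variable {α : Type*}

theorem exists_pairwise_lt_of_injOn {S : Finset α} {g : α → ℕ} (hg : Set.InjOn g S) :
    ∃ l : List α, l.Nodup ∧ (∀ a, a ∈ l ↔ a ∈ S) ∧ l.Pairwise (fun a b => g a < g b) := by
  let l := S.toList.insertionSort (fun a b => g a ≤ g b)
  have hp : l.Perm S.toList := List.perm_insertionSort _ _
  have hm : ∀ a, a ∈ l ↔ a ∈ S := fun a => by rw [hp.mem_iff, Finset.mem_toList]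
  have hn : l.Nodup := hp.nodup_iff.2 S.nodup_toList
  have hs : l.Pairwise (fun a b => g a ≤ g b) := by
    have : Std.Total (fun a b : α => g a ≤ g b) := ⟨fun a b => le_total _ _⟩
    have : IsTrans α (fun a b : α => g a ≤ g b) := ⟨fun a b c => le_trans⟩
    exact List.pairwise_insertionSort _ _
  refine ⟨l, hn, hm, ?_⟩
  refine (hs.and hn).imp_of_mem fun {a b} ha hb h => lt_of_le_of_ne h.1 fun e => h.2 ?_
  exact hg ((hm a).1 ha) ((hm b).1 hb) e

theorem eq_of_pairwise_lt {l m : List α} {g : α → ℕ} (h : ∀ a, a ∈ l ↔ a ∈ m)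
    (hl : l.Pairwise (fun a b => g a < g b)) (hm : m.Pairwise (fun a b => g a < g b)) : l = m := by
  have hl' : l.Nodup := hl.imp fun h e => by simp [e] at h
  have hm' : m.Nodup := hm.imp fun h e => by simp [e] at h
  refine List.Perm.eq_of_pairwise ?_ hl hm ((List.perm_ext_iff_of_nodup hl' hm').2 h)
  intro a b _ _ h1 h2
  exact absurd h1 h2.not_gt

variable [Fintype α] [DecidableEq α]

open scoped Classical in
/-- The `r`-monotone maps to `{0, …, N}` that are `0` on `I` and `N` off `J`. -/
noncomputable def monoMaps (r : α → α → Prop) (I J : Finset α) (N : ℕ) : Finset (α → ℕ) :=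
  (Fintype.piFinset fun _ => range (N + 1)).filter fun g =>
    (∀ a b, r a b → g a ≤ g b) ∧ (∀ a ∈ I, g a = 0) ∧ ∀ a ∉ J, g a = N

theorem mem_monoMaps {r : α → α → Prop} {I J : Finset α} {N : ℕ} {g : α → ℕ} :
    g ∈ monoMaps r I J N ↔ (∀ a, g a ≤ N) ∧ (∀ a b, r a b → g a ≤ g b) ∧ (∀ a ∈ I, g a = 0) ∧
      ∀ a ∉ J, g a = N := by
  classical
  unfold monoMaps
  simp

theorem card_monoMaps_mul_le (r : α → α → Prop) (I J I' J' : Finset α) (N : ℕ) :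
    #(monoMaps r I J N) * #(monoMaps r I' J' N) ≤
      #(monoMaps r (I ∩ I') (J ∩ J') N) * #(monoMaps r (I ∪ I') (J ∪ J') N) := by
  classical
  rw [mul_comm #(monoMaps r (I ∩ I') (J ∩ J') N)]
  refine (Finset.le_card_infs_mul_card_sups _ _).trans
    (Nat.mul_le_mul (card_le_card ?_) (card_le_card ?_))
  · intro g hg
    obtain ⟨a, ha, b, hb, rfl⟩ := Finset.mem_infs.1 hg
    rw [mem_monoMaps] at *
    refine ⟨fun x => by simp [ha.1 x], fun x y h => ?_, fun x hx => ?_, fun x hx => ?_⟩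
    · exact inf_le_inf (ha.2.1 x y h) (hb.2.1 x y h)
    · rcases Finset.mem_union.1 hx with h | h
      · simp [ha.2.2.1 x h]
      · simp [hb.2.2.1 x h]
    · rw [Finset.mem_union, not_or] at hx
      simp [ha.2.2.2 x hx.1, hb.2.2.2 x hx.2]
  · intro g hg
    obtain ⟨a, ha, b, hb, rfl⟩ := Finset.mem_sups.1 hg
    rw [mem_monoMaps] at *
    refine ⟨fun x => by simp [ha.1 x, hb.1 x], fun x y h => ?_, fun x hx => ?_, fun x hx => ?_⟩
    · exact sup_le_sup (ha.2.1 x y h) (hb.2.1 x y h)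
    · rw [Finset.mem_inter] at hx
      simp [ha.2.2.1 x hx.1, hb.2.2.1 x hx.2]
    · rw [Finset.mem_inter, not_and_or] at hx
      rcases hx with h | h
      · simp [ha.2.2.2 x h, hb.1 x]
      · simp [hb.2.2.2 x h, ha.1 x]

theorem card_injOn_monoMaps_le (r : α → α → Prop) (I J : Finset α) (N : ℕ)
    [DecidablePred fun g : α → ℕ => Set.InjOn g (J \ I : Finset α)] :
    #((monoMaps r I J N).filter fun g => Set.InjOn g (J \ I : Finset α)) ≤
      numExts r (J \ I) * (N + 1).choose #(J \ I) := by
  set D := J \ I with hD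
  have key : ∀ g : α → ℕ, ∃ l : List α, Set.InjOn g D →
      l.Nodup ∧ (∀ a, a ∈ l ↔ a ∈ D) ∧ l.Pairwise (fun a b => g a < g b) := fun g => by
    by_cases hg : Set.InjOn g D
    · obtain ⟨l, hl⟩ := exists_pairwise_lt_of_injOn hg
      exact ⟨l, fun _ => hl⟩
    · exact ⟨[], fun h => absurd h hg⟩
  choose L hL using key
  rw [← card_range (N + 1), ← card_powersetCard, numExts, ← card_product]
  refine card_le_card_of_injOn (fun g => (L g, D.image g)) ?_ ?_
  · intro g hg
    rw [coe_filter, Set.mem_ofPred_eq, mem_monoMaps] at hg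
    obtain ⟨hg, hi⟩ := hg
    obtain ⟨h1, h2, h3⟩ := hL g hi
    simp only [coe_product, Set.mem_prod, mem_coe]
    refine ⟨mem_linExts.2 ⟨h1, h2, h3.imp fun h h' => ?_⟩,
      mem_powersetCard.2 ⟨?_, card_image_of_injOn hi⟩⟩
    · exact absurd h (hg.2.1 _ _ h').not_gt
    · intro x hx
      obtain ⟨a, _, rfl⟩ := mem_image.1 hx
      simpa [Nat.lt_succ_iff] using hg.1 a
  · intro g hg g' hg' heq
    rw [coe_filter, Set.mem_ofPred_eq, mem_monoMaps] at hg hg'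
    obtain ⟨hg, hi⟩ := hg
    obtain ⟨hg', hi'⟩ := hg'
    obtain ⟨h1, h2, h3⟩ := hL g hi
    obtain ⟨h1', h2', h3'⟩ := hL g' hi'
    simp only [Prod.mk.injEq] at heq
    rw [← heq.1] at h1' h2' h3'
    have hmap : (L g).map g = (L g).map g' := by
      refine eq_of_pairwise_lt (g := id) (fun x => ?_) (List.pairwise_map.2 h3)
        (List.pairwise_map.2 h3')
      have := Finset.ext_iff.1 heq.2 x
      simpa [h2] using this
    funext a
    by_cases ha : a ∈ D
    · exact List.map_inj_left.1 hmap a ((h2 a).2 ha)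
    · simp only [hD, mem_sdiff, not_and_or, not_not] at ha
      rcases ha with ha | ha
      · rw [hg.2.2.2 a ha, hg'.2.2.2 a ha]
      · rw [hg.2.2.1 a ha, hg'.2.2.1 a ha]

theorem card_not_injOn_monoMaps_le (r : α → α → Prop) (I J : Finset α) (N : ℕ)
    [DecidablePred fun g : α → ℕ => ¬ Set.InjOn g (J \ I : Finset α)] :
    #((monoMaps r I J N).filter fun g => ¬ Set.InjOn g (J \ I : Finset α)) ≤
      (N + 1) ^ #(J \ I) - (N + 1).descFactorial #(J \ I) := by
  classical
  set D := J \ I with hD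
  have hcard : #((univ : Finset (D → Fin (N + 1))).filter fun g => ¬ Function.Injective g) =
      (N + 1) ^ #D - (N + 1).descFactorial #D := by
    rw [filter_not, card_sdiff_of_subset (filter_subset _ _)]
    congr 1
    · simp
    · rw [← Fintype.card_subtype, Fintype.card_congr (Equiv.subtypeInjectiveEquivEmbedding _ _),
        Fintype.card_embedding_eq]
      simp
  rw [← hcard]
  refine card_le_card_of_injOn (fun g a => Fin.ofNat (N + 1) (g a)) ?_ ?_
  · intro g hg
    rw [coe_filter, Set.mem_ofPred_eq, mem_monoMaps] at hg
    simp only [coe_filter, mem_univ, true_and, Set.mem_ofPred_eq]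
    refine fun hi => hg.2 fun a ha b hb hab => ?_
    have := @hi ⟨a, ha⟩ ⟨b, hb⟩ (by simp [hab])
    simpa using this
  · intro g hg g' hg' heq
    rw [coe_filter, Set.mem_ofPred_eq, mem_monoMaps] at hg hg'
    obtain ⟨hg, -⟩ := hg
    obtain ⟨hg', -⟩ := hg'
    funext a
    by_cases ha : a ∈ D
    · have := congrFun heq ⟨a, ha⟩
      simp only [Fin.ext_iff, Fin.ofNat] at this
      rwa [Nat.mod_eq_of_lt (Nat.lt_succ_iff.2 (hg.1 a)),
        Nat.mod_eq_of_lt (Nat.lt_succ_iff.2 (hg'.1 a))] at this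
    · simp only [hD, mem_sdiff, not_and_or, not_not] at ha
      rcases ha with ha | ha
      · rw [hg.2.2.2 a ha, hg'.2.2.2 a ha]
      · rw [hg.2.2.1 a ha, hg'.2.2.1 a ha]

theorem card_monoMaps_le (r : α → α → Prop) (I J : Finset α) (N : ℕ) :
    #(monoMaps r I J N) ≤ numExts r (J \ I) * (N + 1).choose #(J \ I) +
      ((N + 1) ^ #(J \ I) - (N + 1).descFactorial #(J \ I)) := by
  classical
  rw [← card_filter_add_card_filter_not (fun g : α → ℕ => Set.InjOn g (J \ I : Finset α))]
  exact add_le_add (card_injOn_monoMaps_le r I J N) (card_not_injOn_monoMaps_le r I J N)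

theorem le_card_monoMaps {r : α → α → Prop} {I J : Finset α} (hIJ : I ⊆ J)
    (hI : ∀ a b, r a b → b ∈ I → a ∈ I) (hJ : ∀ a b, r a b → b ∈ J → a ∈ J) (N : ℕ) :
    numExts r (J \ I) * (N + 1).choose #(J \ I) ≤ #(monoMaps r I J N) := by
  classical
  set D := J \ I with hD
  let G : List α × Finset ℕ → α → ℕ := fun q a =>
    if a ∈ I then 0 else if a ∈ J then (q.2.sort (· ≤ ·)).getD (q.1.idxOf a) 0 else N
  have hG : ∀ l ∈ linExts r D, ∀ T ∈ powersetCard #D (range (N + 1)),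
      l.map (G (l, T)) = T.sort (· ≤ ·) := by
    intro l hl T hT
    have hlen := length_of_mem_linExts hl
    rw [mem_linExts] at hl
    rw [mem_powersetCard] at hT
    refine List.ext_getElem (by simp [hlen, hT.2]) fun i h1 h2 => ?_
    rw [List.length_map] at h1
    have hm := (hl.2.1 l[i]).1 (List.getElem_mem h1)
    rw [hD, mem_sdiff] at hm
    rw [List.getElem_map]
    simp only [G, if_neg hm.2, if_pos hm.1, hl.1.idxOf_getElem]
    exact List.getD_eq_getElem _ _ h2
  have hsort : ∀ l ∈ linExts r D, ∀ T ∈ powersetCard #D (range (N + 1)),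
      l.Pairwise (fun a b => G (l, T) a < G (l, T) b) := by
    intro l hl T hT
    rw [← List.pairwise_map, hG l hl T hT]
    exact (Finset.sortedLT_sort T).pairwise
  have hout : ∀ q a, a ∉ D → G q a = 0 ∧ a ∈ I ∨ G q a = N ∧ a ∉ J ∧ a ∉ I := by
    intro q a ha
    simp only [hD, mem_sdiff, not_and_or, not_not] at ha
    by_cases h : a ∈ I
    · simp [G, h]
    · simp [G, h, ha.resolve_right h]
  rw [← card_range (N + 1), ← card_powersetCard, numExts, ← card_product]
  refine card_le_card_of_injOn G ?_ ?_
  · rintro ⟨l, T⟩ h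
    simp only [coe_product, Set.mem_prod, mem_coe] at h
    obtain ⟨hl, hT⟩ := h
    have hs := hsort l hl T hT
    have hm := hG l hl T hT
    rw [mem_linExts] at hl
    rw [mem_powersetCard] at hT
    have hle : ∀ a, G (l, T) a ≤ N := by
      intro a
      by_cases ha : a ∈ D
      · have : G (l, T) a ∈ l.map (G (l, T)) := List.mem_map_of_mem ((hl.2.1 a).2 ha)
        rw [hm, Finset.mem_sort] at this
        simpa [Nat.lt_succ_iff] using hT.1 this
      · rcases hout (l, T) a ha with h | h <;> simp [h.1]
    rw [mem_coe, mem_monoMaps]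
    refine ⟨hle, fun a b hab => ?_, fun a ha => by simp [G, ha], fun a ha => ?_⟩
    · by_cases hb : b ∈ D
      · by_cases ha : a ∈ D
        · by_contra! hlt
          -- `b` precedes `a` in `l`
          obtain ⟨l1, l2, rfl⟩ := List.append_of_mem ((hl.2.1 b).2 hb)
          have hal := (hl.2.1 a).2 ha
          rw [List.mem_append, List.mem_cons] at hal
          rw [List.pairwise_append, List.pairwise_cons] at hs
          rcases hal with h | h | h
          · exact absurd (hs.2.2 a h b (by simp)) hlt.not_gt
          · subst h; exact lt_irrefl _ hlt
          · have := hl.2.2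
            rw [List.pairwise_append, List.pairwise_cons] at this
            exact this.2.1.1 a h hab
        · rcases hout (l, T) a ha with h | h
          · simp [h.1]
          · exact absurd (hJ a b hab (mem_sdiff.1 hb).1) h.2.1
      · rcases hout (l, T) b hb with h | h
        · have := hI a b hab h.2
          simp [G, this]
        · rw [h.1]; exact hle a
    · have : a ∉ I := fun h => ha (hIJ h)
      simp [G, ha, this]
  · rintro ⟨l, T⟩ h ⟨l', T'⟩ h' heq
    simp only [coe_product, Set.mem_prod, mem_coe] at h h'
    have hs := hsort l h.1 T h.2
    have hs' := hsort l' h'.1 T' h'.2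
    rw [heq] at hs
    have hll : l = l' := eq_of_pairwise_lt
      (fun a => by rw [(mem_linExts.1 h.1).2.1, (mem_linExts.1 h'.1).2.1]) hs hs'
    subst hll
    have h1 := hG l h.1 T h.2
    rw [heq, hG l h'.1 T' h'.2] at h1
    have : T' = T := by
      ext x
      rw [← Finset.mem_sort (· ≤ ·), h1, Finset.mem_sort]
    rw [this]

end MonoMaps

section Supermodular

open Filter Topology in
theorem tendsto_choose_div_pow (k : ℕ) :
    Tendsto (fun n : ℕ => (n.choose k : ℝ) / (n : ℝ) ^ k) atTop (𝓝 (1 / (k.factorial : ℝ))) := by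
  have h := isEquivalent_choose k
  have h2 : ∀ᶠ n : ℕ in atTop, (n : ℝ) ^ k / (k.factorial : ℝ) ≠ 0 := by
    filter_upwards [eventually_gt_atTop 0] with n hn
    positivity
  rw [Asymptotics.isEquivalent_iff_tendsto_one h2] at h
  have h3 := h.mul_const (1 / (k.factorial : ℝ))
  rw [one_mul] at h3
  refine h3.congr' ?_
  filter_upwards [eventually_gt_atTop 0] with n hn
  simp only [Pi.div_apply]
  field_simp

open Filter Topology in
theorem tendsto_descFactorial_div_pow (k : ℕ) :
    Tendsto (fun n : ℕ => (n.descFactorial k : ℝ) / (n : ℝ) ^ k) atTop (𝓝 1) := by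
  have h := (tendsto_choose_div_pow k).const_mul (k.factorial : ℝ)
  rw [mul_one_div_cancel (by positivity)] at h
  refine h.congr fun n => ?_
  rw [Nat.descFactorial_eq_factorial_mul_choose]
  push_cast
  ring

open Filter Topology in
theorem le_of_forall_choose_le {e₁ e₂ e₃ e₄ n₁ n₂ n₃ n₄ : ℕ} (hn : n₁ + n₂ = n₃ + n₄)
    (h : ∀ m : ℕ, 0 < m → (e₁ * m.choose n₁) * (e₂ * m.choose n₂) ≤
      (e₃ * m.choose n₃ + (m ^ n₃ - m.descFactorial n₃)) *
        (e₄ * m.choose n₄ + (m ^ n₄ - m.descFactorial n₄))) :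
    e₁ * e₂ * (n₃.factorial * n₄.factorial) ≤ e₃ * e₄ * (n₁.factorial * n₂.factorial) := by
  have hL : ∀ e n : ℕ, Tendsto (fun m : ℕ => (e : ℝ) * ((m.choose n : ℝ) / (m : ℝ) ^ n)) atTop
      (𝓝 (e * (1 / (n.factorial : ℝ)))) := fun e n => (tendsto_choose_div_pow n).const_mul _
  have hR : ∀ e n : ℕ, Tendsto (fun m : ℕ => (e : ℝ) * ((m.choose n : ℝ) / (m : ℝ) ^ n) +
      (1 - (m.descFactorial n : ℝ) / (m : ℝ) ^ n)) atTop (𝓝 (e * (1 / (n.factorial : ℝ)))) := by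
    intro e n
    have := (hL e n).add ((tendsto_descFactorial_div_pow n).const_sub 1)
    simpa using this
  have key := le_of_tendsto_of_tendsto ((hL e₁ n₁).mul (hL e₂ n₂)) ((hR e₃ n₃).mul (hR e₄ n₄)) ?_
  · have p1 : (0 : ℝ) < n₁.factorial := by positivity
    have p2 : (0 : ℝ) < n₂.factorial := by positivity
    have p3 : (0 : ℝ) < n₃.factorial := by positivity
    have p4 : (0 : ℝ) < n₄.factorial := by positivity
    have e1 : (e₁ : ℝ) * (1 / n₁.factorial) * (e₂ * (1 / n₂.factorial)) =
      e₁ * e₂ / (n₁.factorial * n₂.factorial) := by field_simp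
    have e2 : (e₃ : ℝ) * (1 / n₃.factorial) * (e₄ * (1 / n₄.factorial)) =
      e₃ * e₄ / (n₃.factorial * n₄.factorial) := by field_simp
    rw [e1, e2, div_le_div_iff₀ (by positivity) (by positivity)] at key
    exact_mod_cast key
  · filter_upwards [eventually_gt_atTop 0] with m hm
    have hm' : (0 : ℝ) < m := by exact_mod_cast hm
    have h' := (Nat.cast_le (α := ℝ)).2 (h m hm)
    push_cast [Nat.cast_sub (Nat.descFactorial_le_pow m n₃),
      Nat.cast_sub (Nat.descFactorial_le_pow m n₄)] at h'
    have hp : (m : ℝ) ^ n₁ * m ^ n₂ = m ^ n₃ * m ^ n₄ := by rw [← pow_add, ← pow_add, hn]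
    calc _ = ((e₁ * m.choose n₁ : ℝ) * (e₂ * m.choose n₂)) / (m ^ n₁ * m ^ n₂) := by
          field_simp
      _ ≤ ((e₃ * m.choose n₃ + (m ^ n₃ - m.descFactorial n₃) : ℝ) *
        (e₄ * m.choose n₄ + (m ^ n₄ - m.descFactorial n₄))) / (m ^ n₁ * m ^ n₂) := by gcongr
      _ = _ := by
          rw [hp]
          field_simp

theorem numExts_mul_numExts_mul_factorial_le {α : Type*} [Fintype α] [DecidableEq α]
    {r : α → α → Prop} {I J I' J' : Finset α} (hIJ : I ⊆ J) (hIJ' : I' ⊆ J')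
    (hI : ∀ a b, r a b → b ∈ I → a ∈ I) (hJ : ∀ a b, r a b → b ∈ J → a ∈ J)
    (hI' : ∀ a b, r a b → b ∈ I' → a ∈ I') (hJ' : ∀ a b, r a b → b ∈ J' → a ∈ J') :
    numExts r (J \ I) * numExts r (J' \ I') *
        ((#((J ∩ J') \ (I ∩ I'))).factorial * (#((J ∪ J') \ (I ∪ I'))).factorial) ≤
      numExts r ((J ∩ J') \ (I ∩ I')) * numExts r ((J ∪ J') \ (I ∪ I')) *
        ((#(J \ I)).factorial * (#(J' \ I')).factorial) := by
  refine le_of_forall_choose_le ?_ ?_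
  · rw [card_sdiff_of_subset hIJ, card_sdiff_of_subset hIJ',
      card_sdiff_of_subset (inter_subset_inter hIJ hIJ'),
      card_sdiff_of_subset (union_subset_union hIJ hIJ')]
    have h1 := card_union_add_card_inter J J'
    have h2 := card_union_add_card_inter I I'
    have h3 := card_le_card hIJ
    have h4 := card_le_card hIJ'
    have h5 := card_le_card (inter_subset_inter hIJ hIJ')
    have h6 := card_le_card (union_subset_union hIJ hIJ')
    omega
  · intro m hm
    obtain ⟨N, rfl⟩ := Nat.exists_eq_add_of_lt hm
    rw [zero_add]
    exact (Nat.mul_le_mul (le_card_monoMaps hIJ hI hJ N) (le_card_monoMaps hIJ' hI' hJ' N)).trans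
      ((card_monoMaps_mul_le r I J I' J' N).trans
        (Nat.mul_le_mul (card_monoMaps_le r _ _ N) (card_monoMaps_le r _ _ N)))

/-- The strong supermodularity inequality relative to a finite ground set `U`. -/
theorem numExts_mul_numExts_mul_factorial_le_of_subset {α : Type*} [DecidableEq α]
    {r : α → α → Prop} {U I J I' J' : Finset α} (hIJ : I ⊆ J) (hIJ' : I' ⊆ J')
    (hJU : J ⊆ U) (hJU' : J' ⊆ U)
    (hI : ∀ a ∈ U, ∀ b ∈ I, r a b → a ∈ I) (hJ : ∀ a ∈ U, ∀ b ∈ J, r a b → a ∈ J)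
    (hI' : ∀ a ∈ U, ∀ b ∈ I', r a b → a ∈ I') (hJ' : ∀ a ∈ U, ∀ b ∈ J', r a b → a ∈ J') :
    numExts r (J \ I) * numExts r (J' \ I') *
        ((#((J ∩ J') \ (I ∩ I'))).factorial * (#((J ∪ J') \ (I ∪ I'))).factorial) ≤
      numExts r ((J ∩ J') \ (I ∩ I')) * numExts r ((J ∪ J') \ (I ∪ I')) *
        ((#(J \ I)).factorial * (#(J' \ I')).factorial) := by
  let s : Finset α → Finset U := fun S => S.subtype (· ∈ U)
  let r' : U → U → Prop := fun a b => r a b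
  have hs : ∀ S, S ⊆ U → (s S).image Subtype.val = S := by
    intro S hS
    ext a
    simp only [s, mem_image, mem_subtype, Subtype.exists, exists_and_left, exists_prop,
      exists_eq_right_right]
    exact ⟨fun h => h.1, fun h => ⟨h, hS h⟩⟩
  have he : ∀ S, S ⊆ U → numExts r' (s S) = numExts r S := by
    intro S hS
    conv_rhs => rw [← hs S hS]
    exact (numExts_image Subtype.val Subtype.val_injective.injOn fun a _ b _ => Iff.rfl).symm
  have hc : ∀ S, S ⊆ U → #(s S) = #S := by
    intro S hS
    conv_rhs => rw [← hs S hS]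
    exact (card_image_of_injective _ Subtype.val_injective).symm
  have hsub : ∀ S T, S ⊆ T → s S ⊆ s T := fun S T h a ha => by
    simp only [s, mem_subtype] at *; exact h ha
  have hdown : ∀ S, (∀ a ∈ U, ∀ b ∈ S, r a b → a ∈ S) → ∀ a b, r' a b → b ∈ s S → a ∈ s S := by
    intro S h a b hab hb
    simp only [s, mem_subtype] at *
    exact h a a.2 b hb hab
  have hsd : ∀ S T, s (S \ T) = s S \ s T := fun S T => by ext; simp [s]
  have hsi : ∀ S T, s (S ∩ T) = s S ∩ s T := fun S T => by ext; simp [s]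
  have hsu : ∀ S T, s (S ∪ T) = s S ∪ s T := fun S T => by ext; simp [s]
  have u1 : J \ I ⊆ U := sdiff_subset.trans hJU
  have u2 : J' \ I' ⊆ U := sdiff_subset.trans hJU'
  have u3 : (J ∩ J') \ (I ∩ I') ⊆ U := sdiff_subset.trans (inter_subset_left.trans hJU)
  have u4 : (J ∪ J') \ (I ∪ I') ⊆ U := sdiff_subset.trans (union_subset hJU hJU')
  have := numExts_mul_numExts_mul_factorial_le (r := r') (hsub _ _ hIJ) (hsub _ _ hIJ')
    (hdown I hI) (hdown J hJ) (hdown I' hI') (hdown J' hJ')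
  rw [← hsi, ← hsi, ← hsu, ← hsu, ← hsd, ← hsd, ← hsd, ← hsd] at this
  rwa [he _ u1, he _ u2, he _ u3, he _ u4, hc _ u1, hc _ u2, hc _ u3, hc _ u4] at this

theorem factorial_mul_factorial_le {a b c d : ℕ} (h : a + b = c + d) (hca : c ≤ a) (hcb : c ≤ b) :
    a.factorial * b.factorial ≤ c.factorial * d.factorial := by
  obtain ⟨k, rfl⟩ := Nat.exists_eq_add_of_le hca
  obtain rfl : d = b + k := by omega
  clear h hca
  induction k with
  | zero => simp
  | succ k ih =>
    rw [← add_assoc, ← add_assoc, Nat.factorial_succ, Nat.factorial_succ]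
    calc (c + k + 1) * (c + k).factorial * b.factorial
        = (c + k + 1) * ((c + k).factorial * b.factorial) := by ring
      _ ≤ (b + k + 1) * (c.factorial * (b + k).factorial) := by gcongr
      _ = _ := by ring

variable {α : Type*} [Fintype α] [DecidableEq α] {r : α → α → Prop} {I J : Finset α}

theorem numExts_mul_le_inter_union (hI : ∀ a b, r a b → b ∈ I → a ∈ I)
    (hJ : ∀ a b, r a b → b ∈ J → a ∈ J) :
    numExts r I * numExts r J ≤ numExts r (I ∩ J) * numExts r (I ∪ J) := by
  have h := numExts_mul_numExts_mul_factorial_le (r := r) (empty_subset I) (empty_subset J)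
    (by simp) hI (by simp) hJ
  simp only [sdiff_empty, inter_self, union_self] at h
  have hf : (#I).factorial * (#J).factorial ≤ (#(I ∩ J)).factorial * (#(I ∪ J)).factorial :=
    factorial_mul_factorial_le (by rw [add_comm #(I ∩ J), card_union_add_card_inter])
      (card_le_card inter_subset_left) (card_le_card inter_subset_right)
  exact Nat.le_of_mul_le_mul_right (h.trans (Nat.mul_le_mul_left _ hf)) (by positivity)

theorem numExts_compl_mul_le_inter_union (hI : ∀ a b, r a b → b ∈ I → a ∈ I)
    (hJ : ∀ a b, r a b → b ∈ J → a ∈ J) :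
    numExts r Iᶜ * numExts r Jᶜ ≤ numExts r (I ∩ J)ᶜ * numExts r (I ∪ J)ᶜ := by
  have h := numExts_mul_numExts_mul_factorial_le (r := r) (subset_univ I) (subset_univ J)
    hI (by simp) hJ (by simp)
  simp only [inter_self, union_self, ← compl_eq_univ_sdiff] at h
  have hf : (#Iᶜ).factorial * (#Jᶜ).factorial ≤ (#(I ∩ J)ᶜ).factorial * (#(I ∪ J)ᶜ).factorial := by
    have h1 := card_union_add_card_inter I J
    have h2 := card_le_card (subset_univ (I ∪ J))
    rw [mul_comm (#(I ∩ J)ᶜ).factorial]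
    refine factorial_mul_factorial_le ?_ (card_le_card (by simp)) (card_le_card (by simp))
    have h3 := card_le_card (subset_univ I)
    have h4 := card_le_card (subset_univ J)
    have h5 := card_le_card (subset_univ (I ∩ J))
    rw [card_univ] at *
    rw [card_compl, card_compl, card_compl, card_compl]
    omega
  exact Nat.le_of_mul_le_mul_right (h.trans (Nat.mul_le_mul_left _ hf)) (by positivity)

end Supermodular

section Paths

/-- The precedence relation on the steps of a lattice path: `inl i` is the step to the right
leaving column `i`, `inr j` the step up leaving row `j`, and `c j i` says that the `j`-th step up
precedes the `i`-th step to the right. -/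
def pathRel (c : ℕ → ℕ → Prop) : ℕ ⊕ ℕ → ℕ ⊕ ℕ → Prop
  | .inl i, .inl j => i < j
  | .inr i, .inr j => i < j
  | .inr j, .inl i => c j i
  | .inl _, .inr _ => False

/-- The steps of a lattice path from `z` to `w`. -/
def pathSeg (z w : ℕ × ℕ) : Finset (ℕ ⊕ ℕ) := (Ico z.1 w.1).disjSum (Ico z.2 w.2)

/-- The number of admissible lattice paths from `z` to `w`. -/
noncomputable def numPaths (c : ℕ → ℕ → Prop) (z w : ℕ × ℕ) : ℕ :=
  numExts (pathRel c) (pathSeg z w)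

/-- The point `z` can be passed by an admissible path. -/
def Passable (c : ℕ → ℕ → Prop) (z : ℕ × ℕ) : Prop := ∀ i < z.1, ∀ j, c j i → j < z.2

@[simp] theorem inl_mem_pathSeg {z w : ℕ × ℕ} {i : ℕ} :
    Sum.inl i ∈ pathSeg z w ↔ z.1 ≤ i ∧ i < w.1 := by simp [pathSeg]

@[simp] theorem inr_mem_pathSeg {z w : ℕ × ℕ} {i : ℕ} :
    Sum.inr i ∈ pathSeg z w ↔ z.2 ≤ i ∧ i < w.2 := by simp [pathSeg]

theorem card_pathSeg (z w : ℕ × ℕ) : #(pathSeg z w) = (w.1 - z.1) + (w.2 - z.2) := by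
  simp [pathSeg]

theorem pathSeg_union {z w v : ℕ × ℕ} (h1 : z ≤ w) (h2 : w ≤ v) :
    pathSeg z w ∪ pathSeg w v = pathSeg z v := by
  rw [Prod.le_def] at h1 h2
  ext (i | i) <;> simp <;> omega

theorem pathSeg_disjoint (z w v : ℕ × ℕ) : Disjoint (pathSeg z w) (pathSeg w v) := by
  rw [Finset.disjoint_left]
  rintro (i | i) <;> simp <;> omega

variable {c : ℕ → ℕ → Prop}

theorem not_pathRel_of_mem {z w v : ℕ × ℕ} (hw : Passable c w) :
    ∀ a ∈ pathSeg z w, ∀ b ∈ pathSeg w v, ¬ pathRel c b a := by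
  rintro (i | i) ha (j | j) hb <;> simp [pathRel] at *
  · omega
  · intro h; have := hw i ha.2 j h; omega
  · omega

theorem numPaths_mul_le {z w v : ℕ × ℕ} (hw : Passable c w) (h1 : z ≤ w) (h2 : w ≤ v) :
    numPaths c z w * numPaths c w v ≤ numPaths c z v := by
  unfold numPaths
  rw [← pathSeg_union h1 h2]
  exact numExts_mul_le (pathSeg_disjoint z w v) (not_pathRel_of_mem hw)

theorem one_le_numPaths_step (p h : ℕ) : 1 ≤ numPaths c (p, h) (p + 1, h + 1) := by
  unfold numPaths numExts
  refine Finset.card_pos.2 ⟨[Sum.inr h, Sum.inl p], mem_linExts.2 ⟨by simp, ?_, by simp [pathRel]⟩⟩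
  rintro (i | i) <;> simp <;> omega

theorem one_le_numPaths_up (z : ℕ × ℕ) (s : ℕ) : 1 ≤ numPaths c z (z.1, z.2 + s) := by
  unfold numPaths numExts
  refine Finset.card_pos.2 ⟨(List.range' z.2 s).map Sum.inr, mem_linExts.2 ⟨?_, ?_, ?_⟩⟩
  · exact (List.nodup_range').map Sum.inr_injective
  · rintro (i | i) <;> simp
  · rw [List.pairwise_map]
    refine (List.pairwise_lt_range' (s := z.2) (n := s)).imp fun {a b} h => ?_
    simp only [pathRel]; omega

theorem Passable.up {z : ℕ × ℕ} (hz : Passable c z) (s : ℕ) : Passable c (z.1, z.2 + s) :=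
  fun i hi j hj => (hz i hi j hj).trans_le (Nat.le_add_right _ _)

theorem numPaths_le_shift (hc : ∀ i j s, c (j + s) i → c j i) (z w : ℕ × ℕ) (s : ℕ) :
    numPaths c z w ≤ numPaths c (z.1, z.2 + s) (w.1, w.2 + s) := by
  have hinj : Function.Injective (Sum.map id (· + s) : ℕ ⊕ ℕ → ℕ ⊕ ℕ) :=
    Sum.map_injective.2 ⟨Function.injective_id, add_left_injective s⟩
  have himg : (pathSeg z w).image (Sum.map id (· + s)) =
      pathSeg (z.1, z.2 + s) (w.1, w.2 + s) := by
    ext (i | i)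
    · simp
    · simp only [mem_image, Sum.exists, inl_mem_pathSeg, Sum.map_inl, inr_mem_pathSeg,
        Sum.map_inr, Sum.inr.injEq]
      constructor
      · rintro (⟨a, _, h⟩ | ⟨a, h1, rfl⟩)
        · simp at h
        · omega
      · intro h
        exact Or.inr ⟨i - s, by omega, by omega⟩
  unfold numPaths
  rw [← himg]
  refine numExts_le_image _ hinj.injOn ?_
  rintro (a | a) _ (b | b) _ <;> simp [pathRel]
  exact hc _ _ _

theorem numPaths_mul_mul_factorial_le {z t t' w : ℕ × ℕ} (hz : Passable c z) (ht : Passable c t)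
    (ht' : Passable c t') (hw : Passable c w) (h1 : z ≤ t) (h2 : t ≤ t') (h3 : t' ≤ w) :
    numPaths c z w * numPaths c t t' *
        ((#(pathSeg z t')).factorial * (#(pathSeg t w)).factorial) ≤
      numPaths c z t' * numPaths c t w *
        ((#(pathSeg z w)).factorial * (#(pathSeg t t')).factorial) := by
  have hsd : ∀ x y : ℕ × ℕ, x ≤ y → pathSeg 0 y \ pathSeg 0 x = pathSeg x y := by
    intro x y hxy
    rw [Prod.le_def] at hxy
    ext (i | i) <;> simp <;> omega
  have hsub : ∀ x y : ℕ × ℕ, x ≤ y → pathSeg 0 x ⊆ pathSeg 0 y := by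
    intro x y hxy
    rw [Prod.le_def] at hxy
    rintro (i | i) <;> simp <;> omega
  have hdown : ∀ x : ℕ × ℕ, Passable c x → ∀ a ∈ pathSeg 0 w, ∀ b ∈ pathSeg 0 x,
      pathRel c a b → a ∈ pathSeg 0 x := by
    rintro x hx (i | i) _ (j | j) hb <;> simp [pathRel] at *
    · omega
    · exact hx j hb i
    · omega
  have := numExts_mul_numExts_mul_factorial_le_of_subset (r := pathRel c)
    (hsub z w (h1.trans (h2.trans h3))) (hsub t t' h2) (U := pathSeg 0 w) subset_rfl
    (hsub t' w h3) (hdown z hz) (hdown w hw) (hdown t ht) (hdown t' ht')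
  rw [inter_eq_right.2 (hsub t' w h3), inter_eq_left.2 (hsub z t h1),
    union_eq_left.2 (hsub t' w h3), union_eq_right.2 (hsub z t h1),
    hsd _ _ (h1.trans (h2.trans h3)), hsd _ _ h2, hsd _ _ (h1.trans h2),
    hsd _ _ (h2.trans h3)] at this
  exact this

open scoped Classical in
/-- The admissible paths from `0` to `e` with a corner at `z`: a step up at `z` followed by a step
to the right. -/
noncomputable def cornerPaths (c : ℕ → ℕ → Prop) (e : ℕ × ℕ) (z : ℕ × ℕ) :
    Finset (List (ℕ ⊕ ℕ)) :=
  (linExts (pathRel c) (pathSeg 0 e)).filter fun l =>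
    ∃ l₁ l₂, l = l₁ ++ Sum.inr z.2 :: Sum.inl z.1 :: l₂

theorem corner_split {z w : ℕ × ℕ} {l l₁ l₂ : List (ℕ ⊕ ℕ)} {p h : ℕ}
    (hl : l ∈ linExts (pathRel c) (pathSeg z w)) (hz : Passable c z) (hw : Passable c w)
    (heq : l = l₁ ++ .inr h :: .inl p :: l₂) :
    l₁ ∈ linExts (pathRel c) (pathSeg z (p, h)) ∧
      l₂ ∈ linExts (pathRel c) (pathSeg (p + 1, h + 1) w) ∧ z ≤ (p, h) ∧ (p + 1, h + 1) ≤ w ∧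
      Passable c (p, h) ∧ Passable c (p + 1, h + 1) := by
  subst heq
  rw [mem_linExts] at hl
  obtain ⟨hn, hm, hp⟩ := hl
  rw [List.nodup_append', List.nodup_cons, List.nodup_cons] at hn
  obtain ⟨hn1, ⟨hnh, hnp, hn2⟩, hdis⟩ := hn
  rw [List.pairwise_append, List.pairwise_cons, List.pairwise_cons] at hp
  obtain ⟨hp1, ⟨hph, hpp, hp2⟩, hp12⟩ := hp
  have hh := (hm (.inr h)).1 (by simp)
  have hpm := (hm (.inl p)).1 (by simp)
  rw [inr_mem_pathSeg] at hh
  rw [inl_mem_pathSeg] at hpm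
  have hnh1 : Sum.inr h ∉ l₁ := fun hx => hdis hx (by simp)
  have hnp1 : Sum.inl p ∉ l₁ := fun hx => hdis hx (by simp)
  -- position of each step relative to the corner
  have L1 : ∀ i, Sum.inl i ∈ l₁ → z.1 ≤ i ∧ i < p := fun i hi => by
    have h1 := (hm (.inl i)).1 (by simp [hi])
    have h2 := hp12 _ hi (.inl p) (by simp)
    rw [inl_mem_pathSeg] at h1
    simp only [pathRel] at h2
    have : i ≠ p := fun e => hnp1 (e ▸ hi)
    omega
  have L2 : ∀ i, Sum.inl i ∈ l₂ → p < i ∧ i < w.1 := fun i hi => by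
    have h1 := (hm (.inl i)).1 (by simp [hi])
    have h2 := hpp _ hi
    rw [inl_mem_pathSeg] at h1
    simp only [pathRel] at h2
    have : i ≠ p := fun e => hnp (e ▸ hi)
    omega
  have R1 : ∀ i, Sum.inr i ∈ l₁ → z.2 ≤ i ∧ i < h := fun i hi => by
    have h1 := (hm (.inr i)).1 (by simp [hi])
    have h2 := hp12 _ hi (.inr h) (by simp)
    rw [inr_mem_pathSeg] at h1
    simp only [pathRel] at h2
    have : i ≠ h := fun e => hnh1 (e ▸ hi)
    omega
  have R2 : ∀ i, Sum.inr i ∈ l₂ → h < i ∧ i < w.2 := fun i hi => by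
    have h1 := (hm (.inr i)).1 (by simp [hi])
    have h2 := hph (.inr i) (by simp [hi])
    rw [inr_mem_pathSeg] at h1
    simp only [pathRel] at h2
    have : i ≠ h := fun e => hnh (by simp [← e, hi])
    omega
  have M1 : ∀ a, a ∈ l₁ ↔ a ∈ pathSeg z (p, h) := by
    rintro (i | i)
    · refine ⟨fun hi => by simpa using L1 i hi, fun hi => ?_⟩
      simp only [inl_mem_pathSeg] at hi
      have := (hm (.inl i)).2 (by simp; omega)
      simp only [List.mem_append, List.mem_cons, Sum.inl.injEq, reduceCtorEq, false_or] at this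
      rcases this with h | h | h
      · exact h
      · omega
      · have := L2 i h; omega
    · refine ⟨fun hi => by simpa using R1 i hi, fun hi => ?_⟩
      simp only [inr_mem_pathSeg] at hi
      have := (hm (.inr i)).2 (by simp; omega)
      simp only [List.mem_append, List.mem_cons, Sum.inr.injEq, reduceCtorEq, false_or] at this
      rcases this with h | h | h
      · exact h
      · omega
      · have := R2 i h; omega
  have M2 : ∀ a, a ∈ l₂ ↔ a ∈ pathSeg (p + 1, h + 1) w := by
    rintro (i | i)
    · refine ⟨fun hi => by simpa [Nat.succ_le_iff] using L2 i hi, fun hi => ?_⟩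
      simp only [inl_mem_pathSeg] at hi
      have := (hm (.inl i)).2 (by simp; omega)
      simp only [List.mem_append, List.mem_cons, Sum.inl.injEq, reduceCtorEq, false_or] at this
      rcases this with h | h | h
      · have := L1 i h; omega
      · omega
      · exact h
    · refine ⟨fun hi => by simpa [Nat.succ_le_iff] using R2 i hi, fun hi => ?_⟩
      simp only [inr_mem_pathSeg] at hi
      have := (hm (.inr i)).2 (by simp; omega)
      simp only [List.mem_append, List.mem_cons, Sum.inr.injEq, reduceCtorEq, false_or] at this
      rcases this with h | h | h
      · have := R1 i h; omega
      · omega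
      · exact h
  have hv : Passable c (p, h) := by
    intro i hi j hj
    by_contra! hlt
    simp only at hi hlt
    by_cases hiz : i < z.1
    · have := hz i hiz j hj; omega
    · have hjw := hw i (by omega) j hj
      have hi1 := (M1 (.inl i)).2 (by simp; omega)
      rcases hlt.eq_or_lt with rfl | hlt
      · exact hp12 _ hi1 (.inr h) (by simp) hj
      · have hj2 := (M2 (.inr j)).2 (by simp; omega)
        exact hp12 _ hi1 (.inr j) (by simp [hj2]) hj
  refine ⟨mem_linExts.2 ⟨hn1, M1, hp1⟩, mem_linExts.2 ⟨hn2, M2, hp2⟩, by simp [Prod.le_def]; omega,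
    by simp [Prod.le_def]; omega, hv, ?_⟩
  intro i hi j hj
  simp only at hi ⊢
  rcases (Nat.lt_succ_iff.1 hi).eq_or_lt with rfl | hi
  · by_contra! hlt
    have hjw := hw i (by omega) j hj
    have hj2 := (M2 (.inr j)).2 (by simp; omega)
    exact hpp _ hj2 hj
  · exact (hv i hi j hj).trans (Nat.lt_succ_self _)

theorem List.append_cons_inj_of_nodup {α : Type*} {a : α} {x x' z z' : List α}
    (hn : (x ++ a :: z).Nodup) (h : x ++ a :: z = x' ++ a :: z') : x = x' ∧ z = z' := by
  rw [List.nodup_append', List.nodup_cons] at hn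
  have := (List.append_cons_inj_of_notMem (fun h => hn.2.2 h (by simp)) hn.2.1.1).1 h
  exact ⟨this.1, this.2.2⟩

theorem mem_cornerPaths {e z : ℕ × ℕ} {l : List (ℕ ⊕ ℕ)} : l ∈ cornerPaths c e z ↔
    l ∈ linExts (pathRel c) (pathSeg 0 e) ∧
      ∃ l₁ l₂, l = l₁ ++ Sum.inr z.2 :: Sum.inl z.1 :: l₂ := by
  classical
  unfold cornerPaths
  rw [mem_filter]

theorem mul_le_card_cornerPaths {e : ℕ × ℕ} {p h : ℕ} (h1 : Passable c (p, h))
    (h2 : Passable c (p + 1, h + 1)) (he : (p + 1, h + 1) ≤ e) :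
    numPaths c 0 (p, h) * numPaths c (p + 1, h + 1) e ≤ #(cornerPaths c e (p, h)) := by
  unfold numPaths numExts
  rw [← Finset.card_product]
  have hstep : [Sum.inr h, Sum.inl p] ∈
      linExts (pathRel c) (pathSeg (p, h) (p + 1, h + 1)) := by
    refine mem_linExts.2 ⟨by simp, ?_, by simp [pathRel]⟩
    rintro (i | i) <;> simp <;> omega
  have hle : (p, h) ≤ (p + 1, h + 1) := by simp [Prod.le_def]
  refine Finset.card_le_card_of_injOn
    (fun q => (q.1 ++ [Sum.inr h, Sum.inl p]) ++ q.2) ?_ ?_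
  · rintro ⟨l, m⟩ hlm
    simp only [coe_product, Set.mem_prod, mem_coe] at hlm
    have k1 := append_mem_linExts hlm.1 hstep (pathSeg_disjoint _ _ _) (not_pathRel_of_mem h1)
    rw [pathSeg_union (by simp) hle] at k1
    have k2 := append_mem_linExts k1 hlm.2 (pathSeg_disjoint _ _ _) (not_pathRel_of_mem h2)
    rw [pathSeg_union (by simp) he] at k2
    exact mem_cornerPaths.2 ⟨k2, l, m, by simp⟩
  · rintro ⟨l, m⟩ hl ⟨l', m'⟩ hl' heq
    simp only [coe_product, Set.mem_prod, mem_coe] at hl hl' heq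
    have := List.append_inj heq (by
      simp [length_of_mem_linExts hl.1, length_of_mem_linExts hl'.1])
    simpa using this

theorem cornerPaths_disjoint {e : ℕ × ℕ} {p h h' : ℕ} (hh : h ≠ h') :
    Disjoint (cornerPaths c e (p, h)) (cornerPaths c e (p, h')) := by
  rw [Finset.disjoint_left]
  intro l hl hl'
  obtain ⟨hl, l₁, l₂, h1⟩ := mem_cornerPaths.1 hl
  obtain ⟨-, m₁, m₂, h2⟩ := mem_cornerPaths.1 hl'
  have hn := (mem_linExts.1 hl).1
  have e1 : l = (l₁ ++ [Sum.inr h]) ++ Sum.inl p :: l₂ := by simp [h1]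
  have e2 : l = (m₁ ++ [Sum.inr h']) ++ Sum.inl p :: m₂ := by simp [h2]
  have := (List.append_cons_inj_of_nodup (e1 ▸ hn) (e1.symm.trans e2)).1
  exact hh (by simpa using congrArg List.getLast? this)

theorem sum_numPaths_mul_le {e : ℕ × ℕ} {p h S : ℕ} (h1 : Passable c (p, h))
    (h2 : Passable c (p + 1, h + 1)) (he : (p + 1, h + S + 1) ≤ e) :
    ∑ s ∈ range (S + 1), numPaths c 0 (p, h + s) * numPaths c (p + 1, h + s + 1) e ≤
      numPaths c 0 e := by
  classical
  calc _ ≤ ∑ s ∈ range (S + 1), #(cornerPaths c e (p, h + s)) := by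
        refine sum_le_sum fun s hs => ?_
        rw [mem_range] at hs
        have h2' := h2.up s
        simp only [add_right_comm _ 1 s] at h2'
        refine mul_le_card_cornerPaths (h1.up s) h2' (le_trans ?_ he)
        simp [Prod.le_def]; omega
    _ = #((range (S + 1)).biUnion fun s => cornerPaths c e (p, h + s)) := by
        rw [card_biUnion]
        intro s _ t _ hst
        exact cornerPaths_disjoint (by omega)
    _ ≤ _ := by
        unfold numPaths numExts
        refine card_le_card fun l hl => ?_
        obtain ⟨s, -, hs⟩ := mem_biUnion.1 hl
        exact (mem_cornerPaths.1 hs).1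

theorem corner_split_two {e : ℕ × ℕ} {p h p' h' : ℕ} {l : List (ℕ ⊕ ℕ)} (he : Passable c e)
    (hh : h < h') (hl : l ∈ cornerPaths c e (p, h)) (hl' : l ∈ cornerPaths c e (p', h')) :
    ∃ l₁ l₂ l₃, l = l₁ ++ .inr h :: .inl p :: (l₂ ++ .inr h' :: .inl p' :: l₃) := by
  obtain ⟨hl, l₁, m, h1⟩ := mem_cornerPaths.1 hl
  obtain ⟨-, m₁, m₂, h2⟩ := mem_cornerPaths.1 hl'
  have h0 : Passable c 0 := fun i hi => by simp at hi
  obtain ⟨-, k2, -, -, -, -⟩ := corner_split hl h0 he h1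
  obtain ⟨-, -, -, k4, -, -⟩ := corner_split hl h0 he h2
  rw [Prod.le_def] at k4
  have hmem : Sum.inr h' ∈ m := ((mem_linExts.1 k2).2.1 _).2 (by simp at k4 ⊢; omega)
  obtain ⟨l₂, m', rfl⟩ := List.append_of_mem hmem
  have hn := (mem_linExts.1 hl).1
  simp only at h1 h2
  have e1 : l = (l₁ ++ .inr h :: .inl p :: l₂) ++ Sum.inr h' :: m' := by simp [h1]
  have := List.append_cons_inj_of_nodup (e1 ▸ hn) (e1.symm.trans h2)
  exact ⟨l₁, l₂, m₂, by rw [h1, this.2]⟩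

theorem card_cornerPaths_inter_le {e : ℕ × ℕ} {p h p' h' : ℕ} (he : Passable c e)
    (hh : h < h') : #(cornerPaths c e (p, h) ∩ cornerPaths c e (p', h')) ≤
      numPaths c 0 (p, h) * numPaths c (p + 1, h + 1) (p', h') *
        numPaths c (p' + 1, h' + 1) e := by
  classical
  have key : ∀ l : List (ℕ ⊕ ℕ), ∃ q : (List (ℕ ⊕ ℕ) × List (ℕ ⊕ ℕ)) × List (ℕ ⊕ ℕ),
      l ∈ cornerPaths c e (p, h) ∩ cornerPaths c e (p', h') →
      l = q.1.1 ++ .inr h :: .inl p :: (q.1.2 ++ .inr h' :: .inl p' :: q.2) := by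
    intro l
    by_cases hl : l ∈ cornerPaths c e (p, h) ∩ cornerPaths c e (p', h')
    · obtain ⟨l₁, l₂, l₃, h⟩ := corner_split_two he hh (mem_inter.1 hl).1 (mem_inter.1 hl).2
      exact ⟨((l₁, l₂), l₃), fun _ => h⟩
    · exact ⟨(([], []), []), fun h => absurd h hl⟩
  choose f hf using key
  unfold numPaths numExts
  rw [← Finset.card_product, ← Finset.card_product]
  refine Finset.card_le_card_of_injOn f (fun l hl => ?_) fun l hl m hm heq => ?_
  · have h0 : Passable c 0 := fun i hi => by simp at hi
    rw [mem_coe] at hl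
    have hl' := (mem_cornerPaths.1 (mem_inter.1 hl).1).1
    obtain ⟨k1, k2, -, -, -, k6⟩ := corner_split hl' h0 he (hf l hl)
    obtain ⟨k3, k4, -⟩ := corner_split k2 k6 he rfl
    simp [k1, k3, k4]
  · rw [hf l hl, hf m hm, heq]

theorem passable_of_mem_cornerPaths {e : ℕ × ℕ} {p h : ℕ} {l : List (ℕ ⊕ ℕ)} (he : Passable c e)
    (hl : l ∈ cornerPaths c e (p, h)) :
    Passable c (p, h) ∧ Passable c (p + 1, h + 1) ∧ (p + 1, h + 1) ≤ e := by
  obtain ⟨hl, l₁, m, h1⟩ := mem_cornerPaths.1 hl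
  obtain ⟨-, -, -, k1, k2, k3⟩ := corner_split hl (fun i hi => by simp at hi) he h1
  exact ⟨k2, k3, k1⟩

theorem lt_of_mem_cornerPaths {e : ℕ × ℕ} {p h p' h' : ℕ} {l : List (ℕ ⊕ ℕ)} (he : Passable c e)
    (hh : h < h') (hl : l ∈ cornerPaths c e (p, h)) (hl' : l ∈ cornerPaths c e (p', h')) :
    p < p' := by
  obtain ⟨l₁, l₂, l₃, heq⟩ := corner_split_two he hh hl hl'
  obtain ⟨-, k2, -, -, -, k6⟩ :=
    corner_split (mem_cornerPaths.1 hl).1 (fun i hi => by simp at hi) he heq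
  obtain ⟨-, -, k, -⟩ := corner_split k2 k6 he rfl
  exact k.1

end Paths

section Clique

/-- A Ramsey bound: a graph on `T ^ q` vertices has a clique of size `T` or an independent set of
size `q + 1`. -/
theorem exists_clique_or_indep {α : Type*} {R : α → α → Prop} (hR : ∀ a b, R a b → R b a) (T q : ℕ)
    (V : Finset α) (hV : T ^ q ≤ #V) (hV' : 0 < #V) :
    (∃ s ⊆ V, #s = T ∧ (s : Set α).Pairwise R) ∨
      ∃ s ⊆ V, #s = q + 1 ∧ (s : Set α).Pairwise fun a b => ¬ R a b := by
  classical
  induction q generalizing V with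
  | zero =>
    obtain ⟨v, hv⟩ := card_pos.1 hV'
    exact Or.inr ⟨{v}, by simpa using hv, by simp, by simp⟩
  | succ q ih =>
    rcases Nat.eq_zero_or_pos T with rfl | hT
    · exact Or.inl ⟨∅, by simp, by simp, by simp⟩
    by_cases hex : ∃ v ∈ V, T ^ q ≤ #({u ∈ V | u ≠ v ∧ ¬ R v u})
    · obtain ⟨v, hv, hcard⟩ := hex
      rcases ih _ hcard ((Nat.pow_pos hT).trans_le hcard) with ⟨s, hs, h⟩ | ⟨s, hs, h1, h2⟩
      · exact Or.inl ⟨s, hs.trans (filter_subset _ _), h⟩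
      · have hvs : ∀ u ∈ s, u ∈ V ∧ u ≠ v ∧ ¬ R v u := fun u hu => mem_filter.1 (hs hu)
        refine Or.inr ⟨insert v s, insert_subset hv (hs.trans (filter_subset _ _)), ?_, ?_⟩
        · rw [card_insert_of_notMem (fun h => (hvs v h).2.1 rfl), h1]
        · rw [coe_insert]
          exact h2.insert fun u hu _ => ⟨(hvs u hu).2.2, fun h => (hvs u hu).2.2 (hR _ _ h)⟩
    · push Not at hex
      left
      suffices H : ∀ k ≤ T, ∃ s ⊆ V, #s = k ∧ (s : Set α).Pairwise R from H T le_rfl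
      intro k
      induction k with
      | zero => exact fun _ => ⟨∅, by simp, by simp, by simp⟩
      | succ k ihk =>
        intro hk
        obtain ⟨s, hs, hsk, hsp⟩ := ihk (by omega)
        have hlt : #(s.biUnion fun v => {u ∈ V | u = v ∨ ¬ R v u}) < #V := by
          calc _ ≤ #s * T ^ q := by
                refine card_biUnion_le_card_mul _ _ _ fun v hv => ?_
                calc _ ≤ #(insert v {u ∈ V | u ≠ v ∧ ¬ R v u}) := by
                      refine card_le_card fun u hu => ?_
                      simp only [mem_filter, mem_insert] at hu ⊢
                      tauto
                  _ ≤ _ := (card_insert_le _ _).trans (hex v (hs hv))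
            _ < T ^ (q + 1) := by
                rw [hsk, pow_succ, mul_comm]
                exact Nat.mul_lt_mul_of_pos_left (by omega) (Nat.pow_pos hT)
            _ ≤ _ := hV
        obtain ⟨u, huV, hu⟩ := exists_mem_notMem_of_card_lt_card hlt
        have hu' : ∀ v ∈ s, u ≠ v ∧ R v u := fun v hv => by
          by_contra hcon
          exact hu (mem_biUnion.2 ⟨v, hv, mem_filter.2 ⟨huV, by tauto⟩⟩)
        refine ⟨insert u s, insert_subset huV hs, ?_, ?_⟩
        · rw [card_insert_of_notMem (fun h => (hu' u h).1 rfl), hsk]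
        · rw [coe_insert]
          exact hsp.insert fun v hv _ => ⟨hR _ _ (hu' v hv).2, (hu' v hv).2⟩

/-- Large sets whose pairwise intersections are small are few. -/
theorem card_mul_le_of_inter_small {ι α : Type*} [DecidableEq α] {Ω : Finset α}
    (s : Finset ι) (C : ι → Finset α) (η : ℝ) (hη : 0 ≤ η) (hΩ : 0 < #Ω)
    (hC : ∀ i ∈ s, C i ⊆ Ω) (hb : ∀ i ∈ s, η * #Ω ≤ #(C i))
    (hsm : (s : Set ι).Pairwise fun i j => ¬ η ^ 2 / 2 * #Ω ≤ #(C i ∩ C j)) :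
    #s * η ^ 2 ≤ 2 := by
  classical
  have hM : (0 : ℝ) < #Ω := by exact_mod_cast hΩ
  set M : ℝ := (#Ω : ℝ)
  have hdeg : ∀ t : Finset α, t ⊆ Ω → (#t : ℝ) = ∑ a ∈ Ω, if a ∈ t then (1 : ℝ) else 0 := by
    intro t ht
    rw [sum_boole, filter_mem_eq_inter, inter_eq_right.2 ht]
  have h1 : (∑ i ∈ s, (#(C i) : ℝ)) = ∑ a ∈ Ω, ∑ i ∈ s, if a ∈ C i then (1 : ℝ) else 0 := by
    rw [sum_comm]
    exact sum_congr rfl fun i hi => hdeg _ (hC i hi)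
  have h2 : (∑ i ∈ s, ∑ j ∈ s, (#(C i ∩ C j) : ℝ)) =
      ∑ a ∈ Ω, (∑ i ∈ s, if a ∈ C i then (1 : ℝ) else 0) ^ 2 := by
    simp_rw [sq, sum_mul_sum]
    rw [sum_comm]
    conv_rhs => rw [sum_comm]
    rw [sum_comm]
    refine sum_congr rfl fun i hi => ?_
    rw [sum_comm]
    refine sum_congr rfl fun j _ => ?_
    rw [hdeg _ (inter_subset_left.trans (hC i hi))]
    refine sum_congr rfl fun a _ => ?_
    by_cases ha : a ∈ C i <;> simp [ha]
  have h3 : (∑ i ∈ s, (#(C i) : ℝ)) ^ 2 ≤ M * ∑ i ∈ s, ∑ j ∈ s, (#(C i ∩ C j) : ℝ) := by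
    rw [h1, h2]
    exact sq_sum_le_card_mul_sum_sq
  have h4 : #s * (η * M) ≤ ∑ i ∈ s, (#(C i) : ℝ) := by
    rw [← nsmul_eq_mul]
    exact card_nsmul_le_sum _ _ _ hb
  have h5 : ∑ i ∈ s, ∑ j ∈ s, (#(C i ∩ C j) : ℝ) ≤ #s * (M + #s * (η ^ 2 / 2 * M)) := by
    rw [← nsmul_eq_mul]
    refine sum_le_card_nsmul _ _ _ fun i hi => ?_
    rw [← add_sum_erase _ _ hi]
    refine add_le_add ?_ ?_
    · rw [inter_self]; exact Nat.cast_le.2 (card_le_card (hC i hi))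
    · calc _ ≤ #(s.erase i) • (η ^ 2 / 2 * M) := by
            refine sum_le_card_nsmul _ _ _ fun j hj => ?_
            exact (not_le.1 (hsm hi (mem_of_mem_erase hj) (ne_of_mem_erase hj).symm)).le
        _ ≤ _ := by
            rw [nsmul_eq_mul]
            have : (#(s.erase i) : ℝ) ≤ #s := by exact_mod_cast card_le_card (erase_subset _ _)
            gcongr
  rcases s.eq_empty_or_nonempty with rfl | hne
  · simp
  have hk : (0 : ℝ) < #s := by exact_mod_cast hne.card_pos
  have h6 : (#s * (η * M)) ^ 2 ≤ M * (#s * (M + #s * (η ^ 2 / 2 * M))) :=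
    (pow_le_pow_left₀ (by positivity) h4 2).trans (h3.trans (by gcongr))
  have h7 : (#s * M ^ 2) * (#s * η ^ 2) ≤ (#s * M ^ 2) * (1 + #s * η ^ 2 / 2) := by
    linarith
  have h8 := le_of_mul_le_mul_left h7 (by positivity)
  linarith

theorem two_mul_factorial_mul_factorial_ge {l Δ s : ℕ} (hs : s ≤ Δ) (hl : 2 * s * Δ ≤ l) :
    (l + Δ).factorial * l.factorial ≤ 2 * ((l + s).factorial * (l + Δ - s).factorial) := by
  rcases Nat.eq_zero_or_pos s with rfl | hs0
  · simp; nlinarith [Nat.factorial_pos (l + Δ), Nat.factorial_pos l]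
  have h1 : l.factorial * (l + 1) ^ s ≤ (l + s).factorial := Nat.factorial_mul_pow_le_factorial
  have h2 : (l + Δ).factorial ≤ (l + Δ - s).factorial * (l + Δ) ^ s := by
    have := Nat.factorial_mul_descFactorial (n := l + Δ) (k := s) (by omega)
    rw [← this]
    exact Nat.mul_le_mul_left _ (Nat.descFactorial_le_pow _ _)
  have h3 : (l + Δ) ^ s ≤ 2 * (l + 1) ^ s := by
    have hpos : (0 : ℝ) < l + Δ := by
      have : 0 < Δ := by omega
      positivity
    have hb := one_add_mul_le_pow (a := -((Δ : ℝ) / (l + Δ))) (by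
      have : (Δ : ℝ) / (l + Δ) ≤ 1 := by
        rw [div_le_one hpos]; simp
      linarith) s
    have hhalf : (s : ℝ) * (Δ / (l + Δ)) ≤ 1 / 2 := by
      rw [← mul_div_assoc, div_le_iff₀ hpos]
      have : (2 * s * Δ : ℝ) ≤ l := by exact_mod_cast hl
      have : (0 : ℝ) ≤ Δ := by positivity
      linarith
    have h5 : (1 : ℝ) + -((Δ : ℝ) / (l + Δ)) = l / (l + Δ) := by field_simp; ring
    rw [h5, div_pow, le_div_iff₀ (by positivity)] at hb
    have h6 : ((l : ℝ) + Δ) ^ s ≤ 2 * (l + 1) ^ s := by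
      have h7 : (l : ℝ) ^ s ≤ (l + 1) ^ s := by gcongr; simp
      have h8 : (0 : ℝ) < (l + Δ) ^ s := by positivity
      nlinarith
    exact_mod_cast h6
  calc _ ≤ ((l + Δ - s).factorial * (2 * (l + 1) ^ s)) * l.factorial := by
        gcongr; exact h2.trans (by gcongr)
    _ = 2 * ((l.factorial * (l + 1) ^ s) * (l + Δ - s).factorial) := by ring
    _ ≤ _ := by gcongr

theorem exists_long_gap {S J i D T : ℕ} {L : ℕ → ℕ} (hS : 2 ≤ S)
    (hL : ∀ k, k + 1 < T → L k + 2 ≤ L (k + 1)) (hT : i + (J + 1) * S < T)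
    (hD : L (i + (J + 1) * S) ≤ L i + D) (hJ : (D : ℝ) < (1 + 1 / (2 * S)) ^ J) :
    ∃ j, 1 ≤ j ∧ j ≤ J ∧
      2 * S * (L (i + (j + 1) * S) - L (i + j * S)) ≤ L (i + j * S) - L i - 2 := by
  by_contra! hcon
  have hmono : ∀ m k, k + m < T → L k + 2 * m ≤ L (k + m) := by
    intro m
    induction m with
    | zero => simp
    | succ m ih => intro k hk; have := ih k (by omega); have := hL (k + m) (by omega); grind
  have key : ∀ j, j ≤ J →
      (1 + 1 / (2 * S) : ℝ) ^ j ≤ ((L (i + (j + 1) * S) - L i - 2 : ℕ) : ℝ) := by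
    intro j
    induction j with
    | zero =>
      intro _
      have h1 := hmono S i (by nlinarith)
      have : 1 ≤ L (i + (0 + 1) * S) - L i - 2 := by
        rw [zero_add, one_mul]; omega
      simpa using this
    | succ j ih =>
      intro hj
      have h0 := ih (by omega)
      have h1 := hcon (j + 1) (by omega) hj
      have hle : (j + 1 + 1) * S ≤ (J + 1) * S := Nat.mul_le_mul_right _ (by omega)
      have h2 := hmono S (i + (j + 1) * S) (by
        have : (j + 1 + 1) * S = (j + 1) * S + S := by ring
        omega)
      have h3 := hmono ((j + 1) * S) i (by nlinarith)
      have e1 : i + (j + 1) * S + S = i + (j + 1 + 1) * S := by ring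
      rw [e1] at h2
      have hjS : S ≤ (j + 1) * S := by nlinarith
      set a := L (i + (j + 1) * S)
      set b := L (i + (j + 1 + 1) * S)
      have h4 : (b - L i - 2 : ℕ) = (b - a) + (a - L i - 2) := by omega
      rw [h4]
      push_cast
      have h5 : ((a - L i - 2 : ℕ) : ℝ) < 2 * S * (b - a : ℕ) := by exact_mod_cast h1
      have hSpos : (0 : ℝ) < 2 * S := by
        have : (0 : ℝ) < S := by exact_mod_cast (by omega : 0 < S)
        positivity
      rw [pow_succ]
      have h6 : ((a - L i - 2 : ℕ) : ℝ) * (1 / (2 * S)) ≤ (b - a : ℕ) := by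
        rw [mul_one_div, div_le_iff₀ hSpos]; linarith
      calc _ ≤ ((a - L i - 2 : ℕ) : ℝ) * (1 + 1 / (2 * S)) := by gcongr
        _ ≤ _ := by linarith
  have h1 := key J le_rfl
  have h2 : ((L (i + (J + 1) * S) - L i - 2 : ℕ) : ℝ) ≤ D := by
    exact_mod_cast (by omega : L (i + (J + 1) * S) - L i - 2 ≤ D)
  linarith

/-- A sequence of sites carrying a profile `G` with these decay properties is short. -/
theorem sites_lt {κ : ℝ} (hκ : 0 < κ) (hκ1 : κ ≤ 1) {S R : ℕ} (hS : 2 ≤ S)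
    (hR : (1 / 2 : ℝ) ^ R < κ ^ S) {T J D : ℕ} {L : ℕ → ℕ} {G : ℕ → ℕ → ℝ}
    (hJ : (D : ℝ) < (1 + 1 / (2 * S)) ^ J)
    (hL : ∀ k, k + 1 < T → L k + 2 ≤ L (k + 1)) (hD : ∀ i k, i < k → k < T → L k ≤ L i + D)
    (hG1 : ∀ k s, k + s < T → G k s ≤ 1) (hGpos : ∀ k s, k + s < T → κ ^ s ≤ G k s)
    (hG : ∀ i k s, i < k → k + s < T → κ * G k s ≤ G i s)
    (hgap : ∀ i k, i < k → k + S < T → 2 * S * (L (k + S) - L k) ≤ L k - L i - 2 →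
      ∃ s, 1 ≤ s ∧ s ≤ S ∧ G k s ≤ κ / 2 * G i s) :
    T ≤ (R * S + 2) * ((J + 1) * S) := by
  by_contra! hT
  set B := (J + 1) * S with hB
  have hSB : S ≤ B := by rw [hB]; nlinarith
  have hTB : ∀ b, b ≤ R * S → b * B + B + S < T := by
    intro b hb
    have : b * B ≤ R * S * B := Nat.mul_le_mul_right _ hb
    have : (R * S + 2) * B = R * S * B + B + B := by ring
    omega
  have hblock : ∀ b, b ≤ R * S → ∃ s ∈ Icc 1 S, ∃ k, b * B < k ∧ k < b * B + B ∧
      G k s ≤ κ / 2 * G (b * B) s := by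
    intro b hb
    have hb' := hTB b hb
    obtain ⟨j, hj1, hj2, hj⟩ := exists_long_gap (i := b * B) (J := J) hS hL
      (by omega) (hD _ _ (by omega) (by omega)) hJ
    have h1 : S ≤ j * S := by nlinarith
    have h2 : (j + 1) * S ≤ B := by rw [hB]; exact Nat.mul_le_mul_right _ (by omega)
    have h3 : (j + 1) * S = j * S + S := by ring
    rw [h3, ← add_assoc] at hj
    obtain ⟨s, hs1, hs2, hs⟩ := hgap (b * B) (b * B + j * S) (by omega) (by omega) hj
    exact ⟨s, mem_Icc.2 ⟨hs1, hs2⟩, b * B + j * S, by omega, by omega, hs⟩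
  have hblock' : ∀ b, ∃ s, b ≤ R * S → s ∈ Icc 1 S ∧ ∃ k, b * B < k ∧ k < b * B + B ∧
      G k s ≤ κ / 2 * G (b * B) s := by
    intro b
    by_cases hb : b ≤ R * S
    · obtain ⟨s, h1, h2⟩ := hblock b hb; exact ⟨s, fun _ => ⟨h1, h2⟩⟩
    · exact ⟨0, fun h => absurd h hb⟩
  choose σ hσ using hblock'
  obtain ⟨s, hs, hcard⟩ := exists_lt_card_fiber_of_mul_lt_card_of_maps_to
    (s := range (R * S + 1)) (t := Icc 1 S) (f := σ) (n := R)
    (fun b hb => (hσ b (by rw [mem_range] at hb; omega)).1) (by simp; nlinarith)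
  rw [mem_Icc] at hs
  have hstep : ∀ b b', b < b' → b' ≤ R * S → σ b = s → G (b' * B) s ≤ 1 / 2 * G (b * B) s := by
    intro b b' hbb hb' hb
    obtain ⟨-, k, hk1, hk2, hk⟩ := hσ b (by omega)
    rw [hb] at hk
    have h1 : b * B + B ≤ b' * B := by
      have : (b + 1) * B ≤ b' * B := Nat.mul_le_mul_right _ hbb
      linarith
    have h2 := hTB b' hb'
    have h3 := hG k (b' * B) s (by omega) (by omega)
    have h4 : κ * G (b' * B) s ≤ κ * (1 / 2 * G (b * B) s) := by linarith
    exact le_of_mul_le_mul_left h4 hκ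
  have hind : ∀ A : Finset ℕ, (∀ b ∈ A, b ≤ R * S ∧ σ b = s) → ∀ b ∈ A, (∀ x ∈ A, x ≤ b) →
      G (b * B) s ≤ (1 / 2 : ℝ) ^ (#A - 1) := by
    intro A
    induction A using Finset.induction_on_max with
    | empty => simp
    | insert a A hA ih =>
      intro hAs b hb hbmax
      have hba : b = a := by
        rcases mem_insert.1 hb with h | h
        · exact h
        · have := hA b h; have := hbmax a (mem_insert_self _ _); omega
      subst hba
      have hbn : b ∉ A := fun h => lt_irrefl _ (hA b h)
      rw [card_insert_of_notMem hbn, Nat.add_sub_cancel]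
      have hbR := (hAs b hb).1
      have hTb := hTB b hbR
      rcases A.eq_empty_or_nonempty with rfl | hne
      · simpa using hG1 (b * B) s (by omega)
      · have hm := A.max'_mem hne
        have h1 := ih (fun x hx => hAs x (mem_insert_of_mem hx)) _ hm (fun x hx => A.le_max' x hx)
        have h2 := hstep _ b (hA _ hm) hbR (hAs _ (mem_insert_of_mem hm)).2
        have h3 : #A = (#A - 1) + 1 := by have := hne.card_pos; omega
        rw [h3, pow_succ]
        linarith
  set A := {b ∈ range (R * S + 1) | σ b = s}
  have hA : ∀ b ∈ A, b ≤ R * S ∧ σ b = s := by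
    intro b hb
    rw [mem_filter, mem_range] at hb
    exact ⟨by omega, hb.2⟩
  have hne : A.Nonempty := card_pos.1 (by omega)
  have h1 := hind A hA _ (A.max'_mem hne) (fun x hx => A.le_max' x hx)
  have h2 := hTB _ (hA _ (A.max'_mem hne)).1
  have h3 := hGpos (A.max' hne * B) s (by omega)
  have h4 : (1 / 2 : ℝ) ^ (#A - 1) ≤ (1 / 2) ^ R :=
    pow_le_pow_of_le_one (by norm_num) (by norm_num) (by omega)
  have h5 : κ ^ S ≤ κ ^ s := pow_le_pow_of_le_one hκ.le hκ1 hs.2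
  linarith

end Clique

section Sites

variable {c : ℕ → ℕ → Prop}

theorem one_le_numPaths_right (z : ℕ × ℕ) : 1 ≤ numPaths c z (z.1 + 1, z.2) := by
  unfold numPaths numExts
  refine Finset.card_pos.2 ⟨[Sum.inl z.1], mem_linExts.2 ⟨by simp, ?_, by simp⟩⟩
  rintro (i | i)
  · simp; omega
  · simp

/-- The ratio `n(z' + s, e) / n(z', e)`, where `z'` is the upper end of the corner at `(p, h)`. -/
noncomputable def tailRatio (c : ℕ → ℕ → Prop) (e : ℕ × ℕ) (p h s : ℕ) : ℝ :=
  numPaths c (p + 1, h + 1 + s) e / numPaths c (p + 1, h + 1) e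

theorem numPaths_tail_le {e : ℕ × ℕ} {p h : ℕ} (hz' : Passable c (p + 1, h + 1)) {s : ℕ}
    (hs : (p + 1, h + 1 + s) ≤ e) :
    numPaths c (p + 1, h + 1 + s) e ≤ numPaths c (p + 1, h + 1) e := by
  refine le_trans ?_ (numPaths_mul_le (hz'.up s) (by simp [Prod.le_def]) hs)
  exact Nat.le_mul_of_pos_left _ (one_le_numPaths_up (c := c) (p + 1, h + 1) s)

theorem mul_numPaths_le_total {e : ℕ × ℕ} {p h : ℕ} (hz : Passable c (p, h))
    (hz' : Passable c (p + 1, h + 1)) (he : (p + 1, h + 1) ≤ e) :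
    numPaths c 0 (p, h) * numPaths c (p + 1, h + 1) e ≤ numPaths c 0 e := by
  have := sum_numPaths_mul_le (S := 0) hz hz' (by simpa using he)
  simpa using this

theorem numPaths_mul_tail_le (hc : ∀ i j j', j ≤ j' → c j' i → c j i) {e : ℕ × ℕ}
    {p h p' h' s : ℕ} (hz : Passable c (p', h')) (hz' : Passable c (p' + 1, h' + 1))
    (hp : p < p') (hh : h < h') (he : (p' + 1, h' + 1 + s) ≤ e) :
    numPaths c (p + 1, h + 1) (p', h') * numPaths c (p' + 1, h' + 1 + s) e ≤
      numPaths c (p + 1, h + 1 + s) e := by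
  have h1 := numPaths_le_shift (c := c) (fun i j s => hc i j (j + s) (by omega))
    (p + 1, h + 1) (p', h') s
  have h2 : numPaths c (p + 1, h + 1 + s) (p', h' + s) *
      numPaths c (p', h' + s) (p' + 1, h' + s + 1) ≤
      numPaths c (p + 1, h + 1 + s) (p' + 1, h' + s + 1) :=
    numPaths_mul_le (hz.up s) (by simp [Prod.le_def]; omega) (by simp [Prod.le_def])
  have h3 : numPaths c (p + 1, h + 1 + s) (p' + 1, h' + 1 + s) *
      numPaths c (p' + 1, h' + 1 + s) e ≤ numPaths c (p + 1, h + 1 + s) e :=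
    numPaths_mul_le (hz'.up s) (by simp [Prod.le_def]; omega) he
  have h4 := one_le_numPaths_step (c := c) p' (h' + s)
  rw [add_right_comm h' s 1] at h2 h4
  refine le_trans (Nat.mul_le_mul_right _ ?_) h3
  exact h1.trans ((Nat.le_mul_of_pos_right _ h4).trans h2)

theorem numPaths_mul_tail_succ_le (hc : ∀ i j j', j ≤ j' → c j' i → c j i) {e : ℕ × ℕ}
    {p h p' h' s : ℕ} (hz : Passable c (p', h')) (hz' : Passable c (p' + 1, h' + 1))
    (hp : p < p') (hh : h < h') (he : (p' + 1, h' + 1 + s) ≤ e) :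
    numPaths c (p + 1, h + 1) (p', h') * numPaths c (p' + 1, h' + 1 + s) e ≤
      numPaths c (p + 1, h + 1 + (s + 1)) e := by
  have h1 := numPaths_le_shift (c := c) (fun i j s => hc i j (j + s) (by omega))
    (p + 1, h + 1) (p', h') (s + 1)
  have h2 : numPaths c (p + 1, h + 1 + (s + 1)) (p', h' + (s + 1)) *
      numPaths c (p', h' + (s + 1)) (p' + 1, h' + (s + 1)) ≤
      numPaths c (p + 1, h + 1 + (s + 1)) (p' + 1, h' + (s + 1)) :=
    numPaths_mul_le (hz.up (s + 1)) (by simp [Prod.le_def]; omega) (by simp [Prod.le_def])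
  have h4 := one_le_numPaths_right (c := c) (p', h' + (s + 1))
  have e1 : h' + (s + 1) = h' + 1 + s := by ring
  simp only at h4
  rw [e1] at h1 h2 h4
  have h3 : numPaths c (p + 1, h + 1 + (s + 1)) (p' + 1, h' + 1 + s) *
      numPaths c (p' + 1, h' + 1 + s) e ≤ numPaths c (p + 1, h + 1 + (s + 1)) e :=
    numPaths_mul_le (hz'.up s) (by simp [Prod.le_def]; omega) he
  refine le_trans (Nat.mul_le_mul_right _ ?_) h3
  exact h1.trans ((Nat.le_mul_of_pos_right _ h4).trans h2)

/-- The core comparison between two corners `i` and `k` in the presence of a third one, `m`. -/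
theorem sq_le_two_mul (hc : ∀ i j j', j ≤ j' → c j' i → c j i) {e : ℕ × ℕ} {κ : ℝ} (hκ : 0 < κ)
    {pi hi pk hk pm hm s : ℕ} (hM : 0 < numPaths c 0 e)
    (hzi : Passable c (pi, hi)) (hzi' : Passable c (pi + 1, hi + 1))
    (hzk : Passable c (pk, hk)) (hzm : Passable c (pm, hm)) (hzm' : Passable c (pm + 1, hm + 1))
    (hpik : pi < pk) (hhik : hi < hk) (hpkm : pk < pm) (hhkm : hk + s ≤ hm)
    (hem : (pm + 1, hm + 1) ≤ e)
    (hlong : 2 * s * (pm + hm - (pk + hk)) ≤ pk + hk - (pi + hi) - 2)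
    (hik : κ * numPaths c 0 e ≤ numPaths c 0 (pi, hi) * numPaths c (pi + 1, hi + 1) (pk, hk) *
      numPaths c (pk + 1, hk + 1) e)
    (him : κ * numPaths c 0 e ≤ numPaths c 0 (pi, hi) * numPaths c (pi + 1, hi + 1) (pm, hm) *
      numPaths c (pm + 1, hm + 1) e) :
    (κ * numPaths c 0 e) ^ 2 ≤ 2 * (numPaths c 0 (pk, hk + s) * numPaths c 0 (pi, hi) *
      numPaths c (pk + 1, hk + 1) e * numPaths c (pi + 1, hi + 1 + s) e) := by
  have h1 := numPaths_le_shift (c := c) (fun i j s => hc i j (j + s) (by omega))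
    (pi + 1, hi + 1) (pk, hk) s
  simp only at h1
  have h2 : numPaths c (pi + 1, hi + 1 + s) (pm, hm) * numPaths c (pm + 1, hm + 1) e ≤
      numPaths c (pi + 1, hi + 1 + s) e := by
    have k1 : numPaths c (pi + 1, hi + 1 + s) (pm, hm) *
        numPaths c (pm, hm) (pm + 1, hm + 1) ≤ numPaths c (pi + 1, hi + 1 + s) (pm + 1, hm + 1) :=
      numPaths_mul_le hzm (by simp [Prod.le_def]; omega) (by simp [Prod.le_def])
    have k2 : numPaths c (pi + 1, hi + 1 + s) (pm + 1, hm + 1) * numPaths c (pm + 1, hm + 1) e ≤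
        numPaths c (pi + 1, hi + 1 + s) e :=
      numPaths_mul_le hzm' (by simp [Prod.le_def]; omega) hem
    exact le_trans (Nat.mul_le_mul_right _
      ((Nat.le_mul_of_pos_right _ (one_le_numPaths_step (c := c) pm hm)).trans k1)) k2
  have h3 : numPaths c 0 (pi, hi) * numPaths c (pi + 1, hi + 1) (pk, hk + s) ≤
      numPaths c 0 (pk, hk + s) := by
    have k1 : numPaths c 0 (pi, hi) * numPaths c (pi, hi) (pi + 1, hi + 1) ≤
        numPaths c 0 (pi + 1, hi + 1) :=
      numPaths_mul_le hzi (by simp) (by simp [Prod.le_def])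
    have k2 : numPaths c 0 (pi + 1, hi + 1) * numPaths c (pi + 1, hi + 1) (pk, hk + s) ≤
        numPaths c 0 (pk, hk + s) :=
      numPaths_mul_le hzi' (by simp) (by simp [Prod.le_def]; omega)
    exact le_trans (Nat.mul_le_mul_right _
      ((Nat.le_mul_of_pos_right _ (one_le_numPaths_step (c := c) pi hi)).trans k1)) k2
  have h4 := numPaths_mul_mul_factorial_le (c := c) (z := (pi + 1, hi + 1))
    (t := (pi + 1, hi + 1 + s)) (t' := (pk, hk + s)) (w := (pm, hm)) hzi' (hzi'.up s) (hzk.up s)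
    hzm (by simp [Prod.le_def]) (by simp [Prod.le_def]; omega) (by simp [Prod.le_def]; omega)
  simp only [card_pathSeg] at h4
  set l := pk + hk - (pi + hi) - 2 with hl
  set Δ := pm + hm - (pk + hk) with hΔ
  have e1 : pk - (pi + 1) + (hk + s - (hi + 1)) = l + s := by omega
  have e2 : pm - (pi + 1) + (hm - (hi + 1 + s)) = l + Δ - s := by omega
  have e3 : pm - (pi + 1) + (hm - (hi + 1)) = l + Δ := by omega
  have e4 : pk - (pi + 1) + (hk + s - (hi + 1 + s)) = l := by omega
  rw [e1, e2, e3, e4] at h4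
  have h5 := two_mul_factorial_mul_factorial_ge (l := l) (Δ := Δ) (s := s) (by omega) hlong
  have h6 : numPaths c (pi + 1, hi + 1) (pm, hm) *
      numPaths c (pi + 1, hi + 1 + s) (pk, hk + s) ≤
      2 * (numPaths c (pi + 1, hi + 1) (pk, hk + s) *
        numPaths c (pi + 1, hi + 1 + s) (pm, hm)) := by
    have hpos : 0 < (l + s).factorial * (l + Δ - s).factorial :=
      Nat.mul_pos (Nat.factorial_pos _) (Nat.factorial_pos _)
    refine Nat.le_of_mul_le_mul_right (h4.trans ?_) hpos
    calc _ ≤ numPaths c (pi + 1, hi + 1) (pk, hk + s) *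
        numPaths c (pi + 1, hi + 1 + s) (pm, hm) *
          (2 * ((l + s).factorial * (l + Δ - s).factorial)) := Nat.mul_le_mul_left _ h5
      _ = _ := by ring
  have hpos : 0 ≤ κ * numPaths c 0 e := by positivity
  calc (κ * numPaths c 0 e) ^ 2
      ≤ (numPaths c 0 (pi, hi) * numPaths c (pi + 1, hi + 1) (pk, hk) *
      numPaths c (pk + 1, hk + 1) e) * (numPaths c 0 (pi, hi) *
      numPaths c (pi + 1, hi + 1) (pm, hm) * numPaths c (pm + 1, hm + 1) e) := by
        rw [sq]; exact mul_le_mul hik him hpos (by positivity)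
    _ ≤ _ := by
      have : (numPaths c 0 (pi, hi) * numPaths c (pi + 1, hi + 1) (pk, hk) *
          numPaths c (pk + 1, hk + 1) e) * (numPaths c 0 (pi, hi) *
          numPaths c (pi + 1, hi + 1) (pm, hm) * numPaths c (pm + 1, hm + 1) e) ≤
          2 * (numPaths c 0 (pk, hk + s) * numPaths c 0 (pi, hi) *
          numPaths c (pk + 1, hk + 1) e * numPaths c (pi + 1, hi + 1 + s) e) := by
        calc _ ≤ (numPaths c 0 (pi, hi) * numPaths c (pi + 1, hi + 1 + s) (pk, hk + s) *
          numPaths c (pk + 1, hk + 1) e) * (numPaths c 0 (pi, hi) *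
          numPaths c (pi + 1, hi + 1) (pm, hm) * numPaths c (pm + 1, hm + 1) e) := by gcongr
          _ = (numPaths c (pi + 1, hi + 1) (pm, hm) *
            numPaths c (pi + 1, hi + 1 + s) (pk, hk + s)) * (numPaths c 0 (pi, hi) *
              numPaths c (pk + 1, hk + 1) e * numPaths c 0 (pi, hi) *
              numPaths c (pm + 1, hm + 1) e) := by ring
          _ ≤ _ := Nat.mul_le_mul_right _ h6
          _ = 2 * ((numPaths c 0 (pi, hi) * numPaths c (pi + 1, hi + 1) (pk, hk + s)) *
            numPaths c 0 (pi, hi) * numPaths c (pk + 1, hk + 1) e *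
            (numPaths c (pi + 1, hi + 1 + s) (pm, hm) * numPaths c (pm + 1, hm + 1) e)) := by ring
          _ ≤ _ := by gcongr
      exact_mod_cast this

theorem clique_card_le {κ : ℝ} (hκ : 0 < κ) (hκ1 : κ ≤ 1) : ∃ A S : ℕ, 2 ≤ S ∧
    ∀ {c : ℕ → ℕ → Prop}, (∀ i j j', j ≤ j' → c j' i → c j i) → ∀ {e : ℕ × ℕ},
    0 < numPaths c 0 e → ∀ {T : ℕ} {p h : ℕ → ℕ},
    (∀ i k, i < k → k < T → p i < p k) → (∀ i k, i < k → k < T → h i < h k) →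
    (∀ k < T, Passable c (p k, h k)) → (∀ k < T, Passable c (p k + 1, h k + 1)) →
    (∀ k < T, (p k + 1, h k + 1) ≤ e) →
    (∀ i k, i < k → k < T → κ * numPaths c 0 e ≤ numPaths c 0 (p i, h i) *
      numPaths c (p i + 1, h i + 1) (p k, h k) * numPaths c (p k + 1, h k + 1) e) →
    ∀ {J D : ℕ}, (D : ℝ) < (1 + 1 / (2 * S)) ^ J →
    (∀ i k, i < k → k < T → p k + h k ≤ p i + h i + D) → T ≤ A * (J + 1) := by
  set S := ⌈4 / κ ^ 3⌉₊ + 2 with hS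
  obtain ⟨R, hR⟩ := exists_pow_lt_of_lt_one (show (0 : ℝ) < κ ^ S by positivity)
    (show (1 / 2 : ℝ) < 1 by norm_num)
  refine ⟨(R * S + 2) * S + 1, S, by omega, ?_⟩
  intro c hc e hM T p h hp hh hz hz' he hn J D hJ hD
  have hM' : (0 : ℝ) < numPaths c 0 e := by exact_mod_cast hM
  have hhs : ∀ s k, k + s < T → h k + s ≤ h (k + s) := by
    intro s
    induction s with
    | zero => simp
    | succ s ih =>
      intro k hk
      have := ih k (by omega)
      have := hh (k + s) (k + (s + 1)) (by omega) hk
      omega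
  have hes : ∀ k s, k + s < T → (p k + 1, h k + 1 + s) ≤ e := by
    intro k s hk
    have h1 := he (k + s) hk
    have h2 := hhs s k hk
    have h3 := he k (by omega)
    rw [Prod.le_def] at *
    simp only at *
    omega
  have hab : ∀ k < T, (numPaths c 0 (p k, h k) : ℝ) * numPaths c (p k + 1, h k + 1) e ≤
      numPaths c 0 e := by
    intro k hk
    exact_mod_cast mul_numPaths_le_total (hz k hk) (hz' k hk) (he k hk)
  have hpos : ∀ i k, i < k → k < T → (0 : ℝ) < numPaths c 0 (p i, h i) ∧
      (0 : ℝ) < numPaths c (p i + 1, h i + 1) (p k, h k) ∧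
      (0 : ℝ) < numPaths c (p k + 1, h k + 1) e := by
    intro i k hik hk
    have h1 := lt_of_lt_of_le (by positivity) (hn i k hik hk)
    refine ⟨?_, ?_, ?_⟩ <;> refine lt_of_le_of_ne (Nat.cast_nonneg _) fun h0 => ?_ <;>
      simp [← h0] at h1
  have hnb : ∀ i k, i < k → k < T → κ * numPaths c (p i + 1, h i + 1) e ≤
      numPaths c (p i + 1, h i + 1) (p k, h k) * numPaths c (p k + 1, h k + 1) e := by
    intro i k hik hk
    have h1 := hn i k hik hk
    have h2 := hab i (by omega)
    have h3 := (hpos i k hik hk).1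
    refine le_of_mul_le_mul_left ?_ h3
    calc _ = κ * (numPaths c 0 (p i, h i) * numPaths c (p i + 1, h i + 1) e) := by ring
      _ ≤ κ * numPaths c 0 e := by gcongr
      _ ≤ _ := by linarith
  have hb : ∀ k, k + 1 < T → (0 : ℝ) < numPaths c (p k + 1, h k + 1) e := by
    intro k hk
    have h1 : (numPaths c (p k + 1, h k + 1) (p (k + 1), h (k + 1)) : ℝ) *
        numPaths c (p (k + 1) + 1, h (k + 1) + 1) e ≤ numPaths c (p k + 1, h k + 1) e := by
      exact_mod_cast numPaths_mul_tail_le hc (s := 0) (hz _ hk) (hz' _ hk)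
        (hp k (k + 1) (by omega) hk) (hh k (k + 1) (by omega) hk) (he _ hk)
    obtain ⟨-, h2, h3⟩ := hpos k (k + 1) (by omega) hk
    exact lt_of_lt_of_le (mul_pos h2 h3) h1
  have hG : ∀ i k s, i < k → k + s < T - 1 →
      κ * tailRatio c e (p k) (h k) s ≤ tailRatio c e (p i) (h i) s := by
    intro i k s hik hk
    have h1 : (numPaths c (p i + 1, h i + 1) (p k, h k) : ℝ) *
        numPaths c (p k + 1, h k + 1 + s) e ≤ numPaths c (p i + 1, h i + 1 + s) e := by
      exact_mod_cast numPaths_mul_tail_le hc (s := s) (hz k (by omega)) (hz' k (by omega))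
        (hp i k hik (by omega)) (hh i k hik (by omega)) (hes k s (by omega))
    have h2 := hnb i k hik (by omega)
    have h3 := hb i (by omega)
    have h4 := hb k (by omega)
    unfold tailRatio
    rw [← mul_div_assoc, div_le_div_iff₀ h4 h3]
    calc _ = (κ * numPaths c (p i + 1, h i + 1) e) * numPaths c (p k + 1, h k + 1 + s) e := by ring
      _ ≤ _ := mul_le_mul_of_nonneg_right h2 (Nat.cast_nonneg _)
      _ = (numPaths c (p i + 1, h i + 1) (p k, h k) * numPaths c (p k + 1, h k + 1 + s) e) *
        numPaths c (p k + 1, h k + 1) e := by ring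
      _ ≤ _ := mul_le_mul_of_nonneg_right h1 (Nat.cast_nonneg _)
  have hG1 : ∀ k s, k + s < T - 1 → tailRatio c e (p k) (h k) s ≤ 1 := by
    intro k s hk
    refine div_le_one_of_le₀ ?_ (Nat.cast_nonneg _)
    exact_mod_cast numPaths_tail_le (hz' k (by omega)) (hes k s (by omega))
  have hGpos : ∀ s k, k + s < T - 1 → κ ^ s ≤ tailRatio c e (p k) (h k) s := by
    intro s
    induction s with
    | zero =>
      intro k hk
      have := hb k (by omega)
      simp [tailRatio, this.ne']
    | succ s ih =>
      intro k hk
      have h0 := ih (k + 1) (by omega)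
      have h1 : (numPaths c (p k + 1, h k + 1) (p (k + 1), h (k + 1)) : ℝ) *
          numPaths c (p (k + 1) + 1, h (k + 1) + 1 + s) e ≤
          numPaths c (p k + 1, h k + 1 + (s + 1)) e := by
        exact_mod_cast numPaths_mul_tail_succ_le hc (s := s) (hz _ (by omega)) (hz' _ (by omega))
          (hp k (k + 1) (by omega) (by omega)) (hh k (k + 1) (by omega) (by omega))
          (hes (k + 1) s (by omega))
      have h2 := hnb k (k + 1) (by omega) (by omega)
      have h3 := hb k (by omega)
      have h4 := hb (k + 1) (by omega)
      unfold tailRatio at h0 ⊢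
      rw [le_div_iff₀ h4] at h0
      rw [le_div_iff₀ h3]
      refine le_of_mul_le_mul_right ?_ h4
      calc _ = (κ * numPaths c (p k + 1, h k + 1) e) *
            (κ ^ s * numPaths c (p (k + 1) + 1, h (k + 1) + 1) e) := by ring
        _ ≤ _ := mul_le_mul h2 h0 (by positivity) (by positivity)
        _ = (numPaths c (p k + 1, h k + 1) (p (k + 1), h (k + 1)) *
          numPaths c (p (k + 1) + 1, h (k + 1) + 1 + s) e) *
          numPaths c (p (k + 1) + 1, h (k + 1) + 1) e := by ring
        _ ≤ _ := mul_le_mul_of_nonneg_right h1 (Nat.cast_nonneg _)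
  have hgap : ∀ i k, i < k → k + S < T - 1 →
      2 * S * (p (k + S) + h (k + S) - (p k + h k)) ≤ p k + h k - (p i + h i) - 2 →
      ∃ s, 1 ≤ s ∧ s ≤ S ∧
        tailRatio c e (p k) (h k) s ≤ κ / 2 * tailRatio c e (p i) (h i) s := by
    intro i k hik hk hlong
    have hsum : ∑ s ∈ range (S + 1), ((numPaths c 0 (p k, h k + s) : ℝ) *
        numPaths c (p k + 1, h k + 1 + s) e) ≤ numPaths c 0 e := by
      have := sum_numPaths_mul_le (S := S) (hz k (by omega)) (hz' k (by omega))
        (by simpa [add_right_comm] using hes k S (by omega))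
      simp only [add_right_comm _ _ 1] at this
      exact_mod_cast this
    obtain ⟨s, hs, hθ⟩ : ∃ s ∈ Icc 1 S, (numPaths c 0 (p k, h k + s) : ℝ) *
        numPaths c (p k + 1, h k + 1 + s) e ≤ κ ^ 3 / 4 * numPaths c 0 e := by
      by_contra! hcon
      have h1 : #(Icc 1 S) • (κ ^ 3 / 4 * numPaths c 0 e) ≤ ∑ s ∈ Icc 1 S,
          ((numPaths c 0 (p k, h k + s) : ℝ) * numPaths c (p k + 1, h k + 1 + s) e) :=
        card_nsmul_le_sum _ _ _ fun s hs => (hcon s hs).le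
      have h2 : ∑ s ∈ Icc 1 S, ((numPaths c 0 (p k, h k + s) : ℝ) *
          numPaths c (p k + 1, h k + 1 + s) e) ≤ ∑ s ∈ range (S + 1),
            ((numPaths c 0 (p k, h k + s) : ℝ) * numPaths c (p k + 1, h k + 1 + s) e) :=
        sum_le_sum_of_subset_of_nonneg (fun s hs => by simp at hs ⊢; omega)
          (fun _ _ _ => by positivity)
      rw [Nat.card_Icc, Nat.add_sub_cancel, nsmul_eq_mul] at h1
      have h3 : 4 / κ ^ 3 < S := by
        have := Nat.le_ceil (4 / κ ^ 3)
        rw [hS]; push_cast; linarith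
      rw [div_lt_iff₀ (by positivity)] at h3
      nlinarith
    rw [mem_Icc] at hs
    refine ⟨s, hs.1, hs.2, ?_⟩
    have hhS := hhs S k (by omega)
    have h1 := sq_le_two_mul hc (s := s) hκ hM (hz i (by omega)) (hz' i (by omega))
      (hz k (by omega)) (hz (k + S) (by omega)) (hz' (k + S) (by omega)) (hp i k hik (by omega))
      (hh i k hik (by omega)) (hp k (k + S) (by omega) (by omega)) (by omega)
      (he (k + S) (by omega))
      (le_trans (Nat.mul_le_mul_right _ (Nat.mul_le_mul_left _ hs.2)) hlong)
      (hn i k hik (by omega)) (hn i (k + S) (by omega) (by omega))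
    have h2 := hab i (by omega)
    have h3 := hb i (by omega)
    have h4 := hb k (by omega)
    unfold tailRatio
    rw [← mul_div_assoc, div_le_div_iff₀ h4 h3]
    have h5 : (0 : ℝ) ≤ numPaths c 0 (p k, h k + s) := Nat.cast_nonneg _
    have h6 : (0 : ℝ) ≤ numPaths c (p k + 1, h k + 1 + s) e := Nat.cast_nonneg _
    have h7 : (0 : ℝ) ≤ numPaths c (p i + 1, h i + 1 + s) e := Nat.cast_nonneg _
    generalize (numPaths c 0 e : ℝ) = M at *
    generalize (numPaths c 0 (p k, h k + s) : ℝ) = x at *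
    generalize (numPaths c (p k + 1, h k + 1 + s) e : ℝ) = y at *
    generalize (numPaths c (p i + 1, h i + 1 + s) e : ℝ) = z at *
    generalize (numPaths c (p i + 1, h i + 1) e : ℝ) = bi at *
    generalize (numPaths c (p k + 1, h k + 1) e : ℝ) = bk at *
    generalize (numPaths c 0 (p i, h i) : ℝ) = ai at *
    -- multiply the comparison by `y * bi`
    have h8 : κ ^ 2 * M ^ 2 * (y * bi) ≤ κ ^ 2 * M ^ 2 * (κ / 2 * z * bk) := by
      calc κ ^ 2 * M ^ 2 * (y * bi) = (κ * M) ^ 2 * (y * bi) := by ring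
        _ ≤ 2 * (x * ai * bk * z) * (y * bi) := by gcongr
        _ = 2 * bk * z * ((x * y) * (ai * bi)) := by ring
        _ ≤ 2 * bk * z * ((κ ^ 3 / 4 * M) * M) := by
          have : (x * y) * (ai * bi) ≤ (κ ^ 3 / 4 * M) * M :=
            (mul_le_mul_of_nonneg_left h2 (mul_nonneg h5 h6)).trans
              (mul_le_mul_of_nonneg_right hθ hM'.le)
          gcongr
        _ = _ := by ring
    exact le_of_mul_le_mul_left h8 (by positivity)
  have hfin := sites_lt hκ hκ1 (by omega : 2 ≤ S) hR (T := T - 1) (L := fun k => p k + h k)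
    (G := fun k s => tailRatio c e (p k) (h k) s) hJ ?_ (fun i k hik hk => hD i k hik (by omega))
    hG1 (fun k s => hGpos s k) hG hgap
  · have : ((R * S + 2) * S + 1) * (J + 1) = (R * S + 2) * ((J + 1) * S) + (J + 1) := by ring
    omega
  · intro k hk
    have := hp k (k + 1) (by omega) (by omega)
    have := hh k (k + 1) (by omega) (by omega)
    omega

end Sites

section Corners

theorem card_corners_lt_pow {η : ℝ} (hη : 0 < η) (hη1 : η ≤ 1) : ∃ Q A S : ℕ, 2 ≤ S ∧
    ∀ {c : ℕ → ℕ → Prop}, (∀ i j j', j ≤ j' → c j' i → c j i) → ∀ {e : ℕ × ℕ},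
    Passable c e → 0 < numPaths c 0 e → ∀ {H : Finset ℕ} {p : ℕ → ℕ} {m₀ D : ℕ},
    (∀ h ∈ H, η * numPaths c 0 e ≤ #(cornerPaths c e (p h, h))) →
    (∀ h ∈ H, m₀ ≤ p h + h ∧ p h + h ≤ m₀ + D) →
    ∀ {J : ℕ}, (D : ℝ) < (1 + 1 / (2 * S)) ^ J → #H < (A * (J + 1) + 1) ^ Q := by
  have hκ : 0 < η ^ 2 / 2 := by positivity
  have hκ1 : η ^ 2 / 2 ≤ 1 := by nlinarith
  obtain ⟨A, S, hS, hclique⟩ := clique_card_le hκ hκ1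
  refine ⟨⌈2 / η ^ 2⌉₊, A, S, hS, ?_⟩
  intro c hc e he hM H p m₀ D hH hL J hJ
  have hM' : (0 : ℝ) < numPaths c 0 e := by exact_mod_cast hM
  by_contra! hcard
  classical
  rcases exists_clique_or_indep
    (R := fun h h' => η ^ 2 / 2 * numPaths c 0 e ≤
      #(cornerPaths c e (p h, h) ∩ cornerPaths c e (p h', h')))
    (fun a b h => by rwa [inter_comm]) _ _ H hcard
    ((Nat.pow_pos (Nat.succ_pos _)).trans_le hcard) with ⟨s, hs, hsT, hR⟩ | ⟨s, hs, hsq, hR⟩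
  · set T := A * (J + 1) + 1 with hT
    set h : ℕ → ℕ := fun k => if hk : k < T then s.orderEmbOfFin hsT ⟨k, hk⟩ else 0 with hh
    have hhs : ∀ k < T, h k ∈ s := by
      intro k hk
      simp only [hh, hk, dif_pos]
      exact orderEmbOfFin_mem _ _ _
    have hmono : ∀ i k, i < k → k < T → h i < h k := by
      intro i k hik hk
      simp only [hh, hk, hik.trans hk, dif_pos]
      exact (s.orderEmbOfFin hsT).strictMono hik
    have hpass : ∀ k < T, Passable c (p (h k), h k) ∧ Passable c (p (h k) + 1, h k + 1) ∧
        (p (h k) + 1, h k + 1) ≤ e := by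
      intro k hk
      have h1 := hH _ (hs (hhs k hk))
      have h2 : (0 : ℝ) < #(cornerPaths c e (p (h k), h k)) := lt_of_lt_of_le (by positivity) h1
      obtain ⟨l, hl⟩ := card_pos.1 (Nat.cast_pos.1 h2)
      exact passable_of_mem_cornerPaths he hl
    have hadj : ∀ i k, i < k → k < T → η ^ 2 / 2 * numPaths c 0 e ≤
        #(cornerPaths c e (p (h i), h i) ∩ cornerPaths c e (p (h k), h k)) := by
      intro i k hik hk
      exact hR (hhs i (hik.trans hk)) (hhs k hk) (hmono i k hik hk).ne
    have hp : ∀ i k, i < k → k < T → p (h i) < p (h k) := by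
      intro i k hik hk
      have h2 := lt_of_lt_of_le (by positivity) (hadj i k hik hk)
      obtain ⟨l, hl⟩ := card_pos.1 (Nat.cast_pos.1 h2)
      rw [mem_inter] at hl
      exact lt_of_mem_cornerPaths he (hmono i k hik hk) hl.1 hl.2
    have := hclique hc hM (T := T) (p := fun k => p (h k)) (h := h) hp hmono
      (fun k hk => (hpass k hk).1) (fun k hk => (hpass k hk).2.1) (fun k hk => (hpass k hk).2.2)
      (fun i k hik hk => (hadj i k hik hk).trans
        (by exact_mod_cast card_cornerPaths_inter_le he (hmono i k hik hk))) hJ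
      (fun i k hik hk => by
        have h1 := hL _ (hs (hhs i (hik.trans hk)))
        have h2 := hL _ (hs (hhs k hk))
        omega)
    omega
  · have h1 := card_mul_le_of_inter_small (Ω := linExts (pathRel c) (pathSeg 0 e)) s
      (fun h => cornerPaths c e (p h, h)) η hη.le hM
      (fun h _ l hl => (mem_cornerPaths.1 hl).1) (fun h hhs => hH h (hs hhs)) hR
    have h2 := Nat.le_ceil (2 / η ^ 2)
    rw [div_le_iff₀ (by positivity)] at h2
    rw [hsq] at h1
    push_cast at h1
    have : 0 < η ^ 2 := by positivity
    linarith

/-- Only few corners in a strip of width `B * K` are used by a positive proportion of the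
paths. -/
theorem exists_card_corners_lt {η θ : ℝ} (hη : 0 < η) (hη1 : η ≤ 1) (hθ : 0 < θ) {B : ℕ}
    (hB : 0 < B) : ∃ K₀ : ℕ, ∀ K ≥ K₀,
    ∀ {c : ℕ → ℕ → Prop}, (∀ i j j', j ≤ j' → c j' i → c j i) → ∀ {e : ℕ × ℕ},
    Passable c e → 0 < numPaths c 0 e → ∀ {H : Finset ℕ} {p : ℕ → ℕ} {m₀ : ℕ},
    (∀ h ∈ H, η * numPaths c 0 e ≤ #(cornerPaths c e (p h, h))) →
    (∀ h ∈ H, m₀ ≤ p h + h ∧ p h + h ≤ m₀ + B * K) → #H < θ * K := by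
  obtain ⟨Q, A, S, hS, hmain⟩ := card_corners_lt_pow hη hη1
  set ρ : ℝ := 1 + 1 / (2 * S) with hρ
  have hSpos : (0 : ℝ) < S := by exact_mod_cast (by omega : 0 < S)
  have hρ1 : 1 < ρ := by
    have : 0 < 1 / (2 * (S : ℝ)) := by positivity
    linarith
  have hB' : (0 : ℝ) < B := by exact_mod_cast hB
  have hlim := tendsto_pow_const_div_const_pow_of_one_lt Q hρ1
  have hpos : 0 < θ / B / ((2 * A + 1) ^ Q * ρ) := by positivity
  obtain ⟨n₀, hn₀⟩ := Filter.eventually_atTop.1 (hlim.eventually (gt_mem_nhds hpos))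
  refine ⟨⌈ρ ^ (n₀ + 1)⌉₊ + 1, fun K hK c hc e he hM H p m₀ hH hL => ?_⟩
  have hK1 : (1 : ℝ) ≤ K := by exact_mod_cast (by omega : 1 ≤ K)
  have hB1 : (1 : ℝ) ≤ B := by exact_mod_cast hB
  obtain ⟨n, hn1, hn2⟩ := exists_nat_pow_near (show (1 : ℝ) ≤ B * K by nlinarith) hρ1
  have hKρ : ρ ^ (n₀ + 1) < K := by
    have h1 := Nat.le_ceil (ρ ^ (n₀ + 1))
    have h2 : ((⌈ρ ^ (n₀ + 1)⌉₊ + 1 : ℕ) : ℝ) ≤ K := by exact_mod_cast hK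
    push_cast at h2
    linarith
  have hn : n₀ ≤ n + 1 := by
    by_contra! hlt
    have h1 : ρ ^ (n + 1) ≤ ρ ^ (n₀ + 1) := pow_le_pow_right₀ hρ1.le (by omega)
    nlinarith
  have h1 := hn₀ (n + 1) hn
  have h2 := hmain hc he hM hH hL (J := n + 1) (by push_cast; exact hn2)
  have h3 : ((#H : ℕ) : ℝ) < ((A * (n + 1 + 1) + 1 : ℕ) : ℝ) ^ Q := by exact_mod_cast h2
  have h4 : ((A * (n + 1 + 1) + 1 : ℕ) : ℝ) ≤ (2 * A + 1) * ((n + 1 : ℕ) : ℝ) := by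
    push_cast
    have : (0 : ℝ) ≤ A := by positivity
    have : (0 : ℝ) ≤ n := by positivity
    nlinarith [mul_nonneg ‹(0 : ℝ) ≤ A› this]
  rw [div_lt_iff₀ (by positivity), pow_succ] at h1
  calc ((#H : ℕ) : ℝ) < ((A * (n + 1 + 1) + 1 : ℕ) : ℝ) ^ Q := h3
    _ ≤ ((2 * A + 1) * ((n + 1 : ℕ) : ℝ)) ^ Q := by gcongr
    _ = (2 * A + 1) ^ Q * ((n + 1 : ℕ) : ℝ) ^ Q := mul_pow _ _ _
    _ ≤ (2 * A + 1) ^ Q * (θ / B / ((2 * A + 1) ^ Q * ρ) * (ρ ^ n * ρ)) := by gcongr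
    _ = θ / B * ρ ^ n := by field_simp
    _ ≤ θ / B * (B * K) := by gcongr
    _ = θ * K := by field_simp

end Corners

section Cuts
variable {β : Type*} [DecidableEq β] {r : β → β → Prop}

/-- `I` is closed under passing to predecessors. -/
def IsDown (r : β → β → Prop) (I : Finset β) : Prop := ∀ a b, r a b → b ∈ I → a ∈ I

theorem IsDown.inter {I J : Finset β} (hI : IsDown r I) (hJ : IsDown r J) : IsDown r (I ∩ J) :=
  fun a b hab hb => by
    rw [mem_inter] at *
    exact ⟨hI a b hab hb.1, hJ a b hab hb.2⟩

theorem IsDown.union {I J : Finset β} (hI : IsDown r I) (hJ : IsDown r J) : IsDown r (I ∪ J) :=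
  fun a b hab hb => by
    rw [mem_union] at *
    exact hb.imp (hI a b hab) (hJ a b hab)

/-- The set of elements preceding `x` in `l`. -/
def before (l : List β) (x : β) : Finset β := (l.take (l.idxOf x)).toFinset

theorem mem_before {l : List β} {x y : β} (hy : y ∈ l) :
    y ∈ before l x ↔ l.idxOf y < l.idxOf x := by
  rw [before, List.mem_toFinset, List.mem_take_iff_idxOf_lt hy]

theorem before_append_cons {l m : List β} {x : β} (hx : x ∉ l) :
    before (l ++ x :: m) x = l.toFinset := by
  rw [before, List.idxOf_append_of_notMem hx]
  simp

variable [Fintype β]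

theorem append_mem_linExts_univ {l m : List β} : l ++ m ∈ linExts r univ ↔
    l ∈ linExts r l.toFinset ∧ m ∈ linExts r (l.toFinset)ᶜ ∧ IsDown r l.toFinset := by
  constructor
  · intro h
    rw [mem_linExts, List.nodup_append', List.pairwise_append] at h
    obtain ⟨⟨h1, h2, h3⟩, h4, h5, h6, h7⟩ := h
    refine ⟨mem_linExts.2 ⟨h1, by simp, h5⟩, mem_linExts.2 ⟨h2, fun a => ?_, h6⟩, ?_⟩
    · have := (h4 a).2 (mem_univ a)
      rw [mem_compl, List.mem_toFinset]
      refine ⟨fun ha ha' => h3 ha' ha, fun ha => ?_⟩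
      exact (List.mem_append.1 this).resolve_left ha
    · intro a b hab hb
      rw [List.mem_toFinset] at *
      by_contra ha
      have := (List.mem_append.1 ((h4 a).2 (mem_univ a))).resolve_left ha
      exact h7 b hb a this hab
  · rintro ⟨h1, h2, h3⟩
    have := append_mem_linExts h1 h2 disjoint_compl_right fun a ha b hb hr =>
      (mem_compl.1 hb) (h3 b a hr ha)
    rwa [union_compl] at this

theorem append_cons_mem_linExts_univ {l m : List β} {x : β} : l ++ x :: m ∈ linExts r univ ↔
    l ∈ linExts r l.toFinset ∧ m ∈ linExts r (insert x l.toFinset)ᶜ ∧ x ∉ l ∧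
      IsDown r l.toFinset ∧ IsDown r (insert x l.toFinset) := by
  have hins : (l ++ [x]).toFinset = insert x l.toFinset := by ext a; simp
  constructor
  · intro h
    have h1 := append_mem_linExts_univ.1 h
    have h2 : (l ++ [x]) ++ m ∈ linExts r univ := by simpa using h
    have h3 := append_mem_linExts_univ.1 h2
    rw [hins] at h3
    refine ⟨h1.1, h3.2.1, fun hx => ?_, h1.2.2, h3.2.2⟩
    exact (List.nodup_append'.1 (mem_linExts.1 h).1).2.2 hx (by simp)
  · rintro ⟨h1, h2, h3, h4, h5⟩
    have h6 : (l ++ [x]) ++ m ∈ linExts r univ := by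
      refine append_mem_linExts_univ.2 ?_
      rw [hins]
      refine ⟨?_, h2, h5⟩
      have hx : [x] ∈ linExts r {x} := mem_linExts.2 ⟨by simp, by simp, by simp⟩
      have := append_mem_linExts h1 hx (by simpa using h3) fun a ha b hb hr => by
        rw [mem_singleton] at hb
        subst hb
        exact h3 (List.mem_toFinset.1 (h4 _ _ hr ha))
      rwa [union_comm, ← insert_eq] at this
    simpa using h6

/-- The number of linear arrangements in which exactly the elements of `I` precede `x`. -/
noncomputable def cutWeight (r : β → β → Prop) (x : β) (I : Finset β) : ℕ :=
  #{l ∈ linExts r univ | before l x = I}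

theorem exists_eq_append_cons {l : List β} (hl : l ∈ linExts r univ) (x : β) :
    ∃ l₁ l₂, l = l₁ ++ x :: l₂ ∧ x ∉ l₁ ∧ before l x = l₁.toFinset := by
  obtain ⟨l₁, l₂, rfl⟩ := List.append_of_mem (((mem_linExts.1 hl).2.1 x).2 (mem_univ x))
  have := (append_cons_mem_linExts_univ.1 hl).2.2.1
  exact ⟨l₁, l₂, rfl, this, before_append_cons this⟩

theorem isDown_of_cutWeight_pos {x : β} {I : Finset β} (h : cutWeight r x I ≠ 0) :
    x ∉ I ∧ IsDown r I ∧ IsDown r (insert x I) := by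
  obtain ⟨l, hl⟩ := card_pos.1 (Nat.pos_of_ne_zero h)
  rw [mem_filter] at hl
  obtain ⟨l₁, l₂, rfl, hx, hb⟩ := exists_eq_append_cons hl.1 x
  obtain ⟨-, -, -, h4, h5⟩ := append_cons_mem_linExts_univ.1 hl.1
  rw [← hl.2, hb]
  exact ⟨by simpa using hx, h4, h5⟩

theorem cutWeight_eq {x : β} {I : Finset β} (hx : x ∉ I) (h1 : IsDown r I)
    (h2 : IsDown r (insert x I)) :
    cutWeight r x I = numExts r I * numExts r (insert x I)ᶜ := by
  unfold cutWeight numExts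
  rw [← card_product]
  symm
  refine card_bij (fun p _ => p.1 ++ x :: p.2) ?_ ?_ ?_
  · rintro ⟨l, m⟩ h
    rw [mem_product] at h
    have hI := toFinset_of_mem_linExts h.1
    have hxl : x ∉ l := by rwa [← List.mem_toFinset, hI]
    rw [mem_filter, before_append_cons hxl, append_cons_mem_linExts_univ, hI]
    exact ⟨⟨h.1, h.2, hxl, h1, h2⟩, rfl⟩
  · rintro ⟨l, m⟩ h ⟨l', m'⟩ h' heq
    rw [mem_product] at h h'
    have := List.append_inj heq
      ((length_of_mem_linExts h.1).trans (length_of_mem_linExts h'.1).symm)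
    simpa using this
  · intro l hl
    rw [mem_filter] at hl
    obtain ⟨l₁, l₂, rfl, hxl, hb⟩ := exists_eq_append_cons hl.1 x
    rw [hl.2] at hb
    obtain ⟨h4, h5, -⟩ := append_cons_mem_linExts_univ.1 hl.1
    rw [← hb] at h4 h5
    exact ⟨(l₁, l₂), mem_product.2 ⟨h4, h5⟩, rfl⟩

theorem cutWeight_mul_le (x : β) (I J : Finset β) : cutWeight r x I * cutWeight r x J ≤
    cutWeight r x (I ∩ J) * cutWeight r x (I ∪ J) := by
  by_cases hI : cutWeight r x I = 0
  · simp [hI]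
  by_cases hJ : cutWeight r x J = 0
  · simp [hJ]
  obtain ⟨i1, i2, i3⟩ := isDown_of_cutWeight_pos hI
  obtain ⟨j1, j2, j3⟩ := isDown_of_cutWeight_pos hJ
  have e1 : insert x (I ∩ J) = insert x I ∩ insert x J := insert_inter_distrib _ _ _
  have e2 : insert x (I ∪ J) = insert x I ∪ insert x J := insert_union_distrib _ _ _
  rw [cutWeight_eq i1 i2 i3, cutWeight_eq j1 j2 j3,
    cutWeight_eq (by simp [i1]) (i2.inter j2) (e1 ▸ i3.inter j3),
    cutWeight_eq (by simp [i1, j1]) (i2.union j2) (e2 ▸ i3.union j3), e1, e2]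
  have h1 := numExts_mul_le_inter_union i2 j2
  have h2 := numExts_compl_mul_le_inter_union i3 j3
  calc _ = (numExts r I * numExts r J) *
        (numExts r (insert x I)ᶜ * numExts r (insert x J)ᶜ) := by ring
    _ ≤ _ := Nat.mul_le_mul h1 h2
    _ = _ := by ring

/-- The number of linear arrangements in which `y` precedes `x`. -/
noncomputable def countBefore (r : β → β → Prop) (y x : β) : ℕ :=
  #{l ∈ linExts r univ | l.idxOf y < l.idxOf x}

theorem sum_cutWeight_filter (x : β) (p : Finset β → Prop) [DecidablePred p] :
    ∑ I with p I, cutWeight r x I = #{l ∈ linExts r univ | p (before l x)} := by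
  rw [card_eq_sum_card_fiberwise (f := fun l => before l x) (t := univ.filter p)]
  · refine sum_congr rfl fun I hI => ?_
    rw [mem_filter] at hI
    unfold cutWeight
    congr 1
    ext l
    simp only [mem_filter]
    constructor
    · rintro ⟨h1, rfl⟩; exact ⟨⟨h1, hI.2⟩, rfl⟩
    · rintro ⟨⟨h1, -⟩, h2⟩; exact ⟨h1, h2⟩
  · intro l hl
    simpa using (mem_filter.1 hl).2

theorem sum_cutWeight_mem (x y : β) :
    ∑ I with y ∈ I, cutWeight r x I = countBefore r y x := by
  rw [sum_cutWeight_filter, countBefore]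
  congr 1
  refine filter_congr fun l hl => ?_
  exact mem_before (((mem_linExts.1 hl).2.1 y).2 (mem_univ y))

theorem sum_cutWeight_notMem (x y : β) (hxy : x ≠ y) :
    ∑ I with y ∉ I, cutWeight r x I = countBefore r x y := by
  rw [sum_cutWeight_filter, countBefore]
  congr 1
  refine filter_congr fun l hl => ?_
  have hy := ((mem_linExts.1 hl).2.1 y).2 (mem_univ y)
  rw [mem_before hy, not_lt]
  exact (Ne.le_iff_lt fun h => hxy (List.idxOf_inj
    (((mem_linExts.1 hl).2.1 x).2 (mem_univ x)) |>.1 h))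

theorem sum_cutWeight (x : β) : ∑ I, cutWeight r x I = numExts r univ := by
  have := sum_cutWeight_filter (r := r) x (fun _ => True)
  simpa [numExts] using this

end Cuts

section Correlation
variable {β : Type*} [DecidableEq β]

theorem filter_mul_le_inter_union {μ : Finset β → ℝ} (h0 : ∀ I, 0 ≤ μ I)
    (hμ : ∀ I J, μ I * μ J ≤ μ (I ∩ J) * μ (I ∪ J)) {p : Finset β → Prop} [DecidablePred p]
    (hp : ∀ I J, p I → p J → p (I ∩ J) ∧ p (I ∪ J)) (I J : Finset β) :
    (if p I then μ I else 0) * (if p J then μ J else 0) ≤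
      (if p (I ∩ J) then μ (I ∩ J) else 0) * (if p (I ∪ J) then μ (I ∪ J) else 0) := by
  by_cases hI : p I
  · by_cases hJ : p J
    · simpa [hI, hJ, hp I J hI hJ] using hμ I J
    · simp only [hJ, if_false, mul_zero]
      exact mul_nonneg (by split_ifs <;> simp [h0]) (by split_ifs <;> simp [h0])
  · simp only [hI, if_false, zero_mul]
    exact mul_nonneg (by split_ifs <;> simp [h0]) (by split_ifs <;> simp [h0])

variable [Fintype β]

theorem sum_filter_mul_le {μ : Finset β → ℝ} (h0 : ∀ I, 0 ≤ μ I)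
    (hμ : ∀ I J, μ I * μ J ≤ μ (I ∩ J) * μ (I ∪ J)) {p q : Finset β → Prop} [DecidablePred p]
    [DecidablePred q] (hp : ∀ I J, I ⊆ J → p I → p J) (hq : ∀ I J, I ⊆ J → q I → q J) :
    (∑ I with p I, μ I) * ∑ I with q I, μ I ≤ (∑ I, μ I) * ∑ I with p I ∧ q I, μ I := by
  have hmono : ∀ (p : Finset β → Prop) [DecidablePred p], (∀ I J, I ⊆ J → p I → p J) →
      Monotone fun I => if p I then (1 : ℝ) else 0 := by
    intro p _ hp I J hIJ
    by_cases h : p I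
    · simp [h, hp I J hIJ h]
    · simp only [h, if_false]; split_ifs <;> simp
  have hnn : ∀ (p : Finset β → Prop) [DecidablePred p],
      0 ≤ fun I => if p I then (1 : ℝ) else 0 := by
    intro p _ I
    simp only [Pi.zero_apply]; split_ifs <;> simp
  have := fkg _ _ μ h0 (hnn p) (hnn q) (hmono p hp) (hmono q hq) hμ
  simpa [sum_filter, ← ite_and, and_comm] using this

theorem pow_mul_le_sum_superset {μ : Finset β → ℝ} (h0 : ∀ I, 0 ≤ μ I)
    (hμ : ∀ I J, μ I * μ J ≤ μ (I ∩ J) * μ (I ∪ J)) {κ : ℝ} (hκ : 0 ≤ κ) {s : Finset β}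
    (hs : ∀ a ∈ s, κ * ∑ I, μ I ≤ ∑ I with a ∈ I, μ I) :
    κ ^ #s * ∑ I, μ I ≤ ∑ I with s ⊆ I, μ I := by
  have htot : 0 ≤ ∑ I, μ I := sum_nonneg fun I _ => h0 I
  rcases htot.eq_or_lt with htot | htot
  · rw [← htot, mul_zero]; exact sum_nonneg fun I _ => h0 I
  induction s using Finset.induction_on with
  | empty => simp
  | insert a s ha ih =>
    have h1 := ih fun b hb => hs b (mem_insert_of_mem hb)
    have h2 := hs a (mem_insert_self _ _)
    have h3 := sum_filter_mul_le h0 hμ (p := fun I => a ∈ I) (q := fun I => s ⊆ I)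
      (fun I J h ha => h ha) (fun I J h hs => hs.trans h)
    simp_rw [insert_subset_iff]
    rw [card_insert_of_notMem ha]
    refine le_of_mul_le_mul_left ?_ htot
    calc _ = (κ * ∑ I, μ I) * (κ ^ #s * ∑ I, μ I) := by ring
      _ ≤ _ := mul_le_mul h2 h1 (by positivity) (sum_nonneg fun I _ => h0 I)
      _ ≤ _ := h3

theorem pow_mul_le_sum_disjoint {μ : Finset β → ℝ} (h0 : ∀ I, 0 ≤ μ I)
    (hμ : ∀ I J, μ I * μ J ≤ μ (I ∩ J) * μ (I ∪ J)) {κ : ℝ} (hκ : 0 ≤ κ) {t : Finset β}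
    (ht : ∀ b ∈ t, κ * ∑ I, μ I ≤ ∑ I with b ∉ I, μ I) :
    κ ^ #t * ∑ I, μ I ≤ ∑ I with Disjoint t I, μ I := by
  have hsum : ∀ (p : Finset β → Prop) [DecidablePred p],
      ∑ I with p Iᶜ, μ Iᶜ = ∑ I with p I, μ I := by
    intro p _
    rw [sum_filter, sum_filter]
    exact Fintype.sum_equiv (compl_involutive.toPerm _) _ _ fun I => rfl
  have htot : ∑ I, μ Iᶜ = ∑ I, μ I := Fintype.sum_equiv (compl_involutive.toPerm _) _ _ fun I => rfl
  have := pow_mul_le_sum_superset (μ := fun I => μ Iᶜ) (fun I => h0 _)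
    (fun I J => by rw [compl_inter, compl_union, mul_comm (μ (Iᶜ ∪ Jᶜ))]; exact hμ _ _)
    hκ (s := t) (fun b hb => by
      have := hsum (fun I => b ∉ I)
      simp only [mem_compl, not_not] at this
      rw [htot, this]
      exact ht b hb)
  rw [htot] at this
  have h2 := hsum (fun I => Disjoint t I)
  simp only [disjoint_compl_right_iff] at h2
  rwa [h2] at this

/-- If each of the events `a ∈ I` and `b ∉ I` has probability at least `1 / 2 + δ`, for `a ∈ s`
and `b ∈ t`, then these events hold simultaneously with probability bounded below. -/
theorem mul_le_sum_superset_disjoint {μ : Finset β → ℝ} (h0 : ∀ I, 0 ≤ μ I)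
    (hμ : ∀ I J, μ I * μ J ≤ μ (I ∩ J) * μ (I ∪ J)) {δ : ℝ} (hδ : 0 < δ)
    {s t : Finset β} (hs : ∀ a ∈ s, (1 / 2 + δ) * ∑ I, μ I ≤ ∑ I with a ∈ I, μ I)
    (ht : ∀ b ∈ t, (1 / 2 + δ) * ∑ I, μ I ≤ ∑ I with b ∉ I, μ I) :
    ((2 * δ) ^ #t / 2) ^ #s * (1 / 2) ^ #t * ∑ I, μ I ≤
      ∑ I with s ⊆ I ∧ Disjoint t I, μ I := by
  have htot : 0 ≤ ∑ I, μ I := sum_nonneg fun I _ => h0 I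
  have hT : (1 / 2 : ℝ) ^ #t * ∑ I, μ I ≤ ∑ I with Disjoint t I, μ I := by
    refine pow_mul_le_sum_disjoint h0 hμ (by norm_num) fun b hb => le_trans ?_ (ht b hb)
    gcongr; linarith
  -- conditioned on `a ∈ I`
  have hA : ∀ a ∈ s, (2 * δ) ^ #t / 2 * ∑ I, μ I ≤ ∑ I with a ∈ I ∧ Disjoint t I, μ I := by
    intro a ha
    have h1 := pow_mul_le_sum_disjoint (μ := fun I => if a ∈ I then μ I else 0)
      (fun I => by split_ifs <;> simp [h0])
      (filter_mul_le_inter_union h0 hμ (p := fun I => a ∈ I)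
        fun I J hI hJ => by simp [hI, hJ]) (κ := 2 * δ) (by positivity) (t := t) (fun b hb => by
        rw [← sum_filter]
        have e1 : ∑ I with b ∉ I, (if a ∈ I then μ I else 0) = ∑ I with a ∈ I ∧ b ∉ I, μ I := by
          rw [sum_filter, sum_filter]
          refine sum_congr rfl fun I _ => ?_
          by_cases a ∈ I <;> by_cases b ∈ I <;> simp [*]
        have e2 : ∑ I, μ I + ∑ I with a ∈ I ∧ b ∉ I, μ I ≥
            ∑ I with a ∈ I, μ I + ∑ I with b ∉ I, μ I := by
          rw [sum_filter, sum_filter, sum_filter, ← sum_add_distrib, ← sum_add_distrib]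
          refine sum_le_sum fun I _ => ?_
          have := h0 I
          by_cases a ∈ I <;> by_cases b ∈ I <;> simp [*]
        have e3 : ∑ I with a ∈ I, μ I ≤ ∑ I, μ I :=
          sum_le_sum_of_subset_of_nonneg (filter_subset _ _) fun I _ _ => h0 I
        rw [e1]
        have h2 := hs a ha
        have h3 := ht b hb
        have h4 : 2 * δ * ∑ I with a ∈ I, μ I ≤ 2 * δ * ∑ I, μ I := by gcongr
        linarith)
    rw [← sum_filter] at h1
    have e1 : ∑ I with Disjoint t I, (if a ∈ I then μ I else 0) =
        ∑ I with a ∈ I ∧ Disjoint t I, μ I := by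
      rw [sum_filter, sum_filter]
      refine sum_congr rfl fun I _ => ?_
      by_cases a ∈ I <;> by_cases Disjoint t I <;> simp [*]
    rw [e1] at h1
    refine le_trans ?_ h1
    have h2 := hs a ha
    calc (2 * δ) ^ #t / 2 * ∑ I, μ I = (2 * δ) ^ #t * (1 / 2 * ∑ I, μ I) := by ring
      _ ≤ _ := by
        gcongr
        refine le_trans ?_ h2
        gcongr; linarith
  have h1 := pow_mul_le_sum_superset (μ := fun I => if Disjoint t I then μ I else 0)
    (fun I => by split_ifs <;> simp [h0])
    (filter_mul_le_inter_union h0 hμ (p := fun I => Disjoint t I)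
      fun I J hI hJ => ⟨hI.mono_right inter_subset_left, disjoint_union_right.2 ⟨hI, hJ⟩⟩)
    (κ := (2 * δ) ^ #t / 2) (by positivity) (s := s) (fun a ha => by
      rw [← sum_filter]
      have e1 : ∑ I with a ∈ I, (if Disjoint t I then μ I else 0) =
          ∑ I with a ∈ I ∧ Disjoint t I, μ I := by
        rw [sum_filter, sum_filter]
        refine sum_congr rfl fun I _ => ?_
        by_cases a ∈ I <;> by_cases Disjoint t I <;> simp [*]
      have e3 : ∑ I with Disjoint t I, μ I ≤ ∑ I, μ I :=
        sum_le_sum_of_subset_of_nonneg (filter_subset _ _) fun I _ _ => h0 I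
      rw [e1]
      refine le_trans ?_ (hA a ha)
      gcongr)
  rw [← sum_filter] at h1
  have e1 : ∑ I with s ⊆ I, (if Disjoint t I then μ I else 0) =
      ∑ I with s ⊆ I ∧ Disjoint t I, μ I := by
    rw [sum_filter, sum_filter]
    refine sum_congr rfl fun I _ => ?_
    by_cases s ⊆ I <;> by_cases Disjoint t I <;> simp [*]
  rw [e1] at h1
  refine le_trans ?_ h1
  rw [mul_assoc]
  gcongr

end Correlation

section LowerCut
variable {β : Type*}

theorem exists_maximal_of_mem {r : β → β → Prop} (hirr : ∀ a, ¬ r a a)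
    (htr : ∀ a b c, r a b → r b c → r a c) {A : Finset β} {a : β} (ha : a ∈ A) :
    ∃ m ∈ A, (m = a ∨ r a m) ∧ ∀ b ∈ A, ¬ r m b := by
  classical
  induction hn : #{b ∈ A | r a b} using Nat.strong_induction_on generalizing a with
  | _ n ih =>
  by_cases h : ∃ b ∈ A, r a b
  · obtain ⟨b, hb, hab⟩ := h
    have hlt : #{d ∈ A | r b d} < n := by
      rw [← hn]
      refine card_lt_card ⟨fun d hd => ?_, fun hsub => ?_⟩
      · rw [mem_filter] at *
        exact ⟨hd.1, htr _ _ _ hab hd.2⟩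
      · exact hirr b (mem_filter.1 (hsub (mem_filter.2 ⟨hb, hab⟩))).2
    obtain ⟨m, hm, h1, h2⟩ := ih _ hlt hb rfl
    refine ⟨m, hm, Or.inr ?_, h2⟩
    rcases h1 with rfl | h1
    · exact hab
    · exact htr _ _ _ hab h1
  · push Not at h
    exact ⟨a, ha, Or.inl rfl, h⟩

variable [Fintype β] [DecidableEq β] {r : β → β → Prop}

/-- The elements preceding `x` with probability at least `1 / 2 + ε`. -/
noncomputable def lower (r : β → β → Prop) (ε : ℝ) (x : β) : Finset β :=
  {y | y ≠ x ∧ (1 / 2 + ε) * numExts r univ ≤ countBefore r y x}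

/-- The proportion of linear arrangements in which `lower r ε x` precedes `x` that is guaranteed
when antichains have at most `W` elements. -/
noncomputable def cutBound (ε : ℝ) (W : ℕ) : ℝ := ((2 * ε) ^ W / 2) ^ W * (1 / 2) ^ W

theorem cutBound_pos {ε : ℝ} (hε : 0 < ε) (W : ℕ) : 0 < cutBound ε W := by
  unfold cutBound; positivity

theorem cutBound_le_one {ε : ℝ} (hε : 0 < ε) (hε1 : ε ≤ 1 / 2) (W : ℕ) : cutBound ε W ≤ 1 := by
  unfold cutBound
  have h1 : (2 * ε) ^ W ≤ 1 := pow_le_one₀ (by positivity) (by linarith)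
  have h2 : ((2 * ε) ^ W / 2) ^ W ≤ 1 := pow_le_one₀ (by positivity) (by linarith)
  exact mul_le_one₀ h2 (by positivity) (pow_le_one₀ (by norm_num) (by norm_num))

theorem cutBound_mul_le {ε : ℝ} (hε : 0 < ε) (hε1 : ε ≤ 1 / 2) {W : ℕ} (hirr : ∀ a, ¬ r a a)
    (htr : ∀ a b c, r a b → r b c → r a c)
    (hW : ∀ A : Finset β, (A : Set β).Pairwise (fun a b => ¬ r a b) → #A ≤ W) (x : β)
    (hx : ∀ y ≠ x, (1 / 2 + ε) * numExts r univ ≤ countBefore r y x ∨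
      (1 / 2 + ε) * numExts r univ ≤ countBefore r x y) :
    cutBound ε W * numExts r univ ≤ cutWeight r x (lower r ε x) := by
  classical
  set A := lower r ε x with hA
  set B := (insert x A)ᶜ with hB
  set s := {a ∈ A | ∀ b ∈ A, ¬ r a b} with hs
  set t := {a ∈ B | ∀ b ∈ B, ¬ r b a} with ht
  have hsW : #s ≤ W := hW s fun a ha b hb _ => (mem_filter.1 ha).2 b (mem_filter.1 hb).1
  have htW : #t ≤ W := hW t fun a ha b hb _ => (mem_filter.1 hb).2 a (mem_filter.1 ha).1
  have htot : (∑ I, (cutWeight r x I : ℝ)) = numExts r univ := by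
    exact_mod_cast sum_cutWeight x
  have key := mul_le_sum_superset_disjoint (μ := fun I => (cutWeight r x I : ℝ))
    (fun I => Nat.cast_nonneg _) (fun I J => by exact_mod_cast cutWeight_mul_le x I J) hε
    (s := s) (t := t) (fun a ha => by
      have h1 := (mem_filter.1 (mem_filter.1 ha).1).2.2
      rw [htot]
      exact_mod_cast (sum_cutWeight_mem (r := r) x a) ▸ h1) (fun b hb => by
      have h1 := (mem_filter.1 hb).1
      rw [hB, mem_compl, mem_insert, not_or] at h1
      have h2 := (hx b h1.1).resolve_left fun h => h1.2 (by
        rw [hA, lower, mem_filter]; exact ⟨mem_univ _, h1.1, h⟩)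
      rw [htot]
      exact_mod_cast (sum_cutWeight_notMem (r := r) x b (Ne.symm h1.1)) ▸ h2)
  rw [htot] at key
  have hsupp : (∑ I with s ⊆ I ∧ Disjoint t I, (cutWeight r x I : ℝ)) ≤ cutWeight r x A := by
    have : ∑ I with s ⊆ I ∧ Disjoint t I, cutWeight r x I ≤ ∑ I ∈ {A}, cutWeight r x I := by
      refine sum_le_sum_of_ne_zero fun I hI hne => ?_
      obtain ⟨h1, h2, -⟩ := isDown_of_cutWeight_pos hne
      obtain ⟨-, hsI, htI⟩ := mem_filter.1 hI
      rw [mem_singleton]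
      refine Subset.antisymm (fun y hy => ?_) (fun y hy => ?_)
      · by_contra hyA
        have hyB : y ∈ B := by
          rw [hB, mem_compl, mem_insert, not_or]
          exact ⟨fun h => h1 (h ▸ hy), hyA⟩
        obtain ⟨m, hm, h3, h4⟩ := exists_maximal_of_mem (r := flip r) hirr
          (fun a b c hab hbc => htr c b a hbc hab) hyB
        refine disjoint_left.1 htI (mem_filter.2 ⟨hm, h4⟩) ?_
        rcases h3 with rfl | h3
        · exact hy
        · exact h2 _ _ h3 hy
      · obtain ⟨m, hm, h3, h4⟩ := exists_maximal_of_mem hirr htr hy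
        have hmI := hsI (mem_filter.2 ⟨hm, h4⟩)
        rcases h3 with rfl | h3
        · exact hmI
        · exact h2 _ _ h3 hmI
    rw [sum_singleton] at this
    exact_mod_cast this
  refine le_trans ?_ (key.trans hsupp)
  have h1 : (2 * ε) ^ W ≤ (2 * ε) ^ #t := pow_le_pow_of_le_one (by positivity) (by linarith) htW
  have h2 : (1 / 2 : ℝ) ^ W ≤ (1 / 2) ^ #t :=
    pow_le_pow_of_le_one (by norm_num) (by norm_num) htW
  have h3 : ((2 * ε) ^ W / 2) ^ W ≤ ((2 * ε) ^ #t / 2) ^ #s := by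
    have h4 : (2 * ε) ^ W ≤ 1 := pow_le_one₀ (by positivity) (by linarith)
    calc _ ≤ ((2 * ε) ^ W / 2) ^ #s := pow_le_pow_of_le_one (by positivity) (by linarith) hsW
      _ ≤ _ := by gcongr
  unfold cutBound
  gcongr

end LowerCut

section Sites
variable {β : Type*} {r : β → β → Prop}

/-- Inserting `u` into one of the first `t + 1` gaps of an arrangement of `Q`. -/
theorem mul_card_filter_take_le [DecidableEq β] {Q : Finset β} {u : β} {q : β → Prop}
    [DecidablePred q] (hu : u ∉ Q) (h1 : ∀ a ∈ Q, ¬ r a u) (h2 : ∀ a ∈ Q, r u a → q a) (t : ℕ) :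
    (t + 1) * #{l ∈ linExts r Q | t ≤ l.length ∧ ∀ y ∈ l.take t, ¬ q y} ≤
      numExts r (insert u Q) := by
  rw [← card_range (t + 1), ← card_product]
  unfold numExts
  have hul : ∀ l ∈ linExts r Q, u ∉ l := fun l hl h => hu ((mem_linExts.1 hl).2.1 u |>.1 h)
  refine card_le_card_of_injOn (fun p => p.2.take p.1 ++ u :: p.2.drop p.1) ?_ ?_
  · rintro ⟨i, l⟩ h
    rw [mem_coe, mem_product, mem_filter, mem_range] at h
    obtain ⟨hi, hl, -, hq⟩ := h
    have hul := hul l hl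
    rw [mem_linExts] at hl
    obtain ⟨k1, k2, k3⟩ := hl
    have hperm : (l.take i ++ u :: l.drop i).Perm (u :: l) := by
      refine List.perm_middle.trans ?_
      rw [List.take_append_drop]
    rw [mem_coe, mem_linExts]
    refine ⟨hperm.nodup_iff.2 (List.nodup_cons.2 ⟨hul, k1⟩), fun a => ?_, ?_⟩
    · rw [hperm.mem_iff, List.mem_cons, mem_insert, k2]
    · have k4 := k3
      rw [← List.take_append_drop i l, List.pairwise_append] at k4
      obtain ⟨m1, m2, m3⟩ := k4
      refine List.pairwise_append.2 ⟨m1, List.pairwise_cons.2 ⟨fun a ha => ?_, m2⟩, ?_⟩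
      · exact h1 a ((k2 a).1 (List.mem_of_mem_drop ha))
      · intro a ha b hb
        rcases List.mem_cons.1 hb with rfl | hb
        · intro hr
          have ha' : a ∈ l.take t := (List.take_subset_take_left l (by omega)) ha
          exact hq a ha' (h2 a ((k2 a).1 (List.mem_of_mem_take ha)) hr)
        · exact m3 a ha b hb
  · rintro ⟨i, l⟩ h ⟨j, m⟩ h' heq
    rw [mem_coe, mem_product, mem_filter, mem_range] at h h'
    obtain ⟨hi, hl, hlen, -⟩ := h
    obtain ⟨hj, hm, hlen', -⟩ := h'
    simp only at heq hi hj hl hm hlen hlen'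
    have e1 : (l.take i).idxOf u = (l.take i).length :=
      List.idxOf_of_notMem fun h => hul l hl (List.mem_of_mem_take h)
    have i1 : (l.take i ++ u :: l.drop i).idxOf u = i := by
      rw [List.idxOf_append_of_notMem fun h => hul l hl (List.mem_of_mem_take h)]
      simp; omega
    have j1 : (m.take j ++ u :: m.drop j).idxOf u = j := by
      rw [List.idxOf_append_of_notMem fun h => hul m hm (List.mem_of_mem_take h)]
      simp; omega
    have hij : i = j := by rw [← i1, heq, j1]
    subst hij
    have := List.append_inj heq (by simp; omega)
    have e2 : l = m := by
      rw [← List.take_append_drop i l, ← List.take_append_drop i m, this.1,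
        (List.cons.inj this.2).2]
    rw [e2]

/-- Few elements have few elements above them. -/
theorem card_filter_above_lt_le [Fintype β] [DecidableEq β] [DecidableRel r] {W : ℕ}
    (hirr : ∀ a, ¬ r a a) (htr : ∀ a b c, r a b → r b c → r a c)
    (hW : ∀ A : Finset β, (A : Set β).Pairwise (fun a b => ¬ r a b) → #A ≤ W) (t : ℕ) :
    #{c | #{y | r c y} < t} ≤ W * t := by
  have := card_le_mul_card_image_of_maps_to (s := ({c | #{y | r c y} < t} : Finset β))
    (t := range t) (f := fun c => #{y | r c y}) (fun c hc => by simpa using hc) W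
    (fun k _ => hW _ fun a ha b hb _ hab => by
      simp only [coe_filter, mem_filter, mem_univ, true_and, Set.mem_ofPred_eq] at ha hb
      have : #{y | r b y} < #{y | r a y} := by
        refine card_lt_card ⟨fun d hd => ?_, fun hsub => ?_⟩
        · rw [mem_filter] at *
          exact ⟨hd.1, htr _ _ _ hab hd.2⟩
        · exact hirr b (mem_filter.1 (hsub (mem_filter.2 ⟨mem_univ _, hab⟩))).2
      omega)
  simpa using this

end Sites

section CutSpec
variable {β : Type*} [Fintype β] [DecidableEq β] {r : β → β → Prop} {η : ℝ} {x : β} {A : Finset β}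

theorem numExts_mul_numExts_compl_le {I : Finset β} (hI : IsDown r I) :
    numExts r I * numExts r Iᶜ ≤ numExts r univ := by
  have := numExts_mul_le (r := r) (disjoint_compl_right (a := I)) fun a ha b hb hr =>
    mem_compl.1 hb (hI b a hr ha)
  rwa [union_compl] at this

theorem numExts_insert_compl_le (hx : x ∉ A) (hA : IsDown r (insert x A)) :
    numExts r (insert x A)ᶜ ≤ numExts r Aᶜ := by
  have h1 : numExts r {x} * numExts r (insert x A)ᶜ ≤ numExts r ({x} ∪ (insert x A)ᶜ) := by
    refine numExts_mul_le ?_ fun a ha b hb hr => ?_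
    · rw [disjoint_singleton_left]; simp
    · rw [mem_singleton] at ha
      subst ha
      exact mem_compl.1 hb (hA b a hr (mem_insert_self _ _))
  have h2 : ({x} ∪ (insert x A)ᶜ : Finset β) = Aᶜ := by
    ext a
    by_cases h : a = x
    · simp [h, hx]
    · simp [h]
  have h3 : 1 ≤ numExts r {x} := card_pos.2 ⟨[x], mem_linExts.2 ⟨by simp, by simp, by simp⟩⟩
  rw [h2] at h1
  nlinarith

theorem cut_spec (hη : 0 < η) (hM : 0 < numExts r univ)
    (h : η * numExts r univ ≤ cutWeight r x A) :
    x ∉ A ∧ IsDown r A ∧ IsDown r (insert x A) ∧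
      η * numExts r univ ≤ (numExts r A : ℝ) * numExts r Aᶜ ∧
      η * numExts r Aᶜ ≤ numExts r (insert x A)ᶜ := by
  have hM' : (0 : ℝ) < numExts r univ := by exact_mod_cast hM
  have hpos : (0 : ℝ) < cutWeight r x A := lt_of_lt_of_le (by positivity) h
  obtain ⟨h1, h2, h3⟩ := isDown_of_cutWeight_pos (r := r) (x := x) (I := A) (by
    intro h0; rw [h0] at hpos; simp at hpos)
  have e := cutWeight_eq h1 h2 h3
  have hle : (numExts r (insert x A)ᶜ : ℝ) ≤ numExts r Aᶜ := by
    exact_mod_cast numExts_insert_compl_le h1 h3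
  have hle' : (numExts r A : ℝ) * numExts r Aᶜ ≤ numExts r univ := by
    exact_mod_cast numExts_mul_numExts_compl_le h2
  rw [e] at h hpos
  push_cast at h hpos
  have hA : (0 : ℝ) < numExts r A := by
    by_contra h0
    have : (numExts r A : ℝ) = 0 := le_antisymm (not_lt.1 h0) (by positivity)
    rw [this] at hpos; simp at hpos
  refine ⟨h1, h2, h3, h.trans (by gcongr), ?_⟩
  refine le_of_mul_le_mul_left ?_ hA
  calc (numExts r A : ℝ) * (η * numExts r Aᶜ) = η * (numExts r A * numExts r Aᶜ) := by ring
    _ ≤ η * numExts r univ := by gcongr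
    _ ≤ _ := h

theorem numExts_pos_of_le {I : Finset β} (hη : 0 < η) (hM : 0 < numExts r univ)
    (h : η * numExts r univ ≤ (numExts r I : ℝ) * numExts r Iᶜ) :
    0 < numExts r I ∧ 0 < numExts r Iᶜ := by
  have hM' : (0 : ℝ) < numExts r univ := by exact_mod_cast hM
  have : (0 : ℝ) < (numExts r I : ℝ) * numExts r Iᶜ := lt_of_lt_of_le (by positivity) h
  have h2 : 0 < numExts r I * numExts r Iᶜ := by exact_mod_cast this
  exact ⟨Nat.pos_of_mul_pos_right h2, Nat.pos_of_mul_pos_left h2⟩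

/-- Unions of down-sets that are often initial segments are often initial segments. -/
theorem mul_le_numExts_union {I J : Finset β} {κ : ℝ} (hκ : 0 ≤ κ)
    (hM : 0 < numExts r univ) (hI : IsDown r I) (hJ : IsDown r J)
    (h1 : η * numExts r univ ≤ (numExts r I : ℝ) * numExts r Iᶜ)
    (h2 : κ * numExts r univ ≤ (numExts r J : ℝ) * numExts r Jᶜ) :
    η * κ * numExts r univ ≤ (numExts r (I ∪ J) : ℝ) * numExts r (I ∪ J)ᶜ := by
  have hM' : (0 : ℝ) < numExts r univ := by exact_mod_cast hM
  have k1 : (numExts r I * numExts r J : ℝ) ≤ numExts r (I ∩ J) * numExts r (I ∪ J) := by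
    exact_mod_cast numExts_mul_le_inter_union hI hJ
  have k2 : (numExts r Iᶜ * numExts r Jᶜ : ℝ) ≤ numExts r (I ∩ J)ᶜ * numExts r (I ∪ J)ᶜ := by
    exact_mod_cast numExts_compl_mul_le_inter_union hI hJ
  have k3 : (numExts r (I ∩ J) * numExts r (I ∩ J)ᶜ : ℝ) ≤ numExts r univ := by
    exact_mod_cast numExts_mul_numExts_compl_le (hI.inter hJ)
  refine le_of_mul_le_mul_left ?_ hM'
  calc (numExts r univ : ℝ) * (η * κ * numExts r univ)
      = (η * numExts r univ) * (κ * numExts r univ) := by ring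
    _ ≤ (numExts r I * numExts r Iᶜ) * (numExts r J * numExts r Jᶜ) := by gcongr
    _ = (numExts r I * numExts r J) * (numExts r Iᶜ * numExts r Jᶜ) := by ring
    _ ≤ (numExts r (I ∩ J) * numExts r (I ∪ J)) *
        (numExts r (I ∩ J)ᶜ * numExts r (I ∪ J)ᶜ) := by gcongr
    _ = (numExts r (I ∩ J) * numExts r (I ∩ J)ᶜ) *
        (numExts r (I ∪ J) * numExts r (I ∪ J)ᶜ) := by ring
    _ ≤ _ := by gcongr

theorem mul_numExts_compl_union_le {I J : Finset β} (hxI : IsDown r (insert x I)) (hJ : IsDown r J)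
    (hIJ : I ⊆ J) (hx : x ∉ J)
    (hpos : 0 < numExts r Iᶜ)
    (h : η * numExts r Iᶜ ≤ numExts r (insert x I)ᶜ) :
    η * numExts r Jᶜ ≤ numExts r (insert x J)ᶜ := by
  have k : (numExts r (insert x I)ᶜ * numExts r Jᶜ : ℝ) ≤
      numExts r Iᶜ * numExts r (insert x J)ᶜ := by
    have := numExts_compl_mul_le_inter_union hxI hJ
    have e1 : insert x I ∩ J = I := by
      rw [insert_inter_of_notMem hx, inter_eq_left.2 hIJ]
    have e2 : insert x I ∪ J = insert x J := by
      rw [insert_union, union_eq_right.2 hIJ]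
    rw [e1, e2] at this
    exact_mod_cast this
  have hpos' : (0 : ℝ) < numExts r Iᶜ := by exact_mod_cast hpos
  refine le_of_mul_le_mul_left ?_ hpos'
  calc (numExts r Iᶜ : ℝ) * (η * numExts r Jᶜ) = (η * numExts r Iᶜ) * numExts r Jᶜ := by ring
    _ ≤ numExts r (insert x I)ᶜ * numExts r Jᶜ := by gcongr
    _ ≤ _ := k

theorem countBefore_add_countBefore {a b : β} (hab : a ≠ b) :
    countBefore r a b + countBefore r b a = numExts r univ := by
  unfold countBefore numExts
  rw [← card_filter_add_card_filter_not (s := linExts r univ) (fun l => l.idxOf a < l.idxOf b)]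
  congr 2
  refine filter_congr fun l hl => ?_
  have hb := ((mem_linExts.1 hl).2.1 b).2 (mem_univ b)
  rw [not_lt]
  exact (Ne.le_iff_lt fun h => hab (List.idxOf_inj hb |>.1 h).symm).symm

theorem mem_lower {ε : ℝ} {a b : β} : a ∈ lower r ε b ↔
    a ≠ b ∧ (1 / 2 + ε) * numExts r univ ≤ countBefore r a b := by
  simp [lower]

theorem notMem_lower_of_mem {ε : ℝ} (hε : 0 < ε) (hM : 0 < numExts r univ) {a b : β}
    (h : a ∈ lower r ε b) : b ∉ lower r ε a := by
  intro h'
  rw [mem_lower] at h h'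
  have h1 : (countBefore r a b + countBefore r b a : ℝ) = numExts r univ := by
    exact_mod_cast countBefore_add_countBefore h.1
  have hM' : (0 : ℝ) < numExts r univ := by exact_mod_cast hM
  nlinarith [h.2, h'.2]

end CutSpec

section SiteWords
variable {β : Type*} [Fintype β] [DecidableEq β] {r : β → β → Prop} {η : ℝ}

open scoped Classical in
/-- The arrangements in which `c` is preceded by exactly the elements of `S`, and one of the `t`
elements following `c` is at least `x`. -/
noncomputable def siteWords (r : β → β → Prop) (x : β) (t : ℕ) (c : β) (S : Finset β) :
    Finset (List β) :=
  {l ∈ linExts r univ | ∃ l₁ l₂, l = l₁ ++ c :: l₂ ∧ l₁.toFinset = S ∧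
    ∃ y ∈ l₂.take t, y = x ∨ r x y}

theorem mem_siteWords {x c : β} {t : ℕ} {S : Finset β} {l : List β} :
    l ∈ siteWords r x t c S ↔ l ∈ linExts r univ ∧ ∃ l₁ l₂, l = l₁ ++ c :: l₂ ∧
      l₁.toFinset = S ∧ ∃ y ∈ l₂.take t, y = x ∨ r x y := by
  classical
  unfold siteWords
  rw [mem_filter]

/-- An up-set is reached soon after `insert c S`, if it has an element whose insertion does not
increase the number of arrangements much. -/
theorem le_card_siteWords {x c u : β} {t : ℕ} {S : Finset β} {κ : ℝ} (hκ : 0 < κ)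
    (hcS : c ∉ S) (hS : IsDown r S) (hcS' : IsDown r (insert c S)) (huS : u ∈ S)
    (hxu : ∀ a, r u a → a = x ∨ r x a)
    (h : κ * numExts r ((insert c S).erase u)ᶜ ≤ numExts r (insert c S)ᶜ)
    (ht : 2 ≤ κ * (t + 1)) (hlen : t ≤ #(insert c S)ᶜ) :
    (numExts r S : ℝ) * numExts r (insert c S)ᶜ ≤ 2 * #(siteWords r x t c S) := by
  classical
  set Q := (insert c S)ᶜ with hQ
  have huQ : u ∉ Q := by simp [hQ, huS]
  have hins : ((insert c S).erase u)ᶜ = insert u Q := by rw [hQ, compl_erase]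
  rw [hins] at h
  set bad := {l ∈ linExts r Q | t ≤ l.length ∧ ∀ y ∈ l.take t, ¬ (y = x ∨ r x y)} with hbaddef
  have hbad : (t + 1) * #bad ≤ numExts r (insert u Q) := by
    convert mul_card_filter_take_le (r := r) (q := fun y => y = x ∨ r x y) huQ
      (fun a ha hr => mem_compl.1 ha (hcS' a u hr (mem_insert_of_mem huS)))
      (fun a _ hr => hxu a hr) t
  have hbad' : ((t : ℝ) + 1) * #bad ≤ numExts r (insert u Q) := by exact_mod_cast hbad
  have hhalf : (2 * #bad : ℝ) ≤ numExts r Q := by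
    have : (0 : ℝ) ≤ #bad := by positivity
    calc (2 * #bad : ℝ) ≤ κ * (t + 1) * #bad := by gcongr
      _ = κ * ((t + 1) * #bad) := by ring
      _ ≤ κ * numExts r (insert u Q) := by gcongr
      _ ≤ _ := h
  set good := linExts r Q \ bad with hgood
  have hcard : #good + #bad = numExts r Q := card_sdiff_add_card_eq_card (filter_subset _ _)
  have hprod : numExts r S * #good ≤ #(siteWords r x t c S) := by
    unfold numExts
    rw [← card_product]
    refine card_le_card_of_injOn (fun p => p.1 ++ c :: p.2) ?_ ?_
    · rintro ⟨l, m⟩ hp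
      rw [mem_coe, mem_product, hgood, mem_sdiff, hbaddef, mem_filter] at hp
      obtain ⟨h1, h2, h3⟩ := hp
      have hl := toFinset_of_mem_linExts h1
      rw [mem_coe, mem_siteWords, append_cons_mem_linExts_univ, hl]
      refine ⟨⟨h1, h2, ?_, hS, hcS'⟩, l, m, rfl, hl, ?_⟩
      · rwa [← List.mem_toFinset, hl]
      · have hm := length_of_mem_linExts h2
        by_contra hno
        push Not at hno
        exact h3 ⟨h2, by rw [hm]; exact hlen, fun y hy => by simpa using hno y hy⟩
    · rintro ⟨l, m⟩ hp ⟨l', m'⟩ hp' heq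
      rw [mem_coe, mem_product] at hp hp'
      have := List.append_inj heq
        ((length_of_mem_linExts hp.1).trans (length_of_mem_linExts hp'.1).symm)
      simpa using this
  have hprod' : (numExts r S : ℝ) * #good ≤ #(siteWords r x t c S) := by exact_mod_cast hprod
  have hcard' : (#good + #bad : ℝ) = numExts r Q := by exact_mod_cast hcard
  have h0 : (0 : ℝ) ≤ numExts r S := by positivity
  nlinarith

theorem card_union_le_of_isDown {K : ℕ} [DecidableRel r] {x c u : β} {A B : Finset β}
    (htr : ∀ a b c, r a b → r b c → r a c)
    (hK : ∀ a, #{b | b ≠ a ∧ ¬ r a b ∧ ¬ r b a} ≤ K) (hxc : ¬ r x c)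
    (hA : IsDown r A) (hB : IsDown r B) (hc : c ∉ A) (hu : u ∉ B) (huA : u ∈ A) :
    #(A ∪ B) ≤ #{y | r y x} + (3 * K + 1) := by
  obtain ⟨N, hN⟩ : ∃ N : β → Finset β, ∀ a b, b ∈ N a ↔ b ≠ a ∧ ¬ r a b ∧ ¬ r b a :=
    ⟨fun a => {b | b ≠ a ∧ ¬ r a b ∧ ¬ r b a}, by simp⟩
  have hNK : ∀ a, #(N a) ≤ K := fun a => by
    refine le_trans (card_le_card fun b hb => ?_) (hK a)
    simpa using (hN a b).1 hb
  obtain ⟨D, hD⟩ : ∃ D : Finset β, D = ({y | r y x} : Finset β) := ⟨_, rfl⟩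
  have hDm : ∀ y, y ∈ D ↔ r y x := by simp [hD]
  rw [← hD]
  have hsub : A ∪ B ⊆ (D ∪ {x}) ∪ ((N x ∪ N c) ∪ N u) := by
    intro y hy
    by_contra hno
    simp only [hN, hDm, mem_union, mem_singleton, not_or] at hno
    obtain ⟨⟨n1, n2⟩, ⟨n3, n4⟩, n5⟩ := hno
    have hxy : r x y := by
      by_contra h
      exact n3 ⟨n2, h, n1⟩
    have hyA : y ∉ A := by
      intro hyA
      have hyc : y ≠ c := fun h => hc (h ▸ hyA)
      have h1 : ¬ r c y := fun h => hc (hA _ _ h hyA)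
      have h2 : ¬ r y c := fun h => hxc (htr _ _ _ hxy h)
      exact n4 ⟨hyc, h1, h2⟩
    have hyB := (mem_union.1 hy).resolve_left hyA
    have hyu : y ≠ u := fun h => hu (h ▸ hyB)
    have h1 : ¬ r u y := fun h => hu (hB _ _ h hyB)
    have h2 : ¬ r y u := fun h => hyA (hA _ _ h huA)
    exact n5 ⟨hyu, h1, h2⟩
  have e1 := card_le_card hsub
  have e2 := card_union_le (D ∪ {x}) ((N x ∪ N c) ∪ N u)
  have e3 := card_union_le D {x}
  have e4 := card_union_le (N x ∪ N c) (N u)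
  have e5 := card_union_le (N x) (N c)
  have := hNK x
  have := hNK c
  have := hNK u
  rw [card_singleton] at e3
  omega

theorem exists_siteWords {ε : ℝ} {K t : ℕ} [DecidableRel r] (hε : 0 < ε)
    (hη : 0 < η) (hirr : ∀ a, ¬ r a a) (htr : ∀ a b c, r a b → r b c → r a c)
    (hM : 0 < numExts r univ)
    (hcut : ∀ x, η * numExts r univ ≤ cutWeight r x (lower r ε x))
    (hK : ∀ a, #{b | b ≠ a ∧ ¬ r a b ∧ ¬ r b a} ≤ K) {x c : β} (hxc : ¬ r x c) (hcx : ¬ r c x)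
    (hx : x ∈ lower r ε c) (ht : 2 ≤ η * (t + 1)) (habove : t ≤ #{y | r c y}) :
    ∃ S : Finset β, #{y | r y x} ≤ #S ∧ #S ≤ #{y | r y x} + (3 * K + 1) ∧
      η ^ 3 / 2 * numExts r univ ≤ #(siteWords r x t c S) := by
  obtain ⟨u, hu, hxu, hmax⟩ := exists_maximal_of_mem hirr htr
    (A := {a ∈ lower r ε c | a = x ∨ r x a}) (a := x) (by simp [hx])
  rw [mem_filter] at hu
  obtain ⟨huA, hux⟩ := hu
  obtain ⟨c1, c2, c3, c4, c5⟩ := cut_spec hη hM (hcut c)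
  obtain ⟨u1, u2, u3, u4, u5⟩ := cut_spec hη hM (hcut u)
  set A := lower r ε c with hA
  set B := lower r ε u with hB
  have hcB : c ∉ B := notMem_lower_of_mem hε hM huA
  have hcS : c ∉ A ∪ B := by simp [c1, hcB]
  have hS : IsDown r (A ∪ B) := c2.union u2
  have hcS' : IsDown r (insert c (A ∪ B)) := by
    rw [← insert_union]; exact c3.union u2
  have huS : u ∈ A ∪ B := mem_union_left _ huA
  have hxu' : ∀ a, r u a → a = x ∨ r x a := fun a ha => Or.inr (by
    rcases hux with rfl | h
    · exact ha
    · exact htr _ _ _ h ha)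
  have huc : ¬ r u c := fun h => by
    rcases hxu' c h with rfl | h
    · exact c1 hx
    · exact hxc h
  have herase : IsDown r ((insert c (A ∪ B)).erase u) := by
    intro a b hab hb
    rw [mem_erase] at hb ⊢
    refine ⟨?_, hcS' a b hab hb.2⟩
    rintro rfl
    rcases mem_insert.1 hb.2 with rfl | hb2
    · exact huc hab
    rcases mem_union.1 hb2 with hb2 | hb2
    · exact hmax b (mem_filter.2 ⟨hb2, hxu' b hab⟩) hab
    · exact u1 (u2 _ _ hab hb2)
  have hbB := numExts_pos_of_le hη hM u4
  have hbA := numExts_pos_of_le hη hM c4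
  -- comparing the sizes of final segments
  have k1 : η * numExts r (A ∪ B)ᶜ ≤ numExts r (insert c (A ∪ B))ᶜ :=
    mul_numExts_compl_union_le c3 hS subset_union_left hcS hbA.2 c5
  have k2 : η * numExts r ((insert c (A ∪ B)).erase u)ᶜ ≤ numExts r (insert c (A ∪ B))ᶜ := by
    have := mul_numExts_compl_union_le (J := (insert c (A ∪ B)).erase u) u3 herase
      (fun b hb => mem_erase.2 ⟨fun h => u1 (h ▸ hb), by simp [hb]⟩) (by simp) hbB.2 u5
    rwa [insert_erase (mem_insert_of_mem huS)] at this
  have k3 : η * η * numExts r univ ≤ (numExts r (A ∪ B) : ℝ) * numExts r (A ∪ B)ᶜ :=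
    mul_le_numExts_union hη.le hM c2 u2 c4 u4
  have hlen : t ≤ #(insert c (A ∪ B))ᶜ := by
    refine habove.trans (card_le_card fun y hy => ?_)
    rw [mem_filter] at hy
    rw [mem_compl, mem_insert, not_or]
    refine ⟨?_, fun h => hcS (hS c y hy.2 h)⟩
    rintro rfl
    exact hirr _ hy.2
  have k4 := le_card_siteWords (x := x) hη hcS hS hcS' huS hxu' k2 ht hlen
  refine ⟨A ∪ B, ?_, ?_, ?_⟩
  · refine card_le_card fun y hy => mem_union_left _ ?_
    exact c2 y x (mem_filter.1 hy).2 hx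
  · exact card_union_le_of_isDown htr hK hxc c2 u2 c1 u1 huA
  · have h0 : (0 : ℝ) ≤ numExts r (A ∪ B) := by positivity
    have : η ^ 3 * numExts r univ ≤ 2 * #(siteWords r x t c (A ∪ B)) := by
      calc η ^ 3 * numExts r univ = η * (η * η * numExts r univ) := by ring
        _ ≤ η * ((numExts r (A ∪ B) : ℝ) * numExts r (A ∪ B)ᶜ) := by gcongr
        _ = (numExts r (A ∪ B) : ℝ) * (η * numExts r (A ∪ B)ᶜ) := by ring
        _ ≤ (numExts r (A ∪ B) : ℝ) * numExts r (insert c (A ∪ B))ᶜ := by gcongr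
        _ ≤ _ := k4
    linarith

end SiteWords

theorem mem_of_mem_linExts_univ {β : Type*} [Fintype β] {r : β → β → Prop} {l : List β}
    (hl : l ∈ linExts r univ) (a : β) : a ∈ l :=
  ((mem_linExts.1 hl).2.1 a).2 (mem_univ a)

section Fibers
variable {β : Type*} [DecidableEq β]

theorem pairwise_idxOf_lt {l : List β} (hl : l.Nodup) :
    l.Pairwise (fun a b => l.idxOf a < l.idxOf b) := by
  rw [List.pairwise_iff_getElem]
  intro i j hi hj hij
  rwa [hl.idxOf_getElem, hl.idxOf_getElem]

theorem idxOf_lt_idxOf_of_pairwise {l : List β} {R : β → β → Prop} (hl : l.Pairwise R) {a b : β}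
    (hb : b ∈ l) (hab : l.idxOf a < l.idxOf b) : R a b := by
  have h := List.pairwise_iff_getElem.1 hl _ _ (hab.trans (List.idxOf_lt_length_iff.2 hb))
    (List.idxOf_lt_length_iff.2 hb) hab
  simpa only [List.getElem_idxOf] using h

theorem idxOf_filter_lt_iff {l : List β} (hl : l.Nodup) {q : β → Bool} {a b : β} (ha : a ∈ l)
    (hb : b ∈ l) (hqa : q a) (hqb : q b) :
    (l.filter q).idxOf a < (l.filter q).idxOf b ↔ l.idxOf a < l.idxOf b := by
  have h := (pairwise_idxOf_lt hl).sublist (List.filter_sublist (p := q))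
  have ha' : a ∈ l.filter q := List.mem_filter.2 ⟨ha, hqa⟩
  have hb' : b ∈ l.filter q := List.mem_filter.2 ⟨hb, hqb⟩
  refine ⟨idxOf_lt_idxOf_of_pairwise h hb', fun hab => ?_⟩
  by_contra hno
  rcases (not_lt.1 hno).eq_or_lt with heq | hlt
  · have := (List.idxOf_inj hb').1 heq
    subst this
    exact lt_irrefl _ hab
  · exact (idxOf_lt_idxOf_of_pairwise h ha' hlt).not_gt hab

theorem idxOf_filter_append_cons {l m : List β} {q : β → Bool} {a : β} (ha : a ∉ l) (hq : q a) :
    ((l ++ a :: m).filter q).idxOf a = (l.filter q).length := by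
  rw [List.filter_append, List.idxOf_append_of_notMem fun h => ha (List.mem_filter.1 h).1,
    List.filter_cons_of_pos hq]
  simp

/-- The obstacle relation between `q`-elements and other elements, both numbered in the order in
which they occur in `l₀`. -/
def fiberRel (r : β → β → Prop) (q : β → Bool) (l₀ : List β) (j i : ℕ) : Prop :=
  ∃ a b, q a = false ∧ q b = true ∧ r a b ∧ j ≤ (l₀.filter (fun a => !q a)).idxOf a ∧
    (l₀.filter q).idxOf b = i

/-- The lattice step corresponding to an element. -/
def fiberStep (q : β → Bool) (l₀ : List β) (a : β) : ℕ ⊕ ℕ :=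
  if q a then Sum.inl ((l₀.filter q).idxOf a) else Sum.inr ((l₀.filter (fun a => !q a)).idxOf a)

/-- The point at which the paths corresponding to arrangements end. -/
def fiberEnd (q : β → Bool) (l₀ : List β) : ℕ × ℕ :=
  ((l₀.filter q).length, (l₀.filter (fun a => !q a)).length)

theorem fiberRel_anti {r : β → β → Prop} {q : β → Bool} {l₀ : List β} (i j j' : ℕ) (hj : j ≤ j')
    (h : fiberRel r q l₀ j' i) :
    fiberRel r q l₀ j i := by
  obtain ⟨a, b, h1, h2, h3, h4, h5⟩ := h
  exact ⟨a, b, h1, h2, h3, hj.trans h4, h5⟩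

variable [Fintype β] {r : β → β → Prop} {q : β → Bool} {l₀ : List β}

/-- The arrangements in which `q`-elements and other elements are each ordered as in `l₀`. -/
noncomputable def fiber (r : β → β → Prop) (q : β → Bool) (l₀ : List β) : Finset (List β) :=
  {l ∈ linExts r univ | l.filter q = l₀.filter q ∧
    l.filter (fun a => !q a) = l₀.filter (fun a => !q a)}

theorem passable_fiberEnd (hl₀ : l₀ ∈ linExts r univ) :
    Passable (fiberRel r q l₀) (fiberEnd q l₀) := by
  rintro i - j ⟨a, b, h1, h2, h3, h4, h5⟩
  refine h4.trans_lt (List.idxOf_lt_length_iff.2 ?_)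
  exact List.mem_filter.2 ⟨mem_of_mem_linExts_univ hl₀ a, by simp [h1]⟩

theorem fiberStep_injective (hl₀ : l₀ ∈ linExts r univ) : (fiberStep q l₀).Injective := by
  intro a b hab
  have ha := mem_of_mem_linExts_univ hl₀ a
  have hb := mem_of_mem_linExts_univ hl₀ b
  unfold fiberStep at hab
  by_cases h1 : q a = true <;> by_cases h2 : q b = true <;> simp only [h1, h2, if_true] at hab
  · exact (List.idxOf_inj (List.mem_filter.2 ⟨ha, h1⟩)).1 (Sum.inl.inj hab)
  · simp at hab
  · simp at hab
  · simp only [Bool.false_eq_true, if_false] at hab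
    exact (List.idxOf_inj (List.mem_filter.2 ⟨ha, by simpa using h1⟩)).1 (Sum.inr.inj hab)

theorem image_fiberStep (hl₀ : l₀ ∈ linExts r univ) :
    univ.image (fiberStep q l₀) = pathSeg 0 (fiberEnd q l₀) := by
  have hn := (mem_linExts.1 hl₀).1
  ext s
  rw [mem_image]
  constructor
  · rintro ⟨a, -, rfl⟩
    have ha := mem_of_mem_linExts_univ hl₀ a
    unfold fiberStep
    split_ifs with h
    · rw [inl_mem_pathSeg]
      exact ⟨Nat.zero_le _, List.idxOf_lt_length_iff.2 (List.mem_filter.2 ⟨ha, h⟩)⟩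
    · rw [inr_mem_pathSeg]
      exact ⟨Nat.zero_le _, List.idxOf_lt_length_iff.2 (List.mem_filter.2 ⟨ha, by simpa using h⟩)⟩
  · rcases s with i | i
    · rw [inl_mem_pathSeg]
      rintro ⟨-, hi⟩
      change i < (l₀.filter q).length at hi
      refine ⟨(l₀.filter q)[i], mem_univ _, ?_⟩
      have := (List.mem_filter.1 (List.getElem_mem hi)).2
      rw [fiberStep, if_pos this, (hn.filter _).idxOf_getElem]
    · rw [inr_mem_pathSeg]
      rintro ⟨-, hi⟩
      change i < (l₀.filter (fun a => !q a)).length at hi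
      refine ⟨(l₀.filter (fun a => !q a))[i], mem_univ _, ?_⟩
      have := (List.mem_filter.1 (List.getElem_mem hi)).2
      rw [fiberStep, if_neg (by simpa using this), (hn.filter _).idxOf_getElem]

theorem fiber_eq_linExts (hirr : ∀ a, ¬ r a a) (hq : ∀ a b, r a b → q a → q b)
    (hl₀ : l₀ ∈ linExts r univ) : fiber r q l₀ =
      linExts (fun a b => pathRel (fiberRel r q l₀) (fiberStep q l₀ a) (fiberStep q l₀ b))
        univ := by
  have hn₀ := (mem_linExts.1 hl₀).1
  have hm₀ := mem_of_mem_linExts_univ hl₀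
  have hlt : ∀ {a b}, r a b → l₀.idxOf a < l₀.idxOf b := fun {a b} hab => by
    by_contra hno
    rcases (not_lt.1 hno).eq_or_lt with heq | hlt
    · exact hirr a ((List.idxOf_inj (hm₀ b)).1 heq ▸ hab)
    · exact idxOf_lt_idxOf_of_pairwise (mem_linExts.1 hl₀).2.2 (hm₀ a) hlt hab
  ext l
  constructor
  · intro hl
    rw [fiber, mem_filter] at hl
    obtain ⟨hl, h1, h2⟩ := hl
    have hm := mem_of_mem_linExts_univ hl
    obtain ⟨k1, k2, k3⟩ := mem_linExts.1 hl
    refine mem_linExts.2 ⟨k1, k2, (pairwise_idxOf_lt k1).imp fun {a b} hab hba => ?_⟩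
    unfold fiberStep at hba
    rw [← h1, ← h2] at hba
    by_cases ha : q a = true <;> by_cases hb : q b = true <;>
      simp only [ha, hb, if_true, if_false, pathRel, Bool.false_eq_true] at hba
    · exact ((idxOf_filter_lt_iff k1 (hm b) (hm a) hb ha).1 hba).not_gt hab
    · obtain ⟨y, a', y1, y2, y3, y4, y5⟩ := hba
      rw [← h1] at y5
      rw [← h2] at y4
      have haa : a' = a := (List.idxOf_inj (List.mem_filter.2 ⟨hm a', y2⟩)).1 y5
      subst haa
      have hby : l.idxOf b ≤ l.idxOf y := by
        by_contra hno
        have := (idxOf_filter_lt_iff (q := fun a => !q a) k1 (hm y) (hm b) (by simp [y1])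
          (by simpa using hb)).2 (not_le.1 hno)
        omega
      exact idxOf_lt_idxOf_of_pairwise k3 (hm y) (hab.trans_le hby) y3
    · exact ((idxOf_filter_lt_iff (q := fun a => !q a) k1 (hm b) (hm a) (by simpa using hb)
        (by simpa using ha)).1 hba).not_gt hab
  · intro hl
    obtain ⟨k1, k2, k3⟩ := mem_linExts.1 hl
    have hm := mem_of_mem_linExts_univ hl
    have hne : ∀ {a b}, l.idxOf a < l.idxOf b → l₀.idxOf a ≠ l₀.idxOf b := fun {a b} hab h => by
      have := (List.idxOf_inj (hm₀ a)).1 h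
      subst this
      exact lt_irrefl _ hab
    rw [fiber, mem_filter]
    refine ⟨mem_linExts.2 ⟨k1, k2, ?_⟩, ?_, ?_⟩
    · refine k3.imp fun {a b} hab hba => hab ?_
      have hba' := hlt hba
      unfold fiberStep
      by_cases ha : q a = true <;> by_cases hb : q b = true <;>
        simp only [ha, hb, if_true, if_false, pathRel, Bool.false_eq_true]
      · exact (idxOf_filter_lt_iff hn₀ (hm₀ b) (hm₀ a) hb ha).2 hba'
      · exact ⟨b, a, by simpa using hb, ha, hba, le_rfl, rfl⟩
      · exact ha (hq b a hba hb)
      · exact (idxOf_filter_lt_iff (q := fun a => !q a) hn₀ (hm₀ b) (hm₀ a) (by simpa using hb)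
          (by simpa using ha)).2 hba'
    · refine eq_of_pairwise_lt (g := fun a => l₀.idxOf a) (fun a => ?_) ?_ ?_
      · simp [hm a, hm₀ a]
      · rw [List.pairwise_filter]
        refine ((pairwise_idxOf_lt k1).and k3).imp fun {a b} hab ha hb => ?_
        by_contra hno
        refine hab.2 ?_
        simp only [fiberStep, ha, hb, if_true, pathRel]
        exact (idxOf_filter_lt_iff hn₀ (hm₀ b) (hm₀ a) hb ha).2
          (lt_of_le_of_ne (not_lt.1 hno) (hne hab.1).symm)
      · exact (pairwise_idxOf_lt hn₀).sublist List.filter_sublist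
    · refine eq_of_pairwise_lt (g := fun a => l₀.idxOf a) (fun a => ?_) ?_ ?_
      · simp [hm a, hm₀ a]
      · rw [List.pairwise_filter]
        refine ((pairwise_idxOf_lt k1).and k3).imp fun {a b} hab ha hb => ?_
        by_contra hno
        refine hab.2 ?_
        have ha' : q a = false := by simpa using ha
        have hb' : q b = false := by simpa using hb
        simp only [fiberStep, ha', hb', if_false, pathRel, Bool.false_eq_true]
        exact (idxOf_filter_lt_iff (q := fun a => !q a) hn₀ (hm₀ b) (hm₀ a) hb ha).2
          (lt_of_le_of_ne (not_lt.1 hno) (hne hab.1).symm)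
      · exact (pairwise_idxOf_lt hn₀).sublist List.filter_sublist

theorem numPaths_eq_card_fiber (hirr : ∀ a, ¬ r a a) (hq : ∀ a b, r a b → q a → q b)
    (hl₀ : l₀ ∈ linExts r univ) :
    numPaths (fiberRel r q l₀) 0 (fiberEnd q l₀) = #(fiber r q l₀) := by
  rw [numPaths, ← image_fiberStep hl₀, fiber_eq_linExts hirr hq hl₀, ← numExts]
  exact numExts_image _ (fiberStep_injective hl₀).injOn fun a _ b _ => Iff.rfl

theorem map_fiberStep_mem (hirr : ∀ a, ¬ r a a) (hq : ∀ a b, r a b → q a → q b)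
    (hl₀ : l₀ ∈ linExts r univ) {l : List β} (hl : l ∈ fiber r q l₀) :
    l.map (fiberStep q l₀) ∈ linExts (pathRel (fiberRel r q l₀)) (pathSeg 0 (fiberEnd q l₀)) := by
  rw [fiber_eq_linExts hirr hq hl₀] at hl
  rw [← image_fiberStep hl₀]
  exact map_mem_linExts _ (fiberStep_injective hl₀).injOn (fun a _ b _ h => h) hl

end Fibers

section SiteCorners
variable {β : Type*} [Fintype β] [DecidableEq β] {r : β → β → Prop} {q : β → Bool} {l₀ : List β}

theorem List.exists_first_of_mem_take {α : Type*} {q : α → Bool} {t : ℕ} {l : List α} {c : α}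
    (hc : q c = false) (h : ∃ y ∈ l.take t, q y = true) :
    ∃ ys d y l', c :: l = ys ++ d :: y :: l' ∧ (∀ a ∈ ys, q a = false) ∧ q d = false ∧
      q y = true ∧ ys.length < t := by
  induction l generalizing c t with
  | nil => simp at h
  | cons b l ih =>
    cases t with
    | zero => simp at h
    | succ t =>
      rw [List.take_succ_cons] at h
      by_cases hb : q b = true
      · exact ⟨[], c, b, l, rfl, by simp, hc, hb, by simp⟩
      · have hb' : q b = false := by simpa using hb
        obtain ⟨ys, d, y, l', h1, h2, h3, h4, h5⟩ := ih (t := t) hb' (by simpa [hb'] using h)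
        refine ⟨c :: ys, d, y, l', by rw [h1]; rfl, ?_, h3, h4, by simpa using h5⟩
        simpa [hc] using h2

theorem idxOf_of_mem_siteWords {x c : β} {t : ℕ} {S : Finset β} {l : List β} (hc : q c = false)
    (hl : l ∈ siteWords r x t c S) (hf : l ∈ fiber r q l₀) :
    (l₀.filter (fun a => !q a)).idxOf c = #{a ∈ S | q a = false} := by
  obtain ⟨h1, l₁, l₂, rfl, rfl, -⟩ := mem_siteWords.1 hl
  have hn := (append_cons_mem_linExts_univ.1 h1)
  rw [fiber, mem_filter] at hf
  rw [← hf.2.2, idxOf_filter_append_cons hn.2.2.1 (by simp [hc]),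
    ← List.toFinset_card_of_nodup ((mem_linExts.1 hn.1).1.filter _)]
  congr 1
  ext a; simp

theorem card_siteWords_inter_fiber_le (hirr : ∀ a, ¬ r a a) {x c : β}
    (hqx : ∀ a, q a = true ↔ a = x ∨ r x a)
    (hq : ∀ a b, r a b → q a → q b) (hl₀ : l₀ ∈ linExts r univ) (hc : q c = false) {t : ℕ}
    {S : Finset β} : #(siteWords r x t c S ∩ fiber r q l₀) ≤
      ∑ ρ ∈ range t, #(cornerPaths (fiberRel r q l₀) (fiberEnd q l₀)
        (#{a ∈ S | q a = true}, #{a ∈ S | q a = false} + ρ)) := by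
  classical
  refine le_trans ?_ card_biUnion_le
  refine card_le_card_of_injOn (List.map (fiberStep q l₀)) ?_ ?_
  swap
  · intro l _ m _ h
    exact (List.map_injective_iff.2 (fiberStep_injective hl₀)) h
  intro l hl
  rw [mem_coe, mem_inter] at hl
  obtain ⟨hl, hf⟩ := hl
  obtain ⟨h1, l₁, l₂, rfl, rfl, y, hy, hy2⟩ := mem_siteWords.1 hl
  obtain ⟨ys, d, y, l', h2, h3, h4, h5, h6⟩ :=
    List.exists_first_of_mem_take hc ⟨y, hy, (hqx y).2 hy2⟩
  have hnd : l₁.Nodup := (mem_linExts.1 (append_cons_mem_linExts_univ.1 h1).1).1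
  rw [h2] at hf h1
  rw [mem_coe, mem_biUnion]
  refine ⟨ys.length, by simpa using h6, ?_⟩
  rw [h2, mem_cornerPaths]
  refine ⟨map_fiberStep_mem hirr hq hl₀ hf, (l₁ ++ ys).map (fiberStep q l₀),
    l'.map (fiberStep q l₀), ?_⟩
  have e1 : l₁ ++ (ys ++ d :: y :: l') = (l₁ ++ ys) ++ d :: y :: l' := by simp
  have e2 : l₁ ++ (ys ++ d :: y :: l') = (l₁ ++ ys ++ [d]) ++ y :: l' := by simp
  have n1 := (append_cons_mem_linExts_univ.1 (e1 ▸ h1)).2.2.1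
  have n2 := (append_cons_mem_linExts_univ.1 (e2 ▸ h1)).2.2.1
  rw [fiber, mem_filter] at hf
  have f1 : ys.filter q = [] := List.filter_eq_nil_iff.2 fun a ha => by simp [h3 a ha]
  have f2 : ys.filter (fun a => !q a) = ys := List.filter_eq_self.2 fun a ha => by simp [h3 a ha]
  have s1 : (l₁.filter q).length = #{a ∈ l₁.toFinset | q a = true} := by
    rw [← List.toFinset_card_of_nodup (hnd.filter _)]
    congr 1
    ext a; simp
  have s2 : (l₁.filter (fun a => !q a)).length = #{a ∈ l₁.toFinset | q a = false} := by
    rw [← List.toFinset_card_of_nodup (hnd.filter _)]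
    congr 1
    ext a; simp
  have d1 : fiberStep q l₀ d = Sum.inr (#{a ∈ l₁.toFinset | q a = false} + ys.length) := by
    rw [fiberStep, if_neg (by simp [h4]), ← hf.2.2, e1, idxOf_filter_append_cons n1 (by simp [h4]),
      List.filter_append, f2, List.length_append, s2]
  have d2 : fiberStep q l₀ y = Sum.inl #{a ∈ l₁.toFinset | q a = true} := by
    rw [fiberStep, if_pos h5, ← hf.2.1, e2, idxOf_filter_append_cons n2 h5, List.filter_append,
      List.filter_append, f1, List.append_nil, List.filter_cons_of_neg (by simp [h4]),
      List.filter_nil, List.append_nil, s1]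
  rw [e1, List.map_append, List.map_cons, List.map_cons, d1, d2]

end SiteCorners

section SiteCount
variable {β : Type*} [Fintype β] [DecidableEq β] {r : β → β → Prop} {q : β → Bool}

theorem self_mem_fiber {l : List β} (hl : l ∈ linExts r univ) : l ∈ fiber r q l :=
  mem_filter.2 ⟨hl, rfl, rfl⟩

/-- Some fiber meets many of the sets `V c` in a large proportion. -/
theorem exists_fiber {κ : ℝ} (hκ0 : 0 < κ) (hM : 0 < numExts r univ) {G : Finset β}
    {V : β → Finset (List β)}
    (hV : ∀ c ∈ G, V c ⊆ linExts r univ) (hκ : ∀ c ∈ G, κ * numExts r univ ≤ #(V c)) :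
    ∃ l₀ ∈ linExts r univ, κ / 2 * #G ≤
      #{c ∈ G | κ / 2 * #(fiber r q l₀) ≤ #(V c ∩ fiber r q l₀)} := by
  set f : List β → List β × List β := fun l => (l.filter q, l.filter (fun a => !q a)) with hf
  set L := linExts r univ with hL
  set T := L.image f with hT
  have hne : T.Nonempty := (card_pos.1 hM).image f
  have hfib : ∀ l, fiber r q l = {m ∈ L | f m = f l} := fun l => by
    ext m; simp [fiber, hf, hL, Prod.ext_iff]
  have hMs : (numExts r univ : ℝ) = ∑ p ∈ T, (#{m ∈ L | f m = p} : ℝ) := by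
    exact_mod_cast card_eq_sum_card_image f L
  have hVs : ∀ c ∈ G, (#(V c) : ℝ) = ∑ p ∈ T, (#(V c ∩ {m ∈ L | f m = p}) : ℝ) := by
    intro c hc
    have := card_eq_sum_card_fiberwise (s := V c) (f := f) (t := T)
      (fun l hl => mem_image_of_mem f (hV c hc hl))
    rw [this]
    push_cast
    refine sum_congr rfl fun p _ => ?_
    congr 2
    ext l
    rw [mem_filter, mem_inter, mem_filter]
    exact ⟨fun h => ⟨h.1, hV c hc h.1, h.2⟩, fun h => ⟨h.1, h.2.2⟩⟩
  obtain ⟨p, hp, hle⟩ := exists_le_of_sum_le hne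
    (f := fun p => κ * #G * (#{m ∈ L | f m = p} : ℝ))
    (g := fun p => ∑ c ∈ G, (#(V c ∩ {m ∈ L | f m = p}) : ℝ)) (by
      rw [← mul_sum, ← hMs, sum_comm, sum_congr rfl fun c hc => (hVs c hc).symm]
      calc κ * #G * numExts r univ = ∑ c ∈ G, κ * numExts r univ := by
            rw [sum_const, nsmul_eq_mul]; ring
        _ ≤ _ := sum_le_sum hκ)
  obtain ⟨l₀, hl₀, rfl⟩ := mem_image.1 hp
  refine ⟨l₀, hl₀, ?_⟩
  rw [← hfib] at hle
  set Φ := fiber r q l₀ with hΦ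
  have hpos : (0 : ℝ) < #Φ := by
    exact_mod_cast card_pos.2 ⟨l₀, self_mem_fiber hl₀⟩
  set P := {c ∈ G | κ / 2 * #Φ ≤ #(V c ∩ Φ)} with hP
  have hsum : ∑ c ∈ G, (#(V c ∩ Φ) : ℝ) ≤ ∑ c ∈ G, (κ / 2 * #Φ) + ∑ c ∈ P, (#Φ : ℝ) := by
    rw [hP, sum_filter, ← sum_add_distrib]
    refine sum_le_sum fun c _ => ?_
    have h1 : (#(V c ∩ Φ) : ℝ) ≤ #Φ := by exact_mod_cast card_le_card inter_subset_right
    have h2 : 0 ≤ κ / 2 * #Φ := by positivity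
    split_ifs with h <;> linarith
  rw [sum_const, sum_const, nsmul_eq_mul, nsmul_eq_mul] at hsum
  refine le_of_mul_le_mul_right ?_ hpos
  have : κ * #G * #Φ ≤ #G * (κ / 2 * #Φ) + #P * #Φ := hle.trans hsum
  linarith

/-- Sites give rise to corners of lattice paths. -/
theorem exists_corners (hirr : ∀ a, ¬ r a a) {x : β} (hqx : ∀ a, q a = true ↔ a = x ∨ r x a)
    (hq : ∀ a b, r a b → q a → q b) {l₀ : List β} (hl₀ : l₀ ∈ linExts r univ) {κ : ℝ}
    (hκ : 0 < κ) {t : ℕ} (ht : 0 < t) {P : Finset β} {S : β → Finset β}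
    (hP : ∀ c ∈ P, q c = false ∧
      κ * #(fiber r q l₀) ≤ #(siteWords r x t c (S c) ∩ fiber r q l₀)) :
    ∃ (H : Finset ℕ) (p : ℕ → ℕ), #P ≤ t * #H ∧ ∀ h ∈ H,
      κ / t * numPaths (fiberRel r q l₀) 0 (fiberEnd q l₀) ≤
        #(cornerPaths (fiberRel r q l₀) (fiberEnd q l₀) (p h, h)) ∧
      ∃ c ∈ P, #(S c) ≤ p h + h ∧ p h + h < #(S c) + t := by
  have hpos : (0 : ℝ) < #(fiber r q l₀) := by
    exact_mod_cast card_pos.2 ⟨l₀, self_mem_fiber hl₀⟩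
  have ht' : (0 : ℝ) < t := by exact_mod_cast ht
  have hex : ∀ c ∈ P, ∃ ρ < t, κ / t * #(fiber r q l₀) ≤
      #(cornerPaths (fiberRel r q l₀) (fiberEnd q l₀)
        (#{a ∈ S c | q a = true}, #{a ∈ S c | q a = false} + ρ)) := by
    intro c hc
    have h1 := card_siteWords_inter_fiber_le hirr hqx hq hl₀ (hP c hc).1 (t := t) (S := S c)
    obtain ⟨ρ, hρ, hle⟩ := exists_le_of_sum_le (s := range t) ⟨0, by simpa using ht⟩
      (f := fun _ => κ / t * #(fiber r q l₀))
      (g := fun ρ => (#(cornerPaths (fiberRel r q l₀) (fiberEnd q l₀)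
        (#{a ∈ S c | q a = true}, #{a ∈ S c | q a = false} + ρ)) : ℝ)) (by
        rw [sum_const, card_range, nsmul_eq_mul]
        calc (t : ℝ) * (κ / t * #(fiber r q l₀)) = κ * #(fiber r q l₀) := by field_simp
          _ ≤ _ := (hP c hc).2
          _ ≤ _ := by exact_mod_cast h1)
    exact ⟨ρ, mem_range.1 hρ, hle⟩
  choose! ρ hρ hcor using hex
  set height : β → ℕ := fun c => #{a ∈ S c | q a = false} + ρ c with hheight
  have hpre : ∀ h ∈ P.image height, ∃ c ∈ P, height c = h := fun h hh => mem_image.1 hh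
  have : Nonempty β := ⟨x⟩
  choose! pre hpre1 hpre2 using hpre
  refine ⟨P.image height, fun h => #{a ∈ S (pre h) | q a = true}, ?_, fun h hh => ⟨?_, ?_⟩⟩
  · refine card_le_mul_card_image P t fun h _ => ?_
    have hinj : Set.InjOn ρ ({c ∈ P | height c = h} : Finset β) := by
      intro c hc c' hc' heq
      rw [mem_coe, mem_filter] at hc hc'
      have hidx : ∀ c ∈ P, (l₀.filter (fun a => !q a)).idxOf c = #{a ∈ S c | q a = false} := by
        intro c hc
        have h1 := (hP c hc).2
        have h2 : (0 : ℝ) < #(siteWords r x t c (S c) ∩ fiber r q l₀) :=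
          lt_of_lt_of_le (by positivity) h1
        obtain ⟨l, hl⟩ := card_pos.1 (by exact_mod_cast h2)
        rw [mem_inter] at hl
        exact idxOf_of_mem_siteWords (hP c hc).1 hl.1 hl.2
      have h1 := hidx c hc.1
      have h2 := hidx c' hc'.1
      have h3 : height c = height c' := hc.2.trans hc'.2.symm
      simp only [hheight] at h3
      refine (List.idxOf_inj (l := l₀.filter (fun a => !q a)) (List.mem_filter.2
        ⟨mem_of_mem_linExts_univ hl₀ c, by simp [(hP c hc.1).1]⟩)).1 ?_
      omega
    have := card_le_card_of_injOn (t := range t) ρ (fun c hc => by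
      rw [mem_coe, mem_filter] at hc
      simpa using hρ c hc.1) hinj
    simpa using this
  · rw [numPaths_eq_card_fiber hirr hq hl₀]
    have := hcor (pre h) (hpre1 h hh)
    have e : #{a ∈ S (pre h) | q a = false} + ρ (pre h) = h := hpre2 h hh
    rwa [e] at this
  · refine ⟨pre h, hpre1 h hh, ?_⟩
    have e : #{a ∈ S (pre h) | q a = false} + ρ (pre h) = h := hpre2 h hh
    have := hρ (pre h) (hpre1 h hh)
    have e2 := card_filter_add_card_filter_not (s := S (pre h)) (fun a => q a = true)
    simp only [Bool.not_eq_true] at e2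
    beta_reduce
    omega

/-- There are few sites, when their sizes lie in a short interval. -/
theorem exists_card_sites_lt {κ θ : ℝ} (hκ : 0 < κ) (hκ1 : κ ≤ 1) (hθ : 0 < θ) {t : ℕ}
    (ht : 0 < t) : ∃ K₀ : ℕ, ∀ K ≥ K₀, ∀ {β : Type} [Fintype β] [DecidableEq β]
    {r : β → β → Prop}, (∀ a, ¬ r a a) → (∀ a b c, r a b → r b c → r a c) →
    0 < numExts r univ → ∀ {x : β} {G : Finset β} {S : β → Finset β} {m₀ : ℕ},
    (∀ c ∈ G, c ≠ x ∧ ¬ r x c ∧ m₀ ≤ #(S c) ∧ #(S c) ≤ m₀ + (3 * K + 1) ∧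
      κ * numExts r univ ≤ #(siteWords r x t c (S c))) → #G < θ * K := by
  classical
  have ht' : (0 : ℝ) < t := by exact_mod_cast ht
  have ht1 : (1 : ℝ) ≤ t := by exact_mod_cast ht
  obtain ⟨K₀, hK₀⟩ := exists_card_corners_lt (η := κ / 2 / t) (θ := κ / 2 / t * θ) (B := 4)
    (by positivity) (by rw [div_le_one ht']; linarith) (by positivity) (by norm_num)
  refine ⟨max K₀ (t + 1), fun K hK β _ _ r hirr htr hM x G S m₀ hG => ?_⟩
  have hK1 : K₀ ≤ K := le_of_max_le_left hK
  have hK2 : t + 1 ≤ K := le_of_max_le_right hK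
  set q : β → Bool := fun a => decide (a = x ∨ r x a) with hqdef
  have hqx : ∀ a, q a = true ↔ a = x ∨ r x a := fun a => by simp [hqdef]
  have hq : ∀ a b, r a b → q a → q b := fun a b hab ha => by
    rw [hqx] at *
    right
    rcases ha with rfl | ha
    · exact hab
    · exact htr _ _ _ ha hab
  obtain ⟨l₀, hl₀, hpop⟩ := exists_fiber (q := q) hκ hM
    (V := fun c => siteWords r x t c (S c)) (G := G)
    (fun c _ l hl => (mem_siteWords.1 hl).1) (fun c hc => (hG c hc).2.2.2.2)
  obtain ⟨H, p, hcard, hH⟩ := exists_corners hirr hqx hq hl₀ (half_pos hκ) ht (S := S)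
    (P := {c ∈ G | κ / 2 * #(fiber r q l₀) ≤ #(siteWords r x t c (S c) ∩ fiber r q l₀)})
    (fun c hc => by
      rw [mem_filter] at hc
      refine ⟨?_, hc.2⟩
      have := hG c hc.1
      simp [hqdef, this.1, this.2.1])
  have hfin := hK₀ K hK1 (c := fiberRel r q l₀) (fun i j j' hj h => fiberRel_anti i j j' hj h)
    (passable_fiberEnd hl₀) (by
      rw [numPaths_eq_card_fiber hirr hq hl₀]
      exact card_pos.2 ⟨l₀, self_mem_fiber hl₀⟩) (H := H) (p := p) (m₀ := m₀)
    (fun h hh => (hH h hh).1) (fun h hh => by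
      obtain ⟨c, hc, h1, h2⟩ := (hH h hh).2
      have := hG c (mem_filter.1 hc).1
      omega)
  have hcard' : κ / 2 * #G ≤ t * #H := hpop.trans (by exact_mod_cast hcard)
  have : κ / 2 * #G < κ / 2 * (θ * K) := by
    calc κ / 2 * #G ≤ t * #H := hcard'
      _ < t * (κ / 2 / t * θ * K) := by gcongr
      _ = κ / 2 * (θ * K) := by field_simp
  exact lt_of_mul_lt_mul_left this (by positivity)

end SiteCount

section Dual
variable {β : Type*} {r : β → β → Prop}

theorem reverse_mem_linExts {S : Finset β} {l : List β} :
    l.reverse ∈ linExts (fun a b => r b a) S ↔ l ∈ linExts r S := by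
  simp [mem_linExts, List.pairwise_reverse]

theorem idxOf_reverse_lt_iff [DecidableEq β] {l : List β} (hl : l.Nodup) {a b : β} (ha : a ∈ l)
    (hb : b ∈ l) : l.reverse.idxOf a < l.reverse.idxOf b ↔ l.idxOf b < l.idxOf a := by
  constructor
  · exact idxOf_lt_idxOf_of_pairwise (R := fun a b => l.idxOf b < l.idxOf a)
      (List.pairwise_reverse.2 (pairwise_idxOf_lt hl)) (by simpa using hb)
  · refine idxOf_lt_idxOf_of_pairwise (R := fun b a => l.reverse.idxOf a < l.reverse.idxOf b) ?_ ha
    have := List.pairwise_reverse.2 (pairwise_idxOf_lt (List.nodup_reverse.2 hl))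
    rwa [List.reverse_reverse] at this

variable [Fintype β]

theorem numExts_flip : numExts (fun a b => r b a) univ = numExts r univ :=
  (card_bij (fun l _ => l.reverse) (fun _ hl => reverse_mem_linExts.2 hl)
    (fun _ _ _ _ h => List.reverse_injective h)
    (fun l hl => ⟨l.reverse, reverse_mem_linExts.1 (by simpa using hl), by simp⟩)).symm

theorem countBefore_flip [DecidableEq β] (a b : β) :
    countBefore (fun a b => r b a) a b = countBefore r b a := by
  refine (card_bij (fun l _ => l.reverse) (fun l hl => ?_)
    (fun _ _ _ _ h => List.reverse_injective h) fun l hl => ?_).symm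
  · rw [mem_filter] at hl ⊢
    exact ⟨reverse_mem_linExts.2 hl.1, (idxOf_reverse_lt_iff (mem_linExts.1 hl.1).1
      (mem_of_mem_linExts_univ hl.1 a) (mem_of_mem_linExts_univ hl.1 b)).2 hl.2⟩
  · rw [mem_filter] at hl
    have h1 : l.reverse ∈ linExts r univ := reverse_mem_linExts.1 (by simpa using hl.1)
    refine ⟨l.reverse, mem_filter.2 ⟨h1, ?_⟩, by simp⟩
    exact (idxOf_reverse_lt_iff (mem_linExts.1 hl.1).1
      (mem_of_mem_linExts_univ hl.1 b) (mem_of_mem_linExts_univ hl.1 a)).2 hl.2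

end Dual

section Unbalanced

/-- If no pair is balanced and antichains are bounded, then few elements incomparable to `x` tend
to follow `x`. -/
theorem exists_card_upper_le {ε : ℝ} (hε : 0 < ε) (hε1 : ε ≤ 1 / 2) (W : ℕ) : ∃ K₀ T : ℕ,
    ∀ K ≥ K₀, ∀ {β : Type} [Fintype β] [DecidableEq β] {r : β → β → Prop} [DecidableRel r],
    (∀ a, ¬ r a a) → (∀ a b c, r a b → r b c → r a c) →
    (∀ A : Finset β, (A : Set β).Pairwise (fun a b => ¬ r a b) → #A ≤ W) →
    0 < numExts r univ →
    (∀ x y, y ≠ x → (1 / 2 + ε) * numExts r univ ≤ countBefore r y x ∨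
      (1 / 2 + ε) * numExts r univ ≤ countBefore r x y) →
    (∀ a, #{b | b ≠ a ∧ ¬ r a b ∧ ¬ r b a} ≤ K) → ∀ x,
    (#{c | (c ≠ x ∧ ¬ r x c ∧ ¬ r c x) ∧ x ∈ lower r ε c} : ℝ) ≤ K / 8 + T := by
  set η := cutBound ε W with hη
  have hη0 : 0 < η := cutBound_pos hε W
  have hη1 : η ≤ 1 := cutBound_le_one hε hε1 W
  obtain ⟨t, ht⟩ := exists_nat_ge (2 / η)
  have ht0 : (0 : ℝ) < t := lt_of_lt_of_le (by positivity) ht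
  have ht2 : 2 ≤ η * (t + 1) := by
    rw [div_le_iff₀ hη0] at ht
    nlinarith
  obtain ⟨K₀, hK₀⟩ := exists_card_sites_lt (κ := η ^ 3 / 2) (θ := 1 / 8) (by positivity)
    (by have : η ^ 3 ≤ 1 := pow_le_one₀ hη0.le hη1
        linarith) (by norm_num) (t := t) (by exact_mod_cast ht0)
  refine ⟨K₀, W * t, fun K hK β _ _ r _ hirr htr hW hM hx hN x => ?_⟩
  have hcut : ∀ y, η * numExts r univ ≤ cutWeight r y (lower r ε y) := fun y =>
    cutBound_mul_le hε hε1 hirr htr hW y (hx y)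
  set C : Finset β := {c | (c ≠ x ∧ ¬ r x c ∧ ¬ r c x) ∧ x ∈ lower r ε c} with hC
  have hlow := card_filter_above_lt_le hirr htr hW t
  set G : Finset β := {c ∈ C | t ≤ #{y | r c y}} with hG
  have hsite : ∀ c ∈ G, ∃ S : Finset β, #{y | r y x} ≤ #S ∧ #S ≤ #{y | r y x} + (3 * K + 1) ∧
      η ^ 3 / 2 * numExts r univ ≤ #(siteWords r x t c S) := by
    intro c hc
    rw [hG, mem_filter, hC, mem_filter] at hc
    obtain ⟨⟨-, ⟨c1, c2, c3⟩, c4⟩, c5⟩ := hc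
    exact exists_siteWords hε hη0 hirr htr hM hcut hN c2 c3 c4 ht2 c5
  choose! S hS1 hS2 hS3 using hsite
  have hGlt := hK₀ K hK hirr htr hM (x := x) (G := G) (S := S) (m₀ := #{y | r y x})
    (fun c hc => by
      refine ⟨?_, ?_, hS1 c hc, hS2 c hc, hS3 c hc⟩
      · rw [hG, mem_filter, hC, mem_filter] at hc
        exact hc.1.2.1.1
      · rw [hG, mem_filter, hC, mem_filter] at hc
        exact hc.1.2.1.2.1)
  have hCG : #C ≤ #G + W * t := by
    rw [← card_filter_add_card_filter_not (s := C) (fun c => t ≤ #{y | r c y})]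
    refine Nat.add_le_add_left (le_trans (card_le_card fun c hc => ?_) hlow) _
    rw [mem_filter] at hc ⊢
    exact ⟨mem_univ _, not_le.1 hc.2⟩
  have hCG' : (#C : ℝ) ≤ #G + (W * t : ℕ) := by exact_mod_cast hCG
  linarith

/-- If no pair is balanced and antichains are bounded, then every element is incomparable to a
bounded number of elements. -/
theorem exists_card_incomparable_lt {ε : ℝ} (hε : 0 < ε) (hε1 : ε ≤ 1 / 2) (W : ℕ) : ∃ K₀ : ℕ,
    ∀ {β : Type} [Fintype β] [DecidableEq β] {r : β → β → Prop} [DecidableRel r],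
    (∀ a, ¬ r a a) → (∀ a b c, r a b → r b c → r a c) →
    (∀ A : Finset β, (A : Set β).Pairwise (fun a b => ¬ r a b) → #A ≤ W) →
    0 < numExts r univ →
    (∀ x y, y ≠ x → (1 / 2 + ε) * numExts r univ ≤ countBefore r y x ∨
      (1 / 2 + ε) * numExts r univ ≤ countBefore r x y) →
    ∀ x, #{b | b ≠ x ∧ ¬ r x b ∧ ¬ r b x} < K₀ := by
  obtain ⟨K₀, T, hK₀⟩ := exists_card_upper_le hε hε1 W
  refine ⟨max K₀ (4 * T + 1), fun {β} _ _ r _ hirr htr hW hM hx z => ?_⟩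
  obtain ⟨N, hN⟩ : ∃ N : β → Finset β, N = fun a => ({b | b ≠ a ∧ ¬ r a b ∧ ¬ r b a} : Finset β) :=
    ⟨_, rfl⟩
  obtain ⟨x, -, hmax⟩ := exists_max_image univ (fun a => #(N a)) ⟨z, mem_univ z⟩
  have hle : ∀ a, #{b | b ≠ a ∧ ¬ r a b ∧ ¬ r b a} ≤ #(N x) := fun a => by
    have := hmax a (mem_univ a)
    rw [hN] at this ⊢
    exact this
  refine (hle z).trans_lt ?_
  by_contra hno
  have hno := not_lt.1 hno
  have h1 := hK₀ _ (le_of_max_le_left hno) hirr htr hW hM hx hle x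
  have h2 := hK₀ _ (le_of_max_le_left hno) (r := fun a b => r b a) hirr
    (fun a b c hab hbc => htr _ _ _ hbc hab)
    (fun A hA => hW A fun a ha b hb hab => hA hb ha hab.symm) (by rwa [numExts_flip])
    (fun x y hxy => by
      rw [numExts_flip, countBefore_flip (r := r) y x, countBefore_flip (r := r) x y]
      exact (hx x y hxy).symm)
    (fun a => le_trans (card_le_card fun b hb => by
      rw [mem_filter] at hb ⊢
      exact ⟨hb.1, hb.2.1, hb.2.2.2, hb.2.2.1⟩) (hle a)) x
  set C₁ : Finset β := {c | (c ≠ x ∧ ¬ r x c ∧ ¬ r c x) ∧ x ∈ lower r ε c} with hC₁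
  set C₂ : Finset β :=
    {c | (c ≠ x ∧ ¬ r c x ∧ ¬ r x c) ∧ x ∈ lower (fun a b => r b a) ε c} with hC₂
  have hcov : N x ⊆ C₁ ∪ C₂ := by
    intro c hc
    rw [hN, mem_filter] at hc
    obtain ⟨-, c1, c2, c3⟩ := hc
    rw [mem_union, hC₁, hC₂, mem_filter, mem_filter, mem_lower, mem_lower,
      numExts_flip (r := r), countBefore_flip (r := r)]
    rcases hx x c c1 with h | h
    · exact Or.inr ⟨mem_univ _, ⟨c1, c3, c2⟩, c1.symm, h⟩
    · exact Or.inl ⟨mem_univ _, ⟨c1, c2, c3⟩, c1.symm, h⟩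
  have h3 : (#(N x) : ℝ) ≤ #C₁ + #C₂ := by
    exact_mod_cast (card_le_card hcov).trans (card_union_le _ _)
  have h4 : (4 * T + 1 : ℝ) ≤ #(N x) := by exact_mod_cast le_of_max_le_right hno
  have h5 : (0 : ℝ) ≤ T := by positivity
  linarith

end Unbalanced

section Bridge
variable {α : Type*} [Fintype α] [PartialOrder α]

/-- Linear extensions as linear arrangements. -/
theorem exists_equiv_linExts [DecidableEq α] :
    ∃ F : {l // l ∈ linExts (fun a b : α => a < b) univ} ≃ LinExt α,
      ∀ l x, ((F l).1 x : ℕ) = l.1.idxOf x := by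
  have hlen : ∀ l : {l // l ∈ linExts (fun a b : α => a < b) univ}, l.1.length = Fintype.card α :=
    fun l => length_of_mem_linExts l.2
  have hidx : ∀ (l : {l // l ∈ linExts (fun a b : α => a < b) univ}) x,
      l.1.idxOf x < Fintype.card α := fun l x => by
    rw [← hlen l]
    exact List.idxOf_lt_length_iff.2 (mem_of_mem_linExts_univ l.2 x)
  have hinj : ∀ l : {l // l ∈ linExts (fun a b : α => a < b) univ},
      Function.Injective fun x => (⟨l.1.idxOf x, hidx l x⟩ : Fin (Fintype.card α)) := by
    intro l x y hxy
    exact (List.idxOf_inj (mem_of_mem_linExts_univ l.2 x)).1 (Fin.mk.inj hxy)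
  let G : {l // l ∈ linExts (fun a b : α => a < b) univ} → LinExt α := fun l =>
    ⟨Equiv.ofBijective _ ((Fintype.bijective_iff_injective_and_card _).2 ⟨hinj l, by simp⟩),
      fun x y hxy => by
        change l.1.idxOf x < l.1.idxOf y
        by_contra hno
        rcases (not_lt.1 hno).eq_or_lt with heq | hlt
        · exact hxy.ne ((List.idxOf_inj (mem_of_mem_linExts_univ l.2 y)).1 heq).symm
        · exact idxOf_lt_idxOf_of_pairwise (mem_linExts.1 l.2).2.2
            (mem_of_mem_linExts_univ l.2 x) hlt hxy⟩
  have hG : ∀ l x, ((G l).1 x : ℕ) = l.1.idxOf x := fun l x => rfl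
  refine ⟨Equiv.ofBijective G ⟨fun l m hlm => ?_, fun f => ?_⟩, hG⟩
  · refine Subtype.ext (eq_of_pairwise_lt (g := fun a => l.1.idxOf a) (fun a => ?_)
      (pairwise_idxOf_lt (mem_linExts.1 l.2).1) ?_)
    · simp [mem_of_mem_linExts_univ l.2 a, mem_of_mem_linExts_univ m.2 a]
    · have : ∀ a, l.1.idxOf a = m.1.idxOf a := fun a => by rw [← hG, hlm, hG]
      simp_rw [this]
      exact pairwise_idxOf_lt (mem_linExts.1 m.2).1
  · have hn : (List.ofFn f.1.symm).Nodup := List.nodup_ofFn.2 f.1.symm.injective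
    have hmem : List.ofFn f.1.symm ∈ linExts (fun a b : α => a < b) univ := by
      refine mem_linExts.2 ⟨hn, fun a => ?_, ?_⟩
      · simp only [mem_univ, iff_true, List.mem_ofFn]
        exact ⟨f.1 a, by simp⟩
      · rw [List.pairwise_ofFn]
        intro i j hij hlt
        have := f.2 _ _ hlt
        simp only [Equiv.apply_symm_apply] at this
        exact lt_asymm hij this
    refine ⟨⟨_, hmem⟩, Subtype.ext (Equiv.ext fun x => Fin.ext ?_)⟩
    rw [hG]
    have hlt : (f.1 x : ℕ) < (List.ofFn f.1.symm).length := by simp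
    have := hn.idxOf_getElem (f.1 x : ℕ) hlt
    simpa using this

theorem card_linExt : Nat.card (LinExt α) = numExts (fun a b : α => a < b) univ := by
  classical
  obtain ⟨F, -⟩ := exists_equiv_linExts (α := α)
  rw [← Nat.card_congr F, Nat.card_eq_fintype_card, Fintype.card_coe, numExts]

theorem prLT_eq [DecidableEq α] (x y : α) : prLT x y =
    (countBefore (fun a b : α => a < b) x y : ℝ) / numExts (fun a b : α => a < b) univ := by
  obtain ⟨F, hF⟩ := exists_equiv_linExts (α := α)
  unfold prLT Pr
  rw [card_linExt]
  congr 2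
  have e : {l : {l // l ∈ linExts (fun a b : α => a < b) univ} // l.1.idxOf x < l.1.idxOf y} ≃
      {f : LinExt α // val f x < val f y} := F.subtypeEquiv fun l => by
    rw [_root_.val, _root_.val, hF, hF, Nat.add_lt_add_iff_right]
  rw [← Nat.card_congr e, Nat.card_congr (Equiv.subtypeSubtypeEquivSubtypeInter
    (fun l => l ∈ linExts (fun a b : α => a < b) univ) fun l => l.idxOf x < l.idxOf y)]
  exact Nat.subtype_card _ fun l => mem_filter

theorem numExts_lt_pos : 0 < numExts (fun a b : α => a < b) univ := by
  rw [← card_linExt]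
  let i : Fintype (LinearExtension α) := inferInstanceAs (Fintype α)
  let e := Fintype.orderIsoFinOfCardEq (LinearExtension α) (rfl : Fintype.card _ = Fintype.card α)
  have : Nonempty (LinExt α) := ⟨e.symm.toEquiv, fun x y hxy => e.symm.strictMono
    (lt_of_le_of_ne (toLinearExtension.monotone hxy.le) hxy.ne)⟩
  exact Nat.card_pos

theorem piVal_eq [DecidableEq α] [DecidableRel fun a b : α => a < b] (x : α) :
    piVal x = #{b | b ≠ x ∧ ¬ x < b ∧ ¬ b < x} := by
  refine Nat.subtype_card _ fun b => ?_
  rw [mem_filter, le_iff_lt_or_eq, le_iff_lt_or_eq]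
  grind

end Bridge

/-- the Kahn–Saks Conjecture (δ(P) → 1/2 as w(P) → ∞) implies the
conjecture with width replaced by π. -/
theorem stmt_3
    (hKS : ∀ ε : ℝ, 0 < ε → ∃ W : ℕ,
      ∀ (β : Type) [Fintype β] [PartialOrder β],
        (∃ A : Finset β, IsAntichain (· ≤ ·) (A : Set β) ∧ W ≤ A.card) →
        ∃ x y : β, x ≠ y ∧ 1 / 2 - ε < min (prLT x y) (prLT y x)) :
    ∀ ε : ℝ, 0 < ε → ∃ K : ℕ,
      ∀ (β : Type) [Fintype β] [PartialOrder β],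
        (∃ x : β, K ≤ piVal x) →
        ∃ x y : β, x ≠ y ∧ 1 / 2 - ε < min (prLT x y) (prLT y x) := by
  intro ε₀ hε₀
  obtain ⟨ε, hε, hε1, hle⟩ : ∃ ε : ℝ, 0 < ε ∧ ε ≤ 1 / 2 ∧ ε ≤ ε₀ :=
    ⟨min ε₀ (1 / 2), by positivity, min_le_right _ _, min_le_left _ _⟩
  obtain ⟨W, hW⟩ := hKS ε hε
  obtain ⟨K, hK⟩ := exists_card_incomparable_lt hε hε1 W
  refine ⟨K, fun β _ _ ⟨x, hx⟩ => ?_⟩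
  by_contra! hno
  have hno' : ∀ a b : β, a ≠ b → min (prLT a b) (prLT b a) ≤ 1 / 2 - ε := fun a b hab =>
    (hno a b hab).trans (by linarith)
  classical
  have hM := numExts_lt_pos (α := β)
  have hM' : (0 : ℝ) < numExts (fun a b : β => a < b) univ := by exact_mod_cast hM
  refine (hK (r := fun a b : β => a < b) lt_irrefl (fun _ _ _ => lt_trans) (fun A hA => ?_) hM
    (fun a b hab => ?_) x).not_ge (hx.trans_eq (piVal_eq x))
  · by_contra! hWA
    obtain ⟨a, b, hab, h⟩ := hW β ⟨A, fun a ha b hb hab hle =>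
      hA ha hb hab (lt_of_le_of_ne hle hab), hWA.le⟩
    exact (hno' a b hab).not_gt h
  · have hsum : (countBefore (fun a b : β => a < b) a b : ℝ) +
        countBefore (fun a b : β => a < b) b a = numExts (fun a b : β => a < b) univ := by
      exact_mod_cast countBefore_add_countBefore hab.symm
    have := hno' a b hab.symm
    rw [prLT_eq, prLT_eq, min_le_iff, div_le_iff₀ hM', div_le_iff₀ hM'] at this
    rcases this with h | h
    · left; linarith
    · right; linarith
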